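/- Let H ∈ (0,1/2), T > 0, ρ_1, ρ_2 ∈ ℝ ∖ {0}, and let B^H be a one-dimensional fractional Brownian motion with Hurst parameter H having continuous paths and W a standard one-dimensional Brownian motion independent of B^H, both on a complete probability space (Ω, F, μ). Suppose b : [0,T] × ℝ → ℝ can be decomposed as b = b̃ + b̂, where b̃ is measurable and bounded, and b̂ is measurable and satisfies |b̂(t,x) − b̂(t,y)| ≤ K|x − y| and |b̂(t,x)| ≤ C(1 + |x|) for all t ∈ [0,T], x, y ∈ ℝ and some constants K, C. Then for every x ∈ ℝ there exists a continuous process (X^x_t)_{0≤t≤T}, adapted to the μ-augmented filtration generated by (B^H, W), such that almost surely X^x_t = x + ∫_0^t b(u, X^x_u) du + ρ_1 B^H_t + ρ_2 W_t for all t ∈ [0,T]; moreover, any two continuous adapted processes with this property are indistinguishable. -/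

import Mathlib

open MeasureTheory ProbabilityTheory Real Set
open scoped ENNReal NNReal BigOperators

noncomputable section

/-- A one-dimensional centered Gaussian process with the fractional Brownian motion
covariance structure with Hurst parameter `H`.  For `H = 1/2` this is a standard
one-dimensional Brownian motion. -/
structure IsFBM {Ω : Type*} [MeasurableSpace Ω] (μ : Measure Ω) (H : ℝ) (B : ℝ → Ω → ℝ) :
    Prop where
  meas : ∀ t, Measurable (B t)
  gaussian : ∀ (n : ℕ) (t : Fin n → ℝ) (c : Fin n → ℝ),
    ∃ v : ℝ≥0, μ.map (fun ω => ∑ i, c i * B (t i) ω) = gaussianReal 0 v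
  cov : ∀ s t : ℝ, 0 ≤ s → 0 ≤ t →
    ∫ ω, B t ω * B s ω ∂μ = (t ^ (2 * H) + s ^ (2 * H) - |t - s| ^ (2 * H)) / 2

/-- The `μ`-augmentation of the σ-algebra generated by `(B_s, W_s)_{0 ≤ s ≤ t}`. -/
def augPairFiltration {Ω : Type*} [MeasurableSpace Ω] (μ : Measure Ω)
    (B W : ℝ → Ω → ℝ) (t : ℝ) : MeasurableSpace Ω :=
  (⨆ s ∈ Set.Icc (0 : ℝ) t,
      MeasurableSpace.comap (B s) inferInstance ⊔ MeasurableSpace.comap (W s) inferInstance) ⊔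
    MeasurableSpace.generateFrom {A : Set Ω | μ A = 0}


/-! ### Part 1: one-variable calculus for bounded drifts -/

lemma bd_intervalIntegrable {a : ℝ → ℝ} {M : ℝ} (ham : Measurable a) (haM : ∀ s, |a s| ≤ M)
    (u v : ℝ) : IntervalIntegrable a volume u v := by
  rw [intervalIntegrable_iff]
  exact Measure.integrableOn_of_bounded (M := M) (by simp) ham.aestronglyMeasurable
    (Filter.Eventually.of_forall fun s => by simpa using haM s)

lemma bd_integral_lipschitz {a : ℝ → ℝ} {M : ℝ} (ham : Measurable a) (haM : ∀ s, |a s| ≤ M)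
    (x : ℝ) (φ : ℝ → ℝ) (hφ : ∀ t, φ t = x + ∫ s in (0:ℝ)..t, a s) :
    LipschitzWith M.toNNReal φ := by
  have hM : 0 ≤ M := (abs_nonneg _).trans (haM 0)
  apply LipschitzWith.of_dist_le_mul
  intro u v
  rw [Real.dist_eq, Real.dist_eq, hφ u, hφ v, Real.coe_toNNReal _ hM]
  have : x + (∫ s in (0:ℝ)..u, a s) - (x + ∫ s in (0:ℝ)..v, a s) = ∫ s in v..u, a s := by
    rw [← intervalIntegral.integral_add_adjacent_intervals
      (bd_intervalIntegrable ham haM 0 v) (bd_intervalIntegrable ham haM v u)]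
    ring
  rw [this]
  rw [← Real.norm_eq_abs]
  exact intervalIntegral.norm_integral_le_of_norm_le_const (fun s _ => haM s)

lemma bd_ae_hasDerivAt {a : ℝ → ℝ} {M : ℝ} (ham : Measurable a) (haM : ∀ s, |a s| ≤ M)
    (x : ℝ) (φ : ℝ → ℝ) (hφ : ∀ t, φ t = x + ∫ s in (0:ℝ)..t, a s) :
    ∀ᵐ t : ℝ, HasDerivAt φ (a t) t := by
  have hloc : LocallyIntegrable a volume := by
    apply MeasureTheory.LocallyIntegrable.mono (f := fun _ : ℝ => M) (by
      exact continuous_const.locallyIntegrable) ham.aestronglyMeasurable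
    exact Filter.Eventually.of_forall fun s => by
      simpa using (haM s).trans (le_abs_self M)
  filter_upwards [LocallyIntegrable.ae_hasDerivAt_integral hloc] with t ht
  have := (ht 0).const_add x
  have h2 : φ = fun t => x + ∫ s in (0:ℝ)..t, a s := funext hφ
  rw [h2]; exact this

lemma lip_integral_eq {U u : ℝ → ℝ} {K : ℝ≥0} (hU : LipschitzWith K U)
    (hd : ∀ᵐ t : ℝ, HasDerivAt U (u t) t) (t : ℝ) :
    U t = U 0 + ∫ s in (0:ℝ)..t, u s := by
  have h1 : AbsolutelyContinuousOnInterval U 0 t :=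
    LipschitzOnWith.absolutelyContinuousOnInterval (hU.lipschitzOnWith)
  have h2 := h1.integral_deriv_eq_sub
  have h3 : ∫ s in (0:ℝ)..t, deriv U s = ∫ s in (0:ℝ)..t, u s := by
    apply intervalIntegral.integral_congr_ae
    filter_upwards [hd] with s hs _
    exact hs.deriv
  linarith

lemma bd_chain {a : ℝ → ℝ} {M : ℝ} (ham : Measurable a) (haM : ∀ s, |a s| ≤ M)
    (x : ℝ) (φ : ℝ → ℝ) (hφ : ∀ t, φ t = x + ∫ s in (0:ℝ)..t, a s)
    {F F' : ℝ → ℝ} {L : ℝ} (hF : ∀ z, HasDerivAt F (F' z) z) (hL : ∀ z, |F' z| ≤ L) (c t : ℝ) :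
    F (φ t + c) = F (x + c) + ∫ s in (0:ℝ)..t, a s * F' (φ s + c) := by
  have hlip := bd_integral_lipschitz ham haM x φ hφ
  have hL0 : 0 ≤ L := (abs_nonneg _).trans (hL 0)
  have hFl : LipschitzWith L.toNNReal F := by
    apply lipschitzWith_of_nnnorm_deriv_le (fun z => (hF z).differentiableAt)
    intro z
    rw [(hF z).deriv, ← NNReal.coe_le_coe, Real.coe_toNNReal _ hL0]
    simpa using hL z
  have hc : LipschitzWith (L.toNNReal * M.toNNReal) (fun t => F (φ t + c)) := by
    have h1 : LipschitzWith M.toNNReal (fun t => φ t + c) := by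
      intro u v
      simpa using hlip u v
    exact hFl.comp h1
  have := lip_integral_eq (u := fun s => a s * F' (φ s + c)) hc (by
    filter_upwards [bd_ae_hasDerivAt ham haM x φ hφ] with s hs
    have := (hF (φ s + c)).comp s (hs.add_const c)
    rwa [mul_comm] at this) t
  rw [this]
  have h0 : φ 0 = x := by rw [hφ]; simp
  simp [h0]

lemma bd_max {a₁ a₂ : ℝ → ℝ} {M : ℝ} (ham₁ : Measurable a₁) (haM₁ : ∀ s, |a₁ s| ≤ M)
    (ham₂ : Measurable a₂) (haM₂ : ∀ s, |a₂ s| ≤ M)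
    (x : ℝ) (φ₁ φ₂ : ℝ → ℝ) (hφ₁ : ∀ t, φ₁ t = x + ∫ s in (0:ℝ)..t, a₁ s)
    (hφ₂ : ∀ t, φ₂ t = x + ∫ s in (0:ℝ)..t, a₂ s) (t : ℝ) :
    max (φ₁ t) (φ₂ t) = x + ∫ s in (0:ℝ)..t, if φ₂ s ≤ φ₁ s then a₁ s else a₂ s := by
  have l1 := bd_integral_lipschitz ham₁ haM₁ x φ₁ hφ₁
  have l2 := bd_integral_lipschitz ham₂ haM₂ x φ₂ hφ₂
  have lU : LipschitzWith (max M.toNNReal M.toNNReal) (fun t => max (φ₁ t) (φ₂ t)) := l1.max l2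
  have hUd : ∀ᵐ s : ℝ, DifferentiableAt ℝ (fun t => max (φ₁ t) (φ₂ t)) s :=
    lU.ae_differentiableAt_real
  have := lip_integral_eq (u := fun s => if φ₂ s ≤ φ₁ s then a₁ s else a₂ s) lU (by
    filter_upwards [bd_ae_hasDerivAt ham₁ haM₁ x φ₁ hφ₁, bd_ae_hasDerivAt ham₂ haM₂ x φ₂ hφ₂, hUd]
      with s h1 h2 h3
    by_cases h : φ₂ s ≤ φ₁ s
    · rw [if_pos h]
      have hd := h3.hasDerivAt.sub h1
      rcases h.lt_or_eq with hlt | heq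
      · apply h1.congr_of_eventuallyEq
        have : ∀ᶠ y in nhds s, φ₂ y < φ₁ y :=
          (l2.continuous.tendsto s).eventually_lt (l1.continuous.tendsto s) hlt
        filter_upwards [this] with y hy
        exact max_eq_left hy.le
      · have hmin : IsLocalMin ((fun t => max (φ₁ t) (φ₂ t)) - φ₁) s := by
          apply Filter.Eventually.of_forall
          intro y
          simp [heq]
        have h0 := hmin.hasDerivAt_eq_zero hd
        have : deriv (fun t => max (φ₁ t) (φ₂ t)) s = a₁ s := by linarith
        rw [← this]; exact h3.hasDerivAt
    · rw [if_neg h]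
      push Not at h
      apply h2.congr_of_eventuallyEq
      have : ∀ᶠ y in nhds s, φ₁ y < φ₂ y :=
        (l1.continuous.tendsto s).eventually_lt (l2.continuous.tendsto s) h
      filter_upwards [this] with y hy
      exact max_eq_right hy.le) t
  rw [this]
  have h0 : φ₁ 0 = x := by rw [hφ₁]; simp
  have h0' : φ₂ 0 = x := by rw [hφ₂]; simp
  simp [h0', h0]

/-! ### Part 2: Gaussian smoothing -/

/-- Gaussian smoothing. -/
def Gs (r q : ℝ) (h : ℝ → ℝ) (z : ℝ) : ℝ := ∫ y, h (z + r * y) ∂gaussianReal 0 q.toNNReal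

/-- Gaussian smoothing weighted by the variable. -/
def Gy (r q : ℝ) (h : ℝ → ℝ) (z : ℝ) : ℝ :=
  (r * q)⁻¹ * ∫ y, h (z + r * y) * y ∂gaussianReal 0 q.toNNReal

lemma gauss_integrable_id (q : ℝ) : Integrable (fun y : ℝ => y) (gaussianReal 0 q.toNNReal) :=
  memLp_one_iff_integrable.1 (by
    have := memLp_id_gaussianReal (μ := 0) (v := q.toNNReal) 1
    exact_mod_cast this)

lemma gauss_abs_moment {q : ℝ} (hq : 0 < q) :
    ∫ y, |y| ∂gaussianReal 0 q.toNNReal ≤ √q := by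
  have h2 : Integrable (fun y : ℝ => y ^ 2) (gaussianReal 0 q.toNNReal) := by
    have := memLp_id_gaussianReal (μ := 0) (v := q.toNNReal) 2
    exact this.integrable_sq
  have hv : ∫ y, y ^ 2 ∂gaussianReal 0 q.toNNReal = q := by
    have := variance_fun_id_gaussianReal (μ := 0) (v := q.toNNReal)
    rw [variance_eq_integral measurable_id'.aemeasurable] at this
    simpa [integral_id_gaussianReal, hq.le] using this
  have hs : 0 < √q := Real.sqrt_pos.2 hq
  have hss : √q * √q = q := Real.mul_self_sqrt hq.le
  have hle : ∀ y : ℝ, |y| ≤ (2 * √q)⁻¹ * y ^ 2 + √q / 2 := by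
    intro y
    have : |y| * (2 * √q) ≤ y ^ 2 + q := by
      nlinarith [sq_nonneg (|y| - √q), sq_abs y]
    have h3 : |y| ≤ (y ^ 2 + q) / (2 * √q) := by
      rw [le_div_iff₀ (by positivity)]; exact this
    refine h3.trans (le_of_eq ?_)
    field_simp
    nlinarith
  calc ∫ y, |y| ∂gaussianReal 0 q.toNNReal
      ≤ ∫ y, ((2 * √q)⁻¹ * y ^ 2 + √q / 2) ∂gaussianReal 0 q.toNNReal := by
        apply integral_mono (gauss_integrable_id q).abs
        · exact (h2.const_mul _).add (integrable_const _)
        · exact hle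
    _ = √q := by
        rw [integral_add (h2.const_mul _) (integrable_const _), integral_const_mul, hv]
        simp
        field_simp
        nlinarith

lemma Gs_abs_le {r q : ℝ} {h : ℝ → ℝ} {K : ℝ} (hK : ∀ z, |h z| ≤ K) (z : ℝ) :
    |Gs r q h z| ≤ K := by
  unfold Gs
  have := norm_integral_le_of_norm_le_const (μ := gaussianReal 0 q.toNNReal)
    (f := fun y => h (z + r * y)) (C := K) (Filter.Eventually.of_forall fun y => hK _)
  simpa using this

lemma Gy_integrable {r q : ℝ} {h : ℝ → ℝ} {K : ℝ} (hm : Measurable h)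
    (hK : ∀ z, |h z| ≤ K) (z : ℝ) :
    Integrable (fun y => h (z + r * y) * y) (gaussianReal 0 q.toNNReal) := by
  apply (gauss_integrable_id q).bdd_mul (c := K)
  · exact (hm.comp (by fun_prop)).aestronglyMeasurable
  · exact Filter.Eventually.of_forall fun y => hK _

lemma Gy_abs_le {r q : ℝ} (hq : 0 < q) {h : ℝ → ℝ} {K : ℝ}
    (hK : ∀ z, |h z| ≤ K) (z : ℝ) :
    |Gy r q h z| ≤ K * (|r|⁻¹ * q ^ (-(1/2) : ℝ)) := by
  have hK0 : 0 ≤ K := (abs_nonneg _).trans (hK 0)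
  unfold Gy
  have h1 : |∫ y, h (z + r * y) * y ∂gaussianReal 0 q.toNNReal| ≤ K * √q := by
    have := norm_integral_le_of_norm_le (μ := gaussianReal 0 q.toNNReal)
      (f := fun y => h (z + r * y) * y) (g := fun y => K * |y|)
      ((gauss_integrable_id q).abs.const_mul K)
      (Filter.Eventually.of_forall fun y => by
        rw [norm_mul]; exact mul_le_mul_of_nonneg_right (hK _) (abs_nonneg _))
    rw [integral_const_mul] at this
    exact this.trans (mul_le_mul_of_nonneg_left (gauss_abs_moment hq) hK0)
  have hs : 0 < √q := Real.sqrt_pos.2 hq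
  have hss : √q * √q = q := Real.mul_self_sqrt hq.le
  have hr : q ^ (-(1/2) : ℝ) = (√q)⁻¹ := by
    rw [Real.rpow_neg hq.le, Real.sqrt_eq_rpow]
  rw [abs_mul, abs_inv, abs_mul, abs_of_pos hq, hr]
  calc (|r| * q)⁻¹ * |∫ y, h (z + r * y) * y ∂gaussianReal 0 q.toNNReal|
      ≤ (|r| * q)⁻¹ * (K * √q) := by gcongr
    _ = K * (|r|⁻¹ * (√q)⁻¹) := by
        rw [mul_inv]
        have : q⁻¹ = (√q)⁻¹ * (√q)⁻¹ := by rw [← mul_inv, hss]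
        rw [this]; field_simp

lemma gaussPDF_hasDerivAt {q : ℝ} (hq : 0 < q) (y : ℝ) :
    HasDerivAt (gaussianPDFReal 0 q.toNNReal) (-(y / q) * gaussianPDFReal 0 q.toNNReal y) y := by
  rw [gaussianPDFReal_def]
  simp only [Real.coe_toNNReal _ hq.le, sub_zero]
  have h1 : HasDerivAt (fun x : ℝ => -x ^ 2 / (2 * q)) (-(y / q)) y := by
    have := ((hasDerivAt_pow 2 y).neg).div_const (2 * q)
    refine this.congr_deriv ?_
    field_simp; norm_num
  refine (h1.exp.const_mul _).congr_deriv ?_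
  ring

lemma gaussPDF_integrable_iff {q : ℝ} (hq : 0 < q) {f : ℝ → ℝ}
    (hf : Integrable f (gaussianReal 0 q.toNNReal)) :
    Integrable (fun y => gaussianPDFReal 0 q.toNNReal y * f y) := by
  have hv : q.toNNReal ≠ 0 := by simpa using hq
  rw [gaussianReal_of_var_ne_zero _ hv] at hf
  rw [integrable_withDensity_iff_integrable_smul' (measurable_gaussianPDF _ _)
    (Filter.Eventually.of_forall fun _ => gaussianPDF_lt_top)] at hf
  simpa [toReal_gaussianPDF] using hf

lemma stein {r q : ℝ} (hr : r ≠ 0) (hq : 0 < q) {F F' : ℝ → ℝ} {K L : ℝ}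
    (hF : ∀ z, HasDerivAt F (F' z) z) (hK : ∀ z, |F z| ≤ K) (hL : ∀ z, |F' z| ≤ L) (z : ℝ) :
    Gs r q F' z = Gy r q F z := by
  have hv : q.toNNReal ≠ 0 := by simpa using hq
  have hFm : Measurable F := (continuous_iff_continuousAt.2 fun z => (hF z).continuousAt).measurable
  have hF'm : Measurable F' := by
    have : F' = deriv F := funext fun z => (hF z).deriv.symm
    rw [this]; exact measurable_deriv F
  unfold Gs Gy
  have hi1 := gaussPDF_integrable_iff hq (Gy_integrable (r := r) (q := q) hFm hK z)
  have hi2 : Integrable (fun y => gaussianPDFReal 0 q.toNNReal y * F' (z + r * y)) :=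
    gaussPDF_integrable_iff hq (Integrable.of_bound (C := L)
      (hF'm.comp (by fun_prop)).aestronglyMeasurable (Filter.Eventually.of_forall fun y => hL _))
  have hi3 : Integrable (fun y => gaussianPDFReal 0 q.toNNReal y * F (z + r * y)) :=
    gaussPDF_integrable_iff hq (Integrable.of_bound (C := K)
      (hFm.comp (by fun_prop)).aestronglyMeasurable (Filter.Eventually.of_forall fun y => hK _))
  have key := integral_mul_deriv_eq_deriv_mul_of_integrable
    (u := fun y => F (z + r * y)) (u' := fun y => F' (z + r * y) * r)
    (v := gaussianPDFReal 0 q.toNNReal)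
    (v' := fun y => -(y / q) * gaussianPDFReal 0 q.toNNReal y)
    (fun y _ => by
      have h1 : HasDerivAt (fun y : ℝ => z + r * y) r y := by
        simpa using ((hasDerivAt_id y).const_mul r).const_add z
      exact (hF (z + r * y)).comp y h1)
    (fun y _ => gaussPDF_hasDerivAt hq y)
    (by
      refine (hi1.const_mul (-q⁻¹)).congr (Filter.Eventually.of_forall fun y => ?_)
      simp only [Pi.mul_apply]; field_simp)
    (by
      refine (hi2.const_mul r).congr (Filter.Eventually.of_forall fun y => ?_)
      simp only [Pi.mul_apply]; ring)
    (by
      refine hi3.congr (Filter.Eventually.of_forall fun y => ?_)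
      simp only [Pi.mul_apply]; ring)
  rw [integral_gaussianReal_eq_integral_smul hv, integral_gaussianReal_eq_integral_smul hv]
  have e1 : ∫ y, F (z + r * y) * (-(y / q) * gaussianPDFReal 0 q.toNNReal y)
      = -q⁻¹ * ∫ y, gaussianPDFReal 0 q.toNNReal y • (F (z + r * y) * y) := by
    rw [← integral_const_mul]; congr 1; ext y; simp only [smul_eq_mul]; field_simp
  have e2 : ∫ y, F' (z + r * y) * r * gaussianPDFReal 0 q.toNNReal y
      = r * ∫ y, gaussianPDFReal 0 q.toNNReal y • F' (z + r * y) := by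
    rw [← integral_const_mul]; congr 1; ext y; simp only [smul_eq_mul]; ring
  rw [e1, e2] at key
  rw [mul_inv]
  have : r * ∫ y, gaussianPDFReal 0 q.toNNReal y • F' (z + r * y) =
    q⁻¹ * ∫ y, gaussianPDFReal 0 q.toNNReal y • (F (z + r * y) * y) := by linarith
  rw [mul_assoc, ← this, ← mul_assoc, inv_mul_cancel₀ hr, one_mul]

lemma Gs_hasDerivAt {r q : ℝ} (hr : r ≠ 0) (hq : 0 < q) {F F' : ℝ → ℝ} {K L : ℝ}
    (hF : ∀ z, HasDerivAt F (F' z) z) (hK : ∀ z, |F z| ≤ K) (hL : ∀ z, |F' z| ≤ L) (z : ℝ) :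
    HasDerivAt (Gs r q F') (Gy r q F' z) z := by
  have hFm : Measurable F := (continuous_iff_continuousAt.2 fun z => (hF z).continuousAt).measurable
  have hF'm : Measurable F' := by
    have : F' = deriv F := funext fun z => (hF z).deriv.symm
    rw [this]; exact measurable_deriv F
  rw [show Gs r q F' = Gy r q F from funext fun z => stein hr hq hF hK hL z]
  unfold Gy
  apply HasDerivAt.const_mul
  have := hasDerivAt_integral_of_dominated_loc_of_deriv_le
    (μ := gaussianReal 0 q.toNNReal) (F := fun z y => F (z + r * y) * y)
    (F' := fun z y => F' (z + r * y) * y) (x₀ := z) (s := univ) (bound := fun y => L * |y|)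
    Filter.univ_mem
    (Filter.Eventually.of_forall fun z => (Gy_integrable hFm hK z).aestronglyMeasurable)
    (Gy_integrable hFm hK z) (Gy_integrable hF'm hL z).aestronglyMeasurable
    (Filter.Eventually.of_forall fun y w _ => by
      rw [norm_mul]; exact mul_le_mul_of_nonneg_right (hL _) (abs_nonneg _))
    ((gauss_integrable_id q).abs.const_mul L)
    (Filter.Eventually.of_forall fun y w _ => by
      have h1 : HasDerivAt (fun w : ℝ => w + r * y) 1 w := (hasDerivAt_id w).add_const _
      have := (hF (w + r * y)).comp w h1
      rw [mul_one] at this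
      exact this.mul_const y)
  exact this.2

lemma gaussPDF_le {q : ℝ} (hq : 0 < q) (y : ℝ) :
    gaussianPDFReal 0 q.toNNReal y ≤ q ^ (-(1/2) : ℝ) := by
  rw [gaussianPDFReal_def]
  simp only [Real.coe_toNNReal _ hq.le, sub_zero]
  have hr : q ^ (-(1/2) : ℝ) = (√q)⁻¹ := by
    rw [Real.rpow_neg hq.le, Real.sqrt_eq_rpow]
  have hs : 0 < √q := Real.sqrt_pos.2 hq
  rw [hr]
  have h1 : rexp (-y ^ 2 / (2 * q)) ≤ 1 := by
    apply Real.exp_le_one_iff.2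
    apply div_nonpos_of_nonpos_of_nonneg <;> nlinarith [sq_nonneg y]
  have h2 : (√(2 * π * q))⁻¹ ≤ (√q)⁻¹ := by
    apply inv_anti₀ hs
    apply Real.sqrt_le_sqrt
    nlinarith [Real.pi_gt_three]
  calc _ ≤ (√q)⁻¹ * 1 := mul_le_mul h2 h1 (Real.exp_pos _).le (by positivity)
    _ = _ := mul_one _

lemma gaussPDF_mul_le {q : ℝ} (hq : 0 < q) (y : ℝ) :
    gaussianPDFReal 0 q.toNNReal y * |y| ≤ 1 := by
  rw [gaussianPDFReal_def]
  simp only [Real.coe_toNNReal _ hq.le, sub_zero]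
  have hs : 0 < √q := Real.sqrt_pos.2 hq
  have hss : √q * √q = q := Real.mul_self_sqrt hq.le
  have h2 : (√(2 * π * q))⁻¹ ≤ (√q * 2)⁻¹ := by
    apply inv_anti₀ (by positivity)
    rw [show √q * 2 = √((√q*2)^2) from (Real.sqrt_sq (by positivity)).symm]
    apply Real.sqrt_le_sqrt
    nlinarith [Real.pi_gt_three]
  have h1 : rexp (-y ^ 2 / (2 * q)) * |y| ≤ √q * 2 := by
    have e : -y ^ 2 / (2 * q) = -(y ^ 2 / (2 * q)) := by ring
    rw [e, Real.exp_neg, inv_mul_le_iff₀ (Real.exp_pos _)]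
    have h3 := Real.add_one_le_exp (y ^ 2 / (2 * q))
    have h4 : |y| ≤ (y ^ 2 / (2 * q) + 1) * (√q * 2) := by
      have : (y ^ 2 / (2 * q) + 1) * (√q * 2) = (y ^ 2 + 2 * q) / √q := by
        field_simp
        nlinarith
      rw [this, le_div_iff₀ hs]
      nlinarith [sq_nonneg (|y| - √q), sq_abs y]
    exact h4.trans (mul_le_mul_of_nonneg_right h3 (by positivity))
  calc (√(2 * π * q))⁻¹ * rexp (-y ^ 2 / (2 * q)) * |y|
      = (√(2 * π * q))⁻¹ * (rexp (-y ^ 2 / (2 * q)) * |y|) := by ring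
    _ ≤ (√q * 2)⁻¹ * (√q * 2) := by gcongr
    _ = 1 := inv_mul_cancel₀ (by positivity)

lemma integral_affine {r : ℝ} (hr : r ≠ 0) (F : ℝ → ℝ) (z : ℝ) :
    ∫ y, F (z + r * y) = |r|⁻¹ * ∫ y, F y := by
  have h := Measure.integral_comp_mul_left (fun y => F (z + y)) r
  rw [h, integral_add_left_eq_self (fun y => F y) z, abs_inv, smul_eq_mul]

lemma integrable_affine {r : ℝ} (hr : r ≠ 0) {F : ℝ → ℝ} (hF : Integrable F) (z : ℝ) :
    Integrable (fun y => F (z + r * y)) := by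
  have h1 : Integrable (fun y => F (z + y)) := hF.comp_add_left z
  exact h1.comp_mul_left' hr

lemma Gs_le_L1 {r q : ℝ} (hr : r ≠ 0) (hq : 0 < q) {F : ℝ → ℝ}
    (h0 : ∀ z, 0 ≤ F z) (hi : Integrable F) (z : ℝ) :
    Gs r q F z ≤ (∫ y, F y) * (|r|⁻¹ * q ^ (-(1/2) : ℝ)) := by
  have hv : q.toNNReal ≠ 0 := by simpa using hq
  unfold Gs
  rw [integral_gaussianReal_eq_integral_smul hv]
  calc _ ≤ ∫ y, q ^ (-(1/2) : ℝ) * F (z + r * y) := by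
        apply integral_mono_of_nonneg
        · exact Filter.Eventually.of_forall fun y =>
            mul_nonneg (gaussianPDFReal_nonneg _ _ _) (h0 _)
        · exact (integrable_affine hr hi z).const_mul _
        · exact Filter.Eventually.of_forall fun y =>
            mul_le_mul_of_nonneg_right (gaussPDF_le hq y) (h0 _)
    _ = _ := by rw [integral_const_mul, integral_affine hr]; ring

lemma Gy_le_L1 {r q : ℝ} (hr : r ≠ 0) (hq : 0 < q) {F : ℝ → ℝ}
    (h0 : ∀ z, 0 ≤ F z) (hi : Integrable F) (z : ℝ) :
    |Gy r q F z| ≤ (∫ y, F y) * ((|r| ^ 2)⁻¹ * q⁻¹) := by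
  have hv : q.toNNReal ≠ 0 := by simpa using hq
  unfold Gy
  rw [integral_gaussianReal_eq_integral_smul hv, abs_mul, abs_inv, abs_mul, abs_of_pos hq]
  have h1 : |∫ y, gaussianPDFReal 0 q.toNNReal y • (F (z + r * y) * y)|
      ≤ |r|⁻¹ * ∫ y, F y := by
    rw [← integral_affine hr F z]
    rw [← Real.norm_eq_abs]
    apply norm_integral_le_of_norm_le (integrable_affine hr hi z)
    refine Filter.Eventually.of_forall fun y => ?_
    rw [smul_eq_mul, Real.norm_eq_abs, abs_mul, abs_mul, abs_of_nonneg (h0 _),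
      abs_of_nonneg (gaussianPDFReal_nonneg _ _ _)]
    nlinarith [gaussPDF_mul_le hq y, h0 (z + r * y)]
  have : 0 < |r| := abs_pos.2 hr
  calc _ ≤ (|r| * q)⁻¹ * (|r|⁻¹ * ∫ y, F y) := by gcongr
    _ = _ := by field_simp


/-! ### Part 3: probabilistic set-up, independence, Duhamel formula -/

lemma indep_integral_aux {Ω Ω' : Type*} [MeasurableSpace Ω] [MeasurableSpace Ω']
    {μ : Measure Ω} [IsProbabilityMeasure μ] {X : Ω → Ω'} {ξ : Ω → ℝ} (hX : Measurable X)
    (hξ : Measurable ξ) (hi : IndepFun X ξ μ) {F : Ω' × ℝ → ℝ} (hF : Measurable F) {K : ℝ}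
    (hK : ∀ p, |F p| ≤ K) :
    ∫ ω, F (X ω, ξ ω) ∂μ = ∫ ω, ∫ y, F (X ω, y) ∂(μ.map ξ) ∂μ := by
  have h := (indepFun_iff_map_prod_eq_prod_map_map hX.aemeasurable hξ.aemeasurable).1 hi
  have := Measure.isProbabilityMeasure_map (μ := μ) hξ.aemeasurable
  have := Measure.isProbabilityMeasure_map (μ := μ) hX.aemeasurable
  rw [← integral_map (μ := μ) (φ := fun ω => (X ω, ξ ω)) (f := F)
    (hX.prodMk hξ).aemeasurable hF.aestronglyMeasurable, h,
    integral_prod _ (Integrable.of_bound (C := K) hF.aestronglyMeasurable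
      (Filter.Eventually.of_forall fun p => hK p))]
  rw [integral_map (μ := μ) (φ := X) hX.aemeasurable]
  exact (hF.stronglyMeasurable.integral_prod_right').aestronglyMeasurable

lemma indep_integral {Ω : Type*} {m : MeasurableSpace Ω} {mΩ : MeasurableSpace Ω} {μ : Measure Ω}
    [IsProbabilityMeasure μ] (hm : m ≤ mΩ) {ξ : Ω → ℝ} (hξ : Measurable ξ)
    (hi : Indep m (MeasurableSpace.comap ξ inferInstance) μ) {F : Ω × ℝ → ℝ}
    (hF : @Measurable _ _ (m.prod inferInstance) _ F) {K : ℝ} (hK : ∀ p, |F p| ≤ K) :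
    ∫ ω, F (ω, ξ ω) ∂μ = ∫ ω, ∫ y, F (ω, y) ∂(μ.map ξ) ∂μ := by
  refine @indep_integral_aux Ω Ω mΩ m μ _ id ξ (measurable_id'' hm) hξ ?_ F hF K hK
  have h2 := hi
  rw [← @MeasurableSpace.comap_id Ω m] at h2
  exact h2

/-- The probabilistic set-up: `V` is frozen noise, `W` a Brownian motion relative to `G`. -/
structure Setup {Ω : Type*} (G0 : MeasurableSpace Ω) (G : ℝ → MeasurableSpace Ω)
    [mΩ : MeasurableSpace Ω] (μ : Measure Ω) (r : ℝ) (V W : ℝ → Ω → ℝ) : Prop where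
  hr : r ≠ 0
  G0_le : ∀ t, G0 ≤ G t
  mono : Monotone G
  le : ∀ t, G t ≤ mΩ
  Vm : ∀ t, Measurable[G0] (V t)
  Vc : ∀ ω, Continuous fun t => V t ω
  Wm : ∀ t, 0 ≤ t → Measurable[G t] (W t)
  Wma : ∀ t, Measurable (W t)
  Wc : ∀ ω, Continuous fun t => W t ω
  indep : ∀ s t, 0 ≤ s → s < t →
    Indep (G s) (MeasurableSpace.comap (fun ω => W t ω - W s ω) inferInstance) μ
  law : ∀ s t, 0 ≤ s → s < t →
    μ.map (fun ω => W t ω - W s ω) = gaussianReal 0 (t - s).toNNReal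

/-- Drift processes with bounded adapted drift. -/
structure DP {Ω : Type*} (G : ℝ → MeasurableSpace Ω) [mΩ : MeasurableSpace Ω] (x M : ℝ)
    (Φ a : ℝ → Ω → ℝ) : Prop where
  am : Measurable (fun p : ℝ × Ω => a p.1 p.2)
  aG : ∀ s, 0 ≤ s → Measurable[G s] (a s)
  ab : ∀ s ω, |a s ω| ≤ M
  ΦG : ∀ s, 0 ≤ s → Measurable[G s] (Φ s)
  eq : ∀ ω t, Φ t ω = x + ∫ s in (0:ℝ)..t, a s ω

/-- Random test functions. -/
structure TF {Ω : Type*} (G0 : MeasurableSpace Ω) (f f' : Ω → ℝ → ℝ) (K L : ℝ) : Prop where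
  fm : @Measurable (Ω × ℝ) ℝ (G0.prod inferInstance) _ (fun p => f p.1 p.2)
  fm' : @Measurable (Ω × ℝ) ℝ (G0.prod inferInstance) _ (fun p => f' p.1 p.2)
  hd : ∀ ω z, HasDerivAt (f ω) (f' ω z) z
  hK : ∀ ω z, |f ω z| ≤ K
  hL : ∀ ω z, |f' ω z| ≤ L

section
variable {Ω : Type*} {G0 : MeasurableSpace Ω} {G : ℝ → MeasurableSpace Ω} [mΩ : MeasurableSpace Ω]
  {μ : Measure Ω} {r : ℝ} {V W : ℝ → Ω → ℝ}

lemma prod_le_prod {Ω : Type*} {m m' : MeasurableSpace Ω} (h : m ≤ m') :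
    m.prod (inferInstance : MeasurableSpace ℝ) ≤ m'.prod inferInstance :=
  sup_le_sup (MeasurableSpace.comap_mono h) le_rfl

lemma DP.meas_section {x M : ℝ} {Φ a : ℝ → Ω → ℝ} (D : DP G x M Φ a) (ω : Ω) :
    Measurable fun s => a s ω :=
  D.am.comp (by fun_prop : Measurable fun s : ℝ => (s, ω))

lemma DP.cont {x M : ℝ} {Φ a : ℝ → Ω → ℝ} (D : DP G x M Φ a) (ω : Ω) :
    Continuous fun s => Φ s ω :=
  (bd_integral_lipschitz (D.meas_section ω) (fun s => D.ab s ω) x _ (D.eq ω)).continuous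

lemma DP.meas {x M : ℝ} {Φ a : ℝ → Ω → ℝ} (D : DP G x M Φ a) (t : ℝ) :
    Measurable (Φ t) := by
  have : Φ t = fun ω => x + ∫ s in (0:ℝ)..t, a s ω := funext fun ω => D.eq ω t
  rw [this]
  apply Measurable.const_add
  have h1 : StronglyMeasurable (fun p : Ω × ℝ => a p.2 p.1) :=
    (D.am.comp measurable_swap).stronglyMeasurable
  simp only [intervalIntegral]
  exact (h1.integral_prod_right.measurable).sub (h1.integral_prod_right.measurable)

lemma DP.jmeas {x M : ℝ} {Φ a : ℝ → Ω → ℝ} (D : DP G x M Φ a) :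
    Measurable (fun p : ℝ × Ω => Φ p.1 p.2) :=
  measurable_uncurry_of_continuous_of_measurable (u := Φ) D.cont D.meas

lemma TF.amb (S : Setup G0 G μ r V W) {f : Ω → ℝ → ℝ}
    (h : @Measurable (Ω × ℝ) ℝ (G0.prod inferInstance) _ (fun p => f p.1 p.2)) :
    Measurable (fun p : Ω × ℝ => f p.1 p.2) :=
  h.mono (prod_le_prod ((S.G0_le 0).trans (S.le 0))) le_rfl

lemma duhamel [IsProbabilityMeasure μ] (S : Setup G0 G μ r V W) {x M : ℝ} {Φ a : ℝ → Ω → ℝ}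
    (D : DP G x M Φ a) {f f' : Ω → ℝ → ℝ} {K L : ℝ} (hf : TF G0 f f' K L) {t : ℝ} (ht : 0 ≤ t) :
    IntervalIntegrable (fun s => ∫ ω, a s ω * Gs r (t - s) (f' ω) (Φ s ω + r * W s ω) ∂μ)
      volume 0 t ∧
    ∫ ω, f ω (Φ t ω + r * W t ω) ∂μ = ∫ ω, f ω (x + r * W t ω) ∂μ +
      ∫ s in (0:ℝ)..t, ∫ ω, a s ω * Gs r (t - s) (f' ω) (Φ s ω + r * W s ω) ∂μ := by
  have fma := TF.amb S hf.fm
  have fma' := TF.amb S hf.fm'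
  have hj : Measurable (fun p : ℝ × Ω => a p.1 p.2 * f' p.2 (Φ p.1 p.2 + r * W t p.2)) := by
    apply D.am.mul
    have : Measurable (fun p : ℝ × Ω => (p.2, Φ p.1 p.2 + r * W t p.2)) :=
      measurable_snd.prodMk (D.jmeas.add (((S.Wma t).comp measurable_snd).const_mul r))
    exact fma'.comp this
  have hL0 : ∀ ω : Ω, 0 ≤ L := fun ω => (abs_nonneg _).trans (hf.hL ω 0)
  have hM0 : ∀ ω : Ω, 0 ≤ M := fun ω => (abs_nonneg _).trans (D.ab 0 ω)
  have hbd : ∀ p : ℝ × Ω, ‖a p.1 p.2 * f' p.2 (Φ p.1 p.2 + r * W t p.2)‖ ≤ M * L := fun p => by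
    rw [norm_mul]
    exact mul_le_mul (D.ab _ _) (hf.hL _ _) (norm_nonneg _) (hM0 p.2)
  have hIg : Integrable (fun p : ℝ × Ω => a p.1 p.2 * f' p.2 (Φ p.1 p.2 + r * W t p.2))
      ((volume.restrict (Ioc 0 t)).prod μ) :=
    Integrable.of_bound hj.aestronglyMeasurable _ (Filter.Eventually.of_forall hbd)
  -- the frozen identity
  have hpath : ∀ ω, f ω (Φ t ω + r * W t ω) = f ω (x + r * W t ω) +
      ∫ s in (0:ℝ)..t, a s ω * f' ω (Φ s ω + r * W t ω) := fun ω =>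
    bd_chain (D.meas_section ω) (fun s => D.ab s ω) x (fun t => Φ t ω) (D.eq ω) (hf.hd ω) (hf.hL ω)
      (r * W t ω) t
  -- the independence step
  have hstep : ∀ s ∈ Ico 0 t, ∫ ω, a s ω * f' ω (Φ s ω + r * W t ω) ∂μ =
      ∫ ω, a s ω * Gs r (t - s) (f' ω) (Φ s ω + r * W s ω) ∂μ := by
    intro s hs
    have hWi := S.indep s t hs.1 hs.2
    have hm : Measurable (fun ω => W t ω - W s ω) := (S.Wma t).sub (S.Wma s)
    have hF : @Measurable (Ω × ℝ) ℝ ((G s).prod inferInstance) _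
        (fun p => a s p.1 * f' p.1 (Φ s p.1 + r * W s p.1 + r * p.2)) := by
      have h1 : @Measurable (Ω × ℝ) Ω ((G s).prod inferInstance) (G s) Prod.fst :=
        @measurable_fst Ω ℝ (G s) _
      have h2 : @Measurable (Ω × ℝ) ℝ ((G s).prod inferInstance) _ Prod.snd :=
        @measurable_snd Ω ℝ (G s) _
      have ha := (D.aG s hs.1).comp h1
      have hΦ := (D.ΦG s hs.1).comp h1
      have hW := (S.Wm s hs.1).comp h1
      refine ha.mul ?_
      have hz := (hΦ.add (hW.const_mul r)).add (h2.const_mul r)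
      have hff := hf.fm'.mono (prod_le_prod (S.G0_le s)) le_rfl
      exact hff.comp (Measurable.prodMk h1 hz)
    have key := indep_integral (μ := μ) (S.le s) hm hWi hF (K := M * L) (fun p => by
      rw [abs_mul]
      exact mul_le_mul (D.ab _ _) (hf.hL _ _) (abs_nonneg _) (hM0 p.1))
    rw [S.law s t hs.1 hs.2] at key
    simp only [] at key
    have e1 : ∀ ω, Φ s ω + r * W s ω + r * (W t ω - W s ω) = Φ s ω + r * W t ω := fun ω => by ring
    simp only [e1] at key
    rw [key]
    refine integral_congr_ae (Filter.Eventually.of_forall fun ω => ?_)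
    simp only [Gs]
    rw [integral_const_mul]
  have hae : ∀ᵐ s ∂(volume : Measure ℝ), s ∈ uIoc (0:ℝ) t →
      ∫ ω, a s ω * f' ω (Φ s ω + r * W t ω) ∂μ =
      ∫ ω, a s ω * Gs r (t - s) (f' ω) (Φ s ω + r * W s ω) ∂μ := by
    have : ∀ᵐ s ∂(volume : Measure ℝ), s ≠ t := by
      simp [ae_iff]
    filter_upwards [this] with s hs hs'
    rw [uIoc_of_le ht] at hs'
    exact hstep s ⟨hs'.1.le, lt_of_le_of_ne hs'.2 hs⟩
  have hI : IntervalIntegrable (fun s => ∫ ω, a s ω * f' ω (Φ s ω + r * W t ω) ∂μ) volume 0 t := by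
    rw [intervalIntegrable_iff_integrableOn_Ioc_of_le ht]
    exact hIg.integral_prod_left
  refine ⟨?_, ?_⟩
  · refine hI.congr_ae ?_
    rw [Filter.EventuallyEq, ae_restrict_iff' measurableSet_uIoc]
    exact hae
  · rw [← intervalIntegral.integral_congr_ae hae]
    simp_rw [hpath]
    have hfi : Integrable (fun ω => f ω (x + r * W t ω)) μ := by
      refine Integrable.of_bound (C := K) ?_ (Filter.Eventually.of_forall fun ω => hf.hK _ _)
      exact (fma.comp (measurable_id.prodMk
        (((S.Wma t).const_mul r).const_add x))).aestronglyMeasurable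
    simp only [intervalIntegral.integral_of_le ht]
    rw [integral_add hfi, integral_integral_swap]
    · exact hIg.swap
    · exact hIg.integral_prod_right

end


/-! ### Part 4: stability of one-dimensional laws -/

/-- Smooth reference drifts. -/
structure RC (c c' : ℝ → ℝ → ℝ) (M L : ℝ) : Prop where
  cc : Continuous (fun p : ℝ × ℝ => c p.1 p.2)
  cc' : Continuous (fun p : ℝ × ℝ => c' p.1 p.2)
  hd : ∀ s z, HasDerivAt (c s) (c' s z) z
  hM : ∀ s z, |c s z| ≤ M
  hL : ∀ s z, |c' s z| ≤ L

lemma Gs_measurable {Ω : Type*} [MeasurableSpace Ω] (r q : ℝ) {f : Ω → ℝ → ℝ}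
    (hf : Measurable (fun p : Ω × ℝ => f p.1 p.2)) :
    Measurable (fun p : Ω × ℝ => Gs r q (f p.1) p.2) := by
  unfold Gs
  have h : Measurable (fun p : (Ω × ℝ) × ℝ => f p.1.1 (p.1.2 + r * p.2)) :=
    hf.comp ((measurable_fst.comp measurable_fst).prodMk
      (by fun_prop : Measurable fun p : (Ω × ℝ) × ℝ => p.1.2 + r * p.2))
  exact h.stronglyMeasurable.integral_prod_right.measurable

lemma Gy_measurable {Ω : Type*} [MeasurableSpace Ω] (r q : ℝ) {f : Ω → ℝ → ℝ}
    (hf : Measurable (fun p : Ω × ℝ => f p.1 p.2)) :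
    Measurable (fun p : Ω × ℝ => Gy r q (f p.1) p.2) := by
  unfold Gy
  have h : Measurable (fun p : (Ω × ℝ) × ℝ => f p.1.1 (p.1.2 + r * p.2) * p.2) :=
    (hf.comp ((measurable_fst.comp measurable_fst).prodMk
      (by fun_prop : Measurable fun p : (Ω × ℝ) × ℝ => p.1.2 + r * p.2))).mul measurable_snd
  exact h.stronglyMeasurable.integral_prod_right.measurable.const_mul _

lemma shift_measurable {Ω : Type*} [MeasurableSpace Ω] {g : ℝ → ℝ} (hg : Continuous g)
    {v : Ω → ℝ} (hv : Measurable v) :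
    Measurable (fun p : Ω × ℝ => g (p.2 + v p.1)) :=
  hg.measurable.comp (measurable_snd.add (hv.comp measurable_fst))

lemma tf_shift {Ω : Type*} {G0 : MeasurableSpace Ω} {ψ ψ' : ℝ → ℝ} {K L : ℝ}
    (hd : ∀ z, HasDerivAt ψ (ψ' z) z) (hc : Continuous ψ') (hK : ∀ z, |ψ z| ≤ K)
    (hL : ∀ z, |ψ' z| ≤ L) {v : Ω → ℝ} (hv : Measurable[G0] v) :
    TF G0 (fun ω z => ψ (z + v ω)) (fun ω z => ψ' (z + v ω)) K L where
  fm := @shift_measurable Ω G0 ψ (continuous_iff_continuousAt.2 fun z => (hd z).continuousAt) v hv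
  fm' := @shift_measurable Ω G0 ψ' hc v hv
  hd ω z := by
    have := (hd (z + v ω)).comp z ((hasDerivAt_id z).add_const (v ω))
    rw [mul_one] at this; exact this
  hK ω z := hK _
  hL ω z := hL _

lemma RC.cont {c c' : ℝ → ℝ → ℝ} {M L : ℝ} (R : RC c c' M L) (s : ℝ) : Continuous (c s) :=
  R.cc.comp (by fun_prop : Continuous fun z : ℝ => (s, z))

lemma RC.cont' {c c' : ℝ → ℝ → ℝ} {M L : ℝ} (R : RC c c' M L) (s : ℝ) : Continuous (c' s) :=
  R.cc'.comp (by fun_prop : Continuous fun z : ℝ => (s, z))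

lemma tf_step {Ω : Type*} {G0 : MeasurableSpace Ω} {c c' : ℝ → ℝ → ℝ} {M L₀ : ℝ}
    (R : RC c c' M L₀) {f f' : Ω → ℝ → ℝ} {K L : ℝ} (hf : TF G0 f f' K L) {r q : ℝ}
    (hr : r ≠ 0) (hq : 0 < q) (s : ℝ) {v : Ω → ℝ} (hv : Measurable[G0] v) :
    TF G0 (fun ω z => c s (z + v ω) * Gs r q (f' ω) z)
      (fun ω z => c' s (z + v ω) * Gs r q (f' ω) z + c s (z + v ω) * Gy r q (f' ω) z)
      (M * (K * (|r|⁻¹ * q ^ (-(1/2) : ℝ))))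
      (L₀ * (K * (|r|⁻¹ * q ^ (-(1/2) : ℝ))) + M * (L * (|r|⁻¹ * q ^ (-(1/2) : ℝ)))) where
  fm := (@shift_measurable Ω G0 _ (R.cont s) v hv).mul (@Gs_measurable Ω G0 r q f' hf.fm')
  fm' := ((@shift_measurable Ω G0 _ (R.cont' s) v hv).mul (@Gs_measurable Ω G0 r q f' hf.fm')).add
    ((@shift_measurable Ω G0 _ (R.cont s) v hv).mul (@Gy_measurable Ω G0 r q f' hf.fm'))
  hd ω z := by
    have h1 : HasDerivAt (fun z => c s (z + v ω)) (c' s (z + v ω)) z := by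
      have := (R.hd s (z + v ω)).comp z ((hasDerivAt_id z).add_const (v ω))
      rw [mul_one] at this; exact this
    exact h1.mul (Gs_hasDerivAt hr hq (hf.hd ω) (hf.hK ω) (hf.hL ω) z)
  hK ω z := by
    rw [abs_mul, stein hr hq (hf.hd ω) (hf.hK ω) (hf.hL ω)]
    exact mul_le_mul (R.hM _ _) (Gy_abs_le hq (hf.hK ω) z) (abs_nonneg _)
      ((abs_nonneg _).trans (R.hM 0 0))
  hL ω z := by
    refine (abs_add_le _ _).trans (add_le_add ?_ ?_)
    · rw [abs_mul, stein hr hq (hf.hd ω) (hf.hK ω) (hf.hL ω)]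
      exact mul_le_mul (R.hL _ _) (Gy_abs_le hq (hf.hK ω) z) (abs_nonneg _)
        ((abs_nonneg _).trans (R.hL 0 0))
    · rw [abs_mul]
      exact mul_le_mul (R.hM _ _) (Gy_abs_le hq (hf.hL ω) z) (abs_nonneg _)
        ((abs_nonneg _).trans (R.hM 0 0))

lemma sing_le {u B : ℝ} (hu : 0 < u) (hB : 0 < B) :
    u ^ (-(1/2) : ℝ) ≤ B ^ 2 + B⁻¹ * u ^ (-(3/4) : ℝ) := by
  have hw : 0 < u ^ (-(1/4) : ℝ) := Real.rpow_pos_of_pos hu _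
  have e1 : u ^ (-(1/2) : ℝ) = (u ^ (-(1/4) : ℝ)) ^ 2 := by
    rw [← Real.rpow_natCast, ← Real.rpow_mul hu.le]; norm_num
  have e2 : u ^ (-(3/4) : ℝ) = (u ^ (-(1/4) : ℝ)) ^ 3 := by
    rw [← Real.rpow_natCast, ← Real.rpow_mul hu.le]; norm_num
  rw [e1, e2]
  set w := u ^ (-(1/4) : ℝ)
  rcases le_total w B with h | h
  · have : 0 ≤ B⁻¹ * w ^ 3 := by positivity
    nlinarith
  · have : w ^ 2 ≤ B⁻¹ * w ^ 3 := by
      rw [inv_mul_eq_div, le_div_iff₀ hB]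
      nlinarith [sq_nonneg w]
    nlinarith [sq_nonneg B]

lemma sing_integrable {t p : ℝ} (hp : -1 < p) :
    IntervalIntegrable (fun s => (t - s) ^ p) volume 0 t := by
  have := (intervalIntegral.intervalIntegrable_rpow' (a := 0) (b := t) hp).comp_sub_left t
  simpa using this.symm

lemma sing_integral {t : ℝ} (_ht : 0 ≤ t) :
    ∫ s in (0:ℝ)..t, (t - s) ^ (-(3/4) : ℝ) = 4 * t ^ (1/4 : ℝ) := by
  rw [intervalIntegral.integral_comp_sub_left (fun u => u ^ (-(3/4) : ℝ)) t]
  rw [integral_rpow (by norm_num)]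
  norm_num
  ring

lemma avg_intervalIntegrable {Ω : Type*} [MeasurableSpace Ω] {μ : Measure Ω}
    [IsProbabilityMeasure μ] {g : ℝ → Ω → ℝ} (hg : Measurable (fun p : ℝ × Ω => g p.1 p.2))
    {M : ℝ} (hM : ∀ s ω, |g s ω| ≤ M) (u v : ℝ) :
    IntervalIntegrable (fun s => ∫ ω, g s ω ∂μ) volume u v := by
  apply bd_intervalIntegrable (M := M)
  · exact hg.stronglyMeasurable.integral_prod_right.measurable
  · intro s
    have := norm_integral_le_of_norm_le_const (μ := μ) (f := fun ω => g s ω) (C := M)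
      (Filter.Eventually.of_forall fun y => hM s y)
    simpa using this

section
variable {Ω : Type*} {G0 : MeasurableSpace Ω} {G : ℝ → MeasurableSpace Ω} [mΩ : MeasurableSpace Ω]
  {μ : Measure Ω} {r : ℝ} {V W : ℝ → Ω → ℝ}

lemma Setup.Vj (S : Setup G0 G μ r V W) : Measurable (fun p : ℝ × Ω => V p.1 p.2) :=
  measurable_uncurry_of_continuous_of_measurable (u := V) S.Vc
    (fun t => (S.Vm t).mono ((S.G0_le 0).trans (S.le 0)) le_rfl)

lemma Setup.Wj (S : Setup G0 G μ r V W) : Measurable (fun p : ℝ × Ω => W p.1 p.2) :=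
  measurable_uncurry_of_continuous_of_measurable (u := W) S.Wc S.Wma

lemma Setup.Vma (S : Setup G0 G μ r V W) (t : ℝ) : Measurable (V t) :=
  (S.Vm t).mono ((S.G0_le 0).trans (S.le 0)) le_rfl

lemma tf_integrable [IsProbabilityMeasure μ] (S : Setup G0 G μ r V W) {f f' : Ω → ℝ → ℝ} {K L : ℝ}
    (hf : TF G0 f f' K L) {z : Ω → ℝ} (hz : Measurable z) : Integrable (fun ω => f ω (z ω)) μ := by
  refine Integrable.of_bound (C := K) ?_ (Filter.Eventually.of_forall fun ω => hf.hK _ _)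
  exact ((TF.amb S hf.fm).comp (measurable_id.prodMk hz)).aestronglyMeasurable

/-- The state process attached to a drift process. -/
def st (r : ℝ) (V W Φ : ℝ → Ω → ℝ) (s : ℝ) (ω : Ω) : ℝ := Φ s ω + r * W s ω + V s ω

lemma st_jmeas (S : Setup G0 G μ r V W) {x M : ℝ} {Φ a : ℝ → Ω → ℝ} (D : DP G x M Φ a) :
    Measurable (fun p : ℝ × Ω => st r V W Φ p.1 p.2) :=
  (D.jmeas.add (S.Wj.const_mul r)).add S.Vj

lemma st_meas (S : Setup G0 G μ r V W) {x M : ℝ} {Φ a : ℝ → Ω → ℝ} (D : DP G x M Φ a) (t : ℝ) :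
    Measurable (st r V W Φ t) :=
  ((D.meas t).add ((S.Wma t).const_mul r)).add (S.Vma t)

lemma d_iter [IsProbabilityMeasure μ] (S : Setup G0 G μ r V W) {x M₁ : ℝ} {Φ₁ a₁ Φ₂ a₂ : ℝ → Ω → ℝ}
    (D₁ : DP G x M₁ Φ₁ a₁) (D₂ : DP G x M₁ Φ₂ a₂) {c c' : ℝ → ℝ → ℝ} {M L₀ : ℝ}
    (R : RC c c' M L₀) {T : ℝ} 
    (h₂ : ∀ s ∈ Icc 0 T, ∀ ω, a₂ s ω = c s (st r V W Φ₂ s ω))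
    {A B l : ℝ} (hA : 0 < A) (hB : 0 < B) (hl : 0 < l)
    (hhalf : M * |r|⁻¹ * (A ^ 2 / l + A⁻¹ * (4 * T ^ (1/4 : ℝ))) ≤ 1 / 2)
    {k : ℝ} (hk0 : 0 ≤ k)
    (hk : ∀ s ∈ Icc 0 T, ∀ (f f' : Ω → ℝ → ℝ) (K L : ℝ), TF G0 f f' K L →
      |∫ ω, f ω (Φ₁ s ω + r * W s ω) ∂μ - ∫ ω, f ω (Φ₂ s ω + r * W s ω) ∂μ| ≤
        k * rexp (l * s) * K)
    {t : ℝ} (ht : t ∈ Icc 0 T) {f f' : Ω → ℝ → ℝ} {K L : ℝ} (hf : TF G0 f f' K L) :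
    |∫ ω, f ω (Φ₁ t ω + r * W t ω) ∂μ - ∫ ω, f ω (Φ₂ t ω + r * W t ω) ∂μ| ≤
      (k / 2 + |r|⁻¹ * (B ^ 2 * (∫ s in (0:ℝ)..T, ∫ ω, |a₁ s ω - c s (st r V W Φ₁ s ω)| ∂μ) +
        (M₁ + M) * B⁻¹ * (4 * T ^ (1/4 : ℝ)))) * rexp (l * t) * K := by
  obtain ⟨ω₀⟩ : Nonempty Ω := nonempty_of_isProbabilityMeasure μ
  have hK0 : 0 ≤ K := (abs_nonneg _).trans (hf.hK ω₀ 0)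
  have hM0 : 0 ≤ M := (abs_nonneg _).trans (R.hM 0 0)
  have hM10 : 0 ≤ M₁ := (abs_nonneg _).trans (D₁.ab 0 ω₀)
  have hr0 : 0 < |r|⁻¹ := inv_pos.2 (abs_pos.2 S.hr)
  have hT0 : 0 ≤ T := ht.1.trans ht.2
  obtain ⟨hi1, he1⟩ := duhamel S D₁ hf ht.1
  obtain ⟨hi2, he2⟩ := duhamel S D₂ hf ht.1
  set e : ℝ → Ω → ℝ := fun s ω => a₁ s ω - c s (st r V W Φ₁ s ω) with he
  have hcj : ∀ {Φ a : ℝ → Ω → ℝ}, DP G x M₁ Φ a →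
      Measurable (fun p : ℝ × Ω => c p.1 (st r V W Φ p.1 p.2)) := fun D =>
    R.cc.measurable.comp (measurable_fst.prodMk (st_jmeas S D))
  have hej : Measurable (fun p : ℝ × Ω => e p.1 p.2) := D₁.am.sub (hcj D₁)
  have heb : ∀ s ω, |e s ω| ≤ M₁ + M := fun s ω =>
    (abs_sub _ _).trans (add_le_add (D₁.ab _ _) (R.hM _ _))
  set η : ℝ → ℝ := fun s => ∫ ω, |e s ω| ∂μ with hη
  have hη0 : ∀ s, 0 ≤ η s := fun s => integral_nonneg fun ω => abs_nonneg _
  have hηi : ∀ u v, IntervalIntegrable η volume u v := fun u v =>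
    avg_intervalIntegrable (g := fun s ω => |e s ω|) hej.abs
      (M := M₁ + M) (fun s ω => by rw [abs_abs]; exact heb s ω) u v
  have hηM : ∀ s, η s ≤ M₁ + M := by
    intro s
    have := norm_integral_le_of_norm_le_const (μ := μ) (f := fun ω => |e s ω|) (C := M₁ + M)
      (Filter.Eventually.of_forall fun y => by rw [Real.norm_eq_abs, abs_abs]; exact heb s y)
    refine (le_abs_self _).trans ?_
    simpa using this
  have hei : ∀ s, Integrable (fun ω => |e s ω|) μ := fun s =>
    Integrable.of_bound (C := M₁ + M)
      ((hej.comp (by fun_prop : Measurable fun ω : Ω => (s, ω))).abs.aestronglyMeasurable)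
      (Filter.Eventually.of_forall fun ω => by rw [Real.norm_eq_abs, abs_abs]; exact heb s ω)
  -- the dominating function
  set g : ℝ → ℝ := fun s => K * |r|⁻¹ * (k * M * (A ^ 2 * rexp (l * s) +
    A⁻¹ * rexp (l * t) * (t - s) ^ (-(3/4) : ℝ)) +
    (B ^ 2 * η s + (M₁ + M) * B⁻¹ * (t - s) ^ (-(3/4) : ℝ))) with hg
  have hI1 : IntervalIntegrable (fun s => rexp (l * s)) volume 0 t :=
    (by fun_prop : Continuous fun s => rexp (l * s)).intervalIntegrable _ _
  have hI2 : IntervalIntegrable (fun s => (t - s) ^ (-(3/4) : ℝ)) volume 0 t :=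
    sing_integrable (by norm_num)
  have hgi : IntervalIntegrable g volume 0 t :=
    ((((hI1.const_mul _).add (hI2.const_mul _)).const_mul _).add
      (((hηi 0 t).const_mul _).add (hI2.const_mul _))).const_mul _
  have hdiff : ∫ ω, f ω (Φ₁ t ω + r * W t ω) ∂μ - ∫ ω, f ω (Φ₂ t ω + r * W t ω) ∂μ =
      ∫ s in (0:ℝ)..t, ((∫ ω, a₁ s ω * Gs r (t - s) (f' ω) (Φ₁ s ω + r * W s ω) ∂μ) -
        ∫ ω, a₂ s ω * Gs r (t - s) (f' ω) (Φ₂ s ω + r * W s ω) ∂μ) := by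
    rw [intervalIntegral.integral_sub hi1 hi2, he1, he2]; ring
  have hpt : ∀ s ∈ Ico 0 t, |(∫ ω, a₁ s ω * Gs r (t - s) (f' ω) (Φ₁ s ω + r * W s ω) ∂μ) -
        ∫ ω, a₂ s ω * Gs r (t - s) (f' ω) (Φ₂ s ω + r * W s ω) ∂μ| ≤ g s := by
    intro s hs
    have hsT : s ∈ Icc 0 T := ⟨hs.1, hs.2.le.trans ht.2⟩
    have hq : 0 < t - s := sub_pos.2 hs.2
    have hu := tf_step R hf S.hr hq s (S.Vm s)
    set q := (t - s) ^ (-(1/2) : ℝ) with hqdef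
    have hq0 : 0 ≤ q := Real.rpow_nonneg hq.le _
    have hm1 : Measurable fun ω => Φ₁ s ω + r * W s ω := (D₁.meas s).add ((S.Wma s).const_mul r)
    have hm2 : Measurable fun ω => Φ₂ s ω + r * W s ω := (D₂.meas s).add ((S.Wma s).const_mul r)
    have hGb : ∀ ω z, |Gs r (t - s) (f' ω) z| ≤ K * (|r|⁻¹ * q) := fun ω z => by
      rw [stein S.hr hq (hf.hd ω) (hf.hK ω) (hf.hL ω)]
      exact Gy_abs_le hq (hf.hK ω) z
    have hGm : Measurable (fun ω => Gs r (t - s) (f' ω) (Φ₁ s ω + r * W s ω)) :=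
      (Gs_measurable r (t - s) (TF.amb S hf.fm')).comp (measurable_id.prodMk hm1)
    have e2 : ∫ ω, a₂ s ω * Gs r (t - s) (f' ω) (Φ₂ s ω + r * W s ω) ∂μ =
        ∫ ω, c s (Φ₂ s ω + r * W s ω + V s ω) * Gs r (t - s) (f' ω) (Φ₂ s ω + r * W s ω) ∂μ := by
      congr 1; ext ω; rw [h₂ s hsT ω]; rfl
    have e1 : ∫ ω, a₁ s ω * Gs r (t - s) (f' ω) (Φ₁ s ω + r * W s ω) ∂μ =
        ∫ ω, c s (Φ₁ s ω + r * W s ω + V s ω) * Gs r (t - s) (f' ω) (Φ₁ s ω + r * W s ω) ∂μ +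
        ∫ ω, e s ω * Gs r (t - s) (f' ω) (Φ₁ s ω + r * W s ω) ∂μ := by
      rw [← integral_add]
      · congr 1; ext ω; simp only [he, st]; ring
      · exact tf_integrable S hu hm1
      · refine Integrable.of_bound (C := (M₁ + M) * (K * (|r|⁻¹ * q))) ?_
          (Filter.Eventually.of_forall fun ω => ?_)
        · exact ((hej.comp (by fun_prop : Measurable fun ω : Ω => (s, ω))).mul
            hGm).aestronglyMeasurable
        · rw [norm_mul]
          exact mul_le_mul (heb _ _) (hGb _ _) (abs_nonneg _) (by positivity)
    have hA1 := hk s hsT _ _ _ _ hu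
    have hA2 : |∫ ω, e s ω * Gs r (t - s) (f' ω) (Φ₁ s ω + r * W s ω) ∂μ| ≤
        η s * (K * (|r|⁻¹ * q)) := by
      rw [hη]; simp only []
      rw [← integral_mul_const, ← Real.norm_eq_abs]
      apply norm_integral_le_of_norm_le ((hei s).mul_const _)
      refine Filter.Eventually.of_forall fun ω => ?_
      rw [norm_mul]
      exact mul_le_mul_of_nonneg_left (hGb _ _) (abs_nonneg _)
    rw [e1, e2]
    have hsA := sing_le hq hA
    have hsB := sing_le hq hB
    rw [← hqdef] at hsA hsB
    set w := (t - s) ^ (-(3/4) : ℝ) with hw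
    have hw0 : 0 ≤ w := Real.rpow_nonneg hq.le _
    have hexp : rexp (l * s) ≤ rexp (l * t) := Real.exp_le_exp.2 (by nlinarith [hs.2])
    have hb1 : rexp (l * s) * q ≤ A ^ 2 * rexp (l * s) + A⁻¹ * rexp (l * t) * w := by
      calc rexp (l * s) * q ≤ rexp (l * s) * (A ^ 2 + A⁻¹ * w) := by gcongr
        _ = A ^ 2 * rexp (l * s) + A⁻¹ * rexp (l * s) * w := by ring
        _ ≤ _ := by gcongr
    have hb2 : η s * q ≤ B ^ 2 * η s + (M₁ + M) * B⁻¹ * w := by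
      calc η s * q ≤ η s * (B ^ 2 + B⁻¹ * w) := mul_le_mul_of_nonneg_left hsB (hη0 s)
        _ = B ^ 2 * η s + η s * (B⁻¹ * w) := by ring
        _ ≤ B ^ 2 * η s + (M₁ + M) * (B⁻¹ * w) := by
            have := mul_le_mul_of_nonneg_right (hηM s) (by positivity : 0 ≤ B⁻¹ * w)
            linarith
        _ = _ := by ring
    calc _ ≤ |∫ ω, c s (Φ₁ s ω + r * W s ω + V s ω) * Gs r (t - s) (f' ω) (Φ₁ s ω + r * W s ω) ∂μ -
          ∫ ω, c s (Φ₂ s ω + r * W s ω + V s ω) * Gs r (t - s) (f' ω) (Φ₂ s ω + r * W s ω) ∂μ| +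
          |∫ ω, e s ω * Gs r (t - s) (f' ω) (Φ₁ s ω + r * W s ω) ∂μ| := by
            refine le_trans (le_of_eq ?_) (abs_add_le _ _); congr 1; ring
      _ ≤ k * rexp (l * s) * (M * (K * (|r|⁻¹ * q))) + η s * (K * (|r|⁻¹ * q)) :=
            add_le_add hA1 hA2
      _ = K * |r|⁻¹ * (k * M * (rexp (l * s) * q) + η s * q) := by ring
      _ ≤ g s := by
          rw [hg]
          apply mul_le_mul_of_nonneg_left _ (by positivity)
          exact add_le_add (mul_le_mul_of_nonneg_left hb1 (by positivity)) hb2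
  have hfin : |∫ s in (0:ℝ)..t, ((∫ ω, a₁ s ω * Gs r (t - s) (f' ω) (Φ₁ s ω + r * W s ω) ∂μ) -
        ∫ ω, a₂ s ω * Gs r (t - s) (f' ω) (Φ₂ s ω + r * W s ω) ∂μ)| ≤ ∫ s in (0:ℝ)..t, g s := by
    rw [← Real.norm_eq_abs]
    apply intervalIntegral.norm_integral_le_of_norm_le ht.1 _ hgi
    have : ∀ᵐ s ∂(volume : Measure ℝ), s ≠ t := by simp [ae_iff]
    filter_upwards [this] with s hs hs'
    exact hpt s ⟨hs'.1.le, lt_of_le_of_ne hs'.2 hs⟩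
  rw [hdiff]
  refine hfin.trans ?_
  have hE1 : ∫ s in (0:ℝ)..t, rexp (l * s) ≤ rexp (l * t) / l := by
    rw [intervalIntegral.integral_comp_mul_left (fun x => rexp x) hl.ne', integral_exp]
    rw [smul_eq_mul, div_eq_inv_mul]
    apply mul_le_mul_of_nonneg_left _ (by positivity)
    have := Real.exp_pos (l * 0)
    linarith
  have hE2 : t ^ (1/4 : ℝ) ≤ T ^ (1/4 : ℝ) := Real.rpow_le_rpow ht.1 ht.2 (by norm_num)
  have hE3 : ∫ s in (0:ℝ)..t, η s ≤ ∫ s in (0:ℝ)..T, η s := by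
    rw [← intervalIntegral.integral_add_adjacent_intervals (hηi 0 t) (hηi t T)]
    have := intervalIntegral.integral_nonneg (μ := volume) ht.2 (fun u _ => hη0 u)
    linarith
  have hgI : ∫ s in (0:ℝ)..t, g s = K * |r|⁻¹ * (k * M * (A ^ 2 * (∫ s in (0:ℝ)..t, rexp (l * s)) +
    A⁻¹ * rexp (l * t) * (4 * t ^ (1/4 : ℝ))) +
    (B ^ 2 * (∫ s in (0:ℝ)..t, η s) + (M₁ + M) * B⁻¹ * (4 * t ^ (1/4 : ℝ)))) := by
    rw [hg]
    rw [intervalIntegral.integral_const_mul, intervalIntegral.integral_add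
      (((hI1.const_mul _).add (hI2.const_mul _)).const_mul _)
      (((hηi 0 t).const_mul _).add (hI2.const_mul _)), intervalIntegral.integral_const_mul,
      intervalIntegral.integral_add (hI1.const_mul _) (hI2.const_mul _),
      intervalIntegral.integral_add ((hηi 0 t).const_mul _) (hI2.const_mul _)]
    simp only [intervalIntegral.integral_const_mul]
    rw [sing_integral ht.1]
  rw [hgI]
  have h1e : 1 ≤ rexp (l * t) := Real.one_le_exp (mul_nonneg hl.le ht.1)
  have hηT : 0 ≤ ∫ s in (0:ℝ)..T, η s :=
    intervalIntegral.integral_nonneg (μ := volume) hT0 (fun u _ => hη0 u)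
  have hTr : 0 ≤ T ^ (1/4 : ℝ) := Real.rpow_nonneg hT0 _
  calc _ ≤ K * |r|⁻¹ * (k * M * (A ^ 2 * (rexp (l * t) / l) +
    A⁻¹ * rexp (l * t) * (4 * T ^ (1/4 : ℝ))) +
    (B ^ 2 * (∫ s in (0:ℝ)..T, η s) + (M₁ + M) * B⁻¹ * (4 * T ^ (1/4 : ℝ)))) := by gcongr
    _ = K * (k * rexp (l * t) * (M * |r|⁻¹ * (A ^ 2 / l + A⁻¹ * (4 * T ^ (1/4 : ℝ)))) +
        |r|⁻¹ * (B ^ 2 * (∫ s in (0:ℝ)..T, η s) + (M₁ + M) * B⁻¹ * (4 * T ^ (1/4 : ℝ))) * 1) := by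
          ring
    _ ≤ K * (k * rexp (l * t) * (1 / 2) +
        |r|⁻¹ * (B ^ 2 * (∫ s in (0:ℝ)..T, η s) + (M₁ + M) * B⁻¹ * (4 * T ^ (1/4 : ℝ))) *
          rexp (l * t)) := by gcongr
    _ = _ := by ring

end


/-! ### Part 5: L1 stability -/

section
variable {Ω : Type*} {G0 : MeasurableSpace Ω} {G : ℝ → MeasurableSpace Ω} [mΩ : MeasurableSpace Ω]
  {μ : Measure Ω} {r : ℝ} {V W : ℝ → Ω → ℝ}

lemma d_est [IsProbabilityMeasure μ] (S : Setup G0 G μ r V W) {M₁ M T : ℝ} (hM₁ : 0 ≤ M₁)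
    (hM : 0 ≤ M) (hT : 0 ≤ T) {ε : ℝ} (hε : 0 < ε) :
    ∃ δ > 0, ∀ (x : ℝ) (Φ₁ a₁ Φ₂ a₂ : ℝ → Ω → ℝ) (c c' : ℝ → ℝ → ℝ) (L₀ : ℝ),
      DP G x M₁ Φ₁ a₁ → DP G x M₁ Φ₂ a₂ → RC c c' M L₀ →
      (∀ s ∈ Icc 0 T, ∀ ω, a₂ s ω = c s (st r V W Φ₂ s ω)) →
      (∫ s in (0:ℝ)..T, ∫ ω, |a₁ s ω - c s (st r V W Φ₁ s ω)| ∂μ) ≤ δ →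
      ∀ t ∈ Icc 0 T, ∀ (f f' : Ω → ℝ → ℝ) (K L : ℝ), TF G0 f f' K L →
        |∫ ω, f ω (Φ₁ t ω + r * W t ω) ∂μ - ∫ ω, f ω (Φ₂ t ω + r * W t ω) ∂μ| ≤ ε * K := by
  obtain ⟨ω₀⟩ : Nonempty Ω := nonempty_of_isProbabilityMeasure μ
  have hr0 : 0 < |r|⁻¹ := inv_pos.2 (abs_pos.2 S.hr)
  set τ := T ^ (1/4 : ℝ) with hτ
  have hτ0 : 0 ≤ τ := Real.rpow_nonneg hT _
  set A := 16 * (M * |r|⁻¹) * τ + 1 with hA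
  have hA0 : 0 < A := by positivity
  set l := 4 * (M * |r|⁻¹) * A ^ 2 + 1 with hl
  have hl0 : 0 < l := by positivity
  set E := 2 * rexp (l * T) * |r|⁻¹ with hE
  have hE0 : 0 < E := by positivity
  set B := 8 * E * (M₁ + M) * τ / ε + 1 with hB
  have hB0 : 0 < B := by positivity
  have hhalf : M * |r|⁻¹ * (A ^ 2 / l + A⁻¹ * (4 * τ)) ≤ 1 / 2 := by
    have h1 : M * |r|⁻¹ * (A ^ 2 / l) ≤ 1 / 4 := by
      rw [← mul_div_assoc, div_le_iff₀ hl0, hl]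
      nlinarith
    have h2 : M * |r|⁻¹ * (A⁻¹ * (4 * τ)) ≤ 1 / 4 := by
      rw [show M * |r|⁻¹ * (A⁻¹ * (4 * τ)) = (M * |r|⁻¹ * (4 * τ)) / A by ring,
        div_le_iff₀ hA0, hA]
      nlinarith
    linarith
  refine ⟨ε / (2 * E * B ^ 2), by positivity, ?_⟩
  intro x Φ₁ a₁ Φ₂ a₂ c c' L₀ D₁ D₂ R h₂ hδ
  set η := ∫ s in (0:ℝ)..T, ∫ ω, |a₁ s ω - c s (st r V W Φ₁ s ω)| ∂μ with hη
  set e := |r|⁻¹ * (B ^ 2 * η + (M₁ + M) * B⁻¹ * (4 * τ)) with he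
  have hη0 : 0 ≤ η := intervalIntegral.integral_nonneg (μ := volume) hT
    (fun u _ => integral_nonneg fun ω => abs_nonneg _)
  have he0 : 0 ≤ e := by positivity
  have hind : ∀ n : ℕ, ∀ s ∈ Icc 0 T, ∀ (f f' : Ω → ℝ → ℝ) (K L : ℝ), TF G0 f f' K L →
      |∫ ω, f ω (Φ₁ s ω + r * W s ω) ∂μ - ∫ ω, f ω (Φ₂ s ω + r * W s ω) ∂μ| ≤
        (2 * (1/2) ^ n + 2 * e) * rexp (l * s) * K := by
    intro n
    induction n with
    | zero =>
      intro s hs f f' K L hf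
      have hK0 : 0 ≤ K := (abs_nonneg _).trans (hf.hK ω₀ 0)
      have hb : ∀ Φ : ℝ → Ω → ℝ, |∫ ω, f ω (Φ s ω + r * W s ω) ∂μ| ≤ K := fun Φ => by
        have := norm_integral_le_of_norm_le_const (μ := μ)
          (f := fun ω => f ω (Φ s ω + r * W s ω)) (C := K)
          (Filter.Eventually.of_forall fun y => hf.hK _ _)
        simpa using this
      refine (abs_sub _ _).trans ?_
      have h1e : 1 ≤ rexp (l * s) := Real.one_le_exp (mul_nonneg hl0.le hs.1)
      have : K + K ≤ (2 * (1/2) ^ 0 + 2 * e) * rexp (l * s) * K := by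
        have h3 : 2 * 1 ≤ (2 * (1/2) ^ 0 + 2 * e) * rexp (l * s) := by
          apply mul_le_mul _ h1e zero_le_one (by positivity)
          simp; exact he0
        nlinarith
      linarith [hb Φ₁, hb Φ₂]
    | succ n ih =>
      intro s hs f f' K L hf
      have := d_iter S D₁ D₂ R h₂ hA0 hB0 hl0 hhalf (k := 2 * (1/2) ^ n + 2 * e) (by positivity)
        ih hs hf
      refine this.trans (le_of_eq ?_)
      rw [← hη, ← he, pow_succ]; ring
  intro t ht f f' K L hf
  have hK0 : 0 ≤ K := (abs_nonneg _).trans (hf.hK ω₀ 0)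
  have hlim : Filter.Tendsto (fun n : ℕ => (2 * (1/2 : ℝ) ^ n + 2 * e) * rexp (l * t) * K)
      Filter.atTop (nhds ((2 * 0 + 2 * e) * rexp (l * t) * K)) := by
    have := tendsto_pow_atTop_nhds_zero_of_lt_one (r := (1/2 : ℝ)) (by norm_num) (by norm_num)
    exact (((this.const_mul 2).add_const _).mul_const _).mul_const _
  have h1 := ge_of_tendsto' hlim (fun n => hind n t ht f f' K L hf)
  refine h1.trans ?_
  apply mul_le_mul_of_nonneg_right _ hK0
  have hexp : rexp (l * t) ≤ rexp (l * T) := Real.exp_le_exp.2 (by nlinarith [ht.2])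
  calc (2 * 0 + 2 * e) * rexp (l * t) ≤ (2 * 0 + 2 * e) * rexp (l * T) := by gcongr
    _ = E * B ^ 2 * η + E * (M₁ + M) * (4 * τ) / B := by rw [he, hE]; field_simp; ring
    _ ≤ E * B ^ 2 * (ε / (2 * E * B ^ 2)) + ε / 2 := by
        apply add_le_add (by gcongr)
        rw [div_le_iff₀ hB0, hB]
        have : ε / 2 * (8 * E * (M₁ + M) * τ / ε + 1) = E * (M₁ + M) * (4 * τ) + ε / 2 := by
          field_simp; ring
        rw [this]; linarith
    _ = ε := by field_simp; ring

lemma st_cj (S : Setup G0 G μ r V W) {x M₁ : ℝ} {Φ a : ℝ → Ω → ℝ} (D : DP G x M₁ Φ a)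
    {c c' : ℝ → ℝ → ℝ} {M L₀ : ℝ} (R : RC c c' M L₀) :
    Measurable (fun p : ℝ × Ω => c p.1 (st r V W Φ p.1 p.2)) :=
  R.cc.measurable.comp (measurable_fst.prodMk (st_jmeas S D))

lemma DP.bdd_diff {x M₁ : ℝ} {Φ₁ a₁ Φ₂ a₂ : ℝ → Ω → ℝ} (D₁ : DP G x M₁ Φ₁ a₁)
    (D₂ : DP G x M₁ Φ₂ a₂) (t : ℝ) (ω : Ω) : |Φ₁ t ω - Φ₂ t ω| ≤ 2 * M₁ * |t| := by
  have h : Φ₁ t ω - Φ₂ t ω = ∫ s in (0:ℝ)..t, (a₁ s ω - a₂ s ω) := by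
    rw [intervalIntegral.integral_sub (bd_intervalIntegrable (D₁.meas_section ω) (D₁.ab · ω) 0 t)
      (bd_intervalIntegrable (D₂.meas_section ω) (D₂.ab · ω) 0 t), D₁.eq, D₂.eq]; ring
  rw [h, ← Real.norm_eq_abs]
  have := intervalIntegral.norm_integral_le_of_norm_le_const (a := 0) (b := t) (C := 2 * M₁)
    (f := fun s => a₁ s ω - a₂ s ω) (fun s _ => by
      rw [Real.norm_eq_abs]
      refine (abs_sub _ _).trans ?_
      linarith [D₁.ab s ω, D₂.ab s ω])
  simpa using this

lemma DP.diff_integrable [IsProbabilityMeasure μ] {x M₁ : ℝ} {Φ₁ a₁ Φ₂ a₂ : ℝ → Ω → ℝ}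
    (D₁ : DP G x M₁ Φ₁ a₁) (D₂ : DP G x M₁ Φ₂ a₂) (t : ℝ) :
    Integrable (fun ω => Φ₁ t ω - Φ₂ t ω) μ :=
  Integrable.of_bound (C := 2 * M₁ * |t|) ((D₁.meas t).sub (D₂.meas t)).aestronglyMeasurable
    (Filter.Eventually.of_forall fun ω => D₁.bdd_diff D₂ t ω)

lemma mean_diff [IsProbabilityMeasure μ] (S : Setup G0 G μ r V W) {x M₁ : ℝ}
    {Φ₁ a₁ Φ₂ a₂ : ℝ → Ω → ℝ}
    (D₁ : DP G x M₁ Φ₁ a₁) (D₂ : DP G x M₁ Φ₂ a₂) {c c' : ℝ → ℝ → ℝ} {M L₀ T ε : ℝ}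
    (R : RC c c' M L₀) (hε : 0 ≤ ε)
    (h₂ : ∀ s ∈ Icc 0 T, ∀ ω, a₂ s ω = c s (st r V W Φ₂ s ω))
    (hd : ∀ t ∈ Icc 0 T, ∀ (f f' : Ω → ℝ → ℝ) (K L : ℝ), TF G0 f f' K L →
        |∫ ω, f ω (Φ₁ t ω + r * W t ω) ∂μ - ∫ ω, f ω (Φ₂ t ω + r * W t ω) ∂μ| ≤ ε * K)
    {t : ℝ} (ht : t ∈ Icc 0 T) :
    |∫ ω, (Φ₁ t ω - Φ₂ t ω) ∂μ| ≤ ε * M * T +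
      ∫ s in (0:ℝ)..T, ∫ ω, |a₁ s ω - c s (st r V W Φ₁ s ω)| ∂μ := by
  have hM0 : 0 ≤ M := (abs_nonneg _).trans (R.hM 0 0)
  set η : ℝ → ℝ := fun s => ∫ ω, |a₁ s ω - c s (st r V W Φ₁ s ω)| ∂μ with hη
  have hej : Measurable (fun p : ℝ × Ω => a₁ p.1 p.2 - c p.1 (st r V W Φ₁ p.1 p.2)) :=
    D₁.am.sub (st_cj S D₁ R)
  have heb : ∀ s ω, |a₁ s ω - c s (st r V W Φ₁ s ω)| ≤ M₁ + M := fun s ω =>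
    (abs_sub _ _).trans (add_le_add (D₁.ab _ _) (R.hM _ _))
  have hη0 : ∀ s, 0 ≤ η s := fun s => integral_nonneg fun ω => abs_nonneg _
  have hηi : ∀ u v, IntervalIntegrable η volume u v := fun u v =>
    avg_intervalIntegrable (g := fun s ω => |a₁ s ω - c s (st r V W Φ₁ s ω)|) hej.abs
      (M := M₁ + M) (fun s ω => by rw [abs_abs]; exact heb s ω) u v
  have hsec : ∀ s : ℝ, Measurable fun ω : Ω => (s, ω) := fun s => by fun_prop
  have hdj : Measurable (fun p : ℝ × Ω => a₁ p.1 p.2 - a₂ p.1 p.2) := D₁.am.sub D₂.am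
  have hdb : ∀ s ω, ‖a₁ s ω - a₂ s ω‖ ≤ M₁ + M₁ := fun s ω =>
    (abs_sub _ _).trans (add_le_add (D₁.ab _ _) (D₂.ab _ _))
  have hpath : ∀ ω, Φ₁ t ω - Φ₂ t ω = ∫ s in (0:ℝ)..t, (a₁ s ω - a₂ s ω) := fun ω => by
    rw [intervalIntegral.integral_sub (bd_intervalIntegrable (D₁.meas_section ω) (D₁.ab · ω) 0 t)
      (bd_intervalIntegrable (D₂.meas_section ω) (D₂.ab · ω) 0 t), D₁.eq, D₂.eq]; ring
  have hswap : ∫ ω, (Φ₁ t ω - Φ₂ t ω) ∂μ = ∫ s in (0:ℝ)..t, ∫ ω, (a₁ s ω - a₂ s ω) ∂μ := by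
    simp_rw [hpath, intervalIntegral.integral_of_le ht.1]
    rw [integral_integral_swap]
    exact Integrable.of_bound (hdj.comp measurable_swap).aestronglyMeasurable (M₁ + M₁)
      (Filter.Eventually.of_forall fun p => hdb _ _)
  rw [hswap, ← Real.norm_eq_abs]
  have hpt : ∀ s ∈ Icc 0 t, ‖∫ ω, (a₁ s ω - a₂ s ω) ∂μ‖ ≤ ε * M + η s := by
    intro s hs
    have hsT : s ∈ Icc 0 T := ⟨hs.1, hs.2.trans ht.2⟩
    have htf : TF G0 (fun ω z => c s (z + V s ω)) (fun ω z => c' s (z + V s ω)) M L₀ :=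
      tf_shift (R.hd s) (R.cont' s) (R.hM s) (R.hL s) (S.Vm s)
    have h1 := hd s hsT _ _ _ _ htf
    have hm1 : Measurable fun ω => Φ₁ s ω + r * W s ω := (D₁.meas s).add ((S.Wma s).const_mul r)
    have hm2 : Measurable fun ω => Φ₂ s ω + r * W s ω := (D₂.meas s).add ((S.Wma s).const_mul r)
    have hi1 := tf_integrable S htf hm1
    have hi2 := tf_integrable S htf hm2
    have hi3 : Integrable (fun ω => a₁ s ω - c s (st r V W Φ₁ s ω)) μ :=
      Integrable.of_bound (C := M₁ + M) (hej.comp (hsec s)).aestronglyMeasurable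
        (Filter.Eventually.of_forall fun ω => heb s ω)
    have e : ∫ ω, (a₁ s ω - a₂ s ω) ∂μ =
        (∫ ω, c s (Φ₁ s ω + r * W s ω + V s ω) ∂μ - ∫ ω, c s (Φ₂ s ω + r * W s ω + V s ω) ∂μ) +
        ∫ ω, (a₁ s ω - c s (st r V W Φ₁ s ω)) ∂μ := by
      have hi12 : Integrable (fun ω => c s (Φ₁ s ω + r * W s ω + V s ω) -
          c s (Φ₂ s ω + r * W s ω + V s ω)) μ := hi1.sub hi2
      rw [← integral_sub hi1 hi2, ← integral_add hi12 hi3]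
      congr 1; ext ω; simp only [h₂ s hsT ω, st, Pi.sub_apply]; ring
    rw [e]
    refine (norm_add_le _ _).trans (add_le_add h1 ?_)
    exact norm_integral_le_integral_norm _
  have hle := intervalIntegral.norm_integral_le_of_norm_le (μ := volume) ht.1
    (f := fun s => ∫ ω, (a₁ s ω - a₂ s ω) ∂μ) (g := fun s => ε * M + η s)
    (Filter.Eventually.of_forall fun s hs => hpt s ⟨hs.1.le, hs.2⟩)
    ((intervalIntegrable_const).add (hηi 0 t))
  refine hle.trans ?_
  rw [intervalIntegral.integral_add intervalIntegrable_const (hηi 0 t)]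
  have hE3 : ∫ s in (0:ℝ)..t, η s ≤ ∫ s in (0:ℝ)..T, η s := by
    rw [← intervalIntegral.integral_add_adjacent_intervals (hηi 0 t) (hηi t T)]
    have := intervalIntegral.integral_nonneg (μ := volume) ht.2 (fun u _ => hη0 u)
    linarith
  have : (∫ _ in (0:ℝ)..t, ε * M) ≤ ε * M * T := by
    simp only [intervalIntegral.integral_const, smul_eq_mul, sub_zero]
    have := mul_le_mul_of_nonneg_left ht.2 (mul_nonneg hε hM0)
    linarith
  linarith

lemma kl [IsProbabilityMeasure μ] (S : Setup G0 G μ r V W) {M₁ M T : ℝ} (hM₁ : 0 ≤ M₁)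
    (hM : 0 ≤ M) (hT : 0 ≤ T) {ε : ℝ} (hε : 0 < ε) :
    ∃ δ > 0, ∀ (x : ℝ) (Φ₁ a₁ Φ₂ a₂ : ℝ → Ω → ℝ) (c c' : ℝ → ℝ → ℝ) (L₀ : ℝ),
      DP G x M₁ Φ₁ a₁ → DP G x M₁ Φ₂ a₂ → RC c c' M L₀ →
      (∀ s ∈ Icc 0 T, ∀ ω, a₂ s ω = c s (st r V W Φ₂ s ω)) →
      (∫ s in (0:ℝ)..T, ∫ ω, |a₁ s ω - c s (st r V W Φ₁ s ω)| ∂μ) ≤ δ →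
      ∀ t ∈ Icc 0 T, ∫ ω, |Φ₁ t ω - Φ₂ t ω| ∂μ ≤ ε := by
  set ε' := ε / (6 * (M * T + 1)) with hε'
  have hε'0 : 0 < ε' := by positivity
  obtain ⟨δ, hδ, h⟩ := d_est S hM₁ hM hT hε'0
  refine ⟨min δ (ε / 6), by positivity, ?_⟩
  intro x Φ₁ a₁ Φ₂ a₂ c c' L₀ D₁ D₂ R h₂ hη t ht
  set U : ℝ → Ω → ℝ := fun s ω => max (Φ₁ s ω) (Φ₂ s ω) with hU
  set a₃ : ℝ → Ω → ℝ := fun s ω => if Φ₂ s ω ≤ Φ₁ s ω then a₁ s ω else a₂ s ω with ha₃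
  have D₃ : DP G x M₁ U a₃ := by
    refine ⟨?_, ?_, ?_, ?_, ?_⟩
    · exact Measurable.ite (measurableSet_le D₂.jmeas D₁.jmeas) D₁.am D₂.am
    · intro s hs
      exact Measurable.ite (measurableSet_le (D₂.ΦG s hs) (D₁.ΦG s hs)) (D₁.aG s hs) (D₂.aG s hs)
    · intro s ω
      simp only [ha₃]
      split_ifs
      · exact D₁.ab s ω
      · exact D₂.ab s ω
    · intro s hs
      exact (D₁.ΦG s hs).max (D₂.ΦG s hs)
    · intro ω t
      exact bd_max (D₁.meas_section ω) (fun s => D₁.ab s ω) (D₂.meas_section ω)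
        (fun s => D₂.ab s ω) x (fun t => Φ₁ t ω) (fun t => Φ₂ t ω) (D₁.eq ω) (D₂.eq ω) t
  have hej : ∀ {Φ a : ℝ → Ω → ℝ}, DP G x M₁ Φ a →
      Measurable (fun p : ℝ × Ω => a p.1 p.2 - c p.1 (st r V W Φ p.1 p.2)) := fun D =>
    D.am.sub (st_cj S D R)
  have heb : ∀ {Φ a : ℝ → Ω → ℝ}, DP G x M₁ Φ a → ∀ s ω,
      |a s ω - c s (st r V W Φ s ω)| ≤ M₁ + M := fun D s ω =>
    (abs_sub _ _).trans (add_le_add (D.ab _ _) (R.hM _ _))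
  have hIg : ∀ {Φ a : ℝ → Ω → ℝ}, DP G x M₁ Φ a → ∀ s,
      Integrable (fun ω => |a s ω - c s (st r V W Φ s ω)|) μ := fun D s =>
    Integrable.of_bound (C := M₁ + M)
      ((hej D).comp (by fun_prop : Measurable fun ω : Ω => (s, ω))).abs.aestronglyMeasurable
      (Filter.Eventually.of_forall fun ω => by rw [Real.norm_eq_abs, abs_abs]; exact heb D s ω)
  have hηi : ∀ {Φ a : ℝ → Ω → ℝ}, DP G x M₁ Φ a → ∀ u v, IntervalIntegrable
      (fun s => ∫ ω, |a s ω - c s (st r V W Φ s ω)| ∂μ) volume u v := fun D u v =>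
    avg_intervalIntegrable (hej D).abs
      (M := M₁ + M) (fun s ω => by rw [abs_abs]; exact heb D s ω) u v
  have hη3 : (∫ s in (0:ℝ)..T, ∫ ω, |a₃ s ω - c s (st r V W U s ω)| ∂μ) ≤
      ∫ s in (0:ℝ)..T, ∫ ω, |a₁ s ω - c s (st r V W Φ₁ s ω)| ∂μ := by
    apply intervalIntegral.integral_mono_on hT (hηi D₃ 0 T) (hηi D₁ 0 T)
    intro s hs
    apply integral_mono (hIg D₃ s) (hIg D₁ s)
    intro ω
    simp only [ha₃, hU, st]
    split_ifs with hle
    · rw [max_eq_left hle]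
    · rw [max_eq_right (not_le.1 hle).le, h₂ s hs ω]
      simp [st]
  have hd1 := h x Φ₁ a₁ Φ₂ a₂ c c' L₀ D₁ D₂ R h₂ (hη.trans (min_le_left _ _))
  have hd3 := h x U a₃ Φ₂ a₂ c c' L₀ D₃ D₂ R h₂ ((hη3.trans hη).trans (min_le_left _ _))
  have m1 := mean_diff S D₁ D₂ R hε'0.le h₂ hd1 ht
  have m3 := mean_diff S D₃ D₂ R hε'0.le h₂ hd3 ht
  have hs : ε' * M * T ≤ ε / 6 := by
    rw [hε']
    rw [show ε / (6 * (M * T + 1)) * M * T = (ε / 6) * (M * T / (M * T + 1)) by field_simp]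
    have : M * T / (M * T + 1) ≤ 1 := by
      rw [div_le_one (by positivity)]; linarith
    nlinarith
  have e : ∫ ω, |Φ₁ t ω - Φ₂ t ω| ∂μ =
      2 * ∫ ω, (U t ω - Φ₂ t ω) ∂μ - ∫ ω, (Φ₁ t ω - Φ₂ t ω) ∂μ := by
    rw [← integral_const_mul, ← integral_sub ((D₃.diff_integrable D₂ t).const_mul 2)
      (D₁.diff_integrable D₂ t)]
    congr 1; ext ω
    simp only [hU]
    rcases le_total (Φ₂ t ω) (Φ₁ t ω) with h | h
    · rw [max_eq_left h, abs_of_nonneg (by linarith)]; ring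
    · rw [max_eq_right h, abs_of_nonpos (by linarith)]; ring
  rw [e]
  have := hη.trans (min_le_right _ _)
  have h3 := abs_le.1 m1
  have h4 := abs_le.1 m3
  linarith [h3.1, h4.2]

end


/-! ### Part 6: Krylov type estimates -/

lemma le_of_sq_le_sq' {a b : ℝ} (hb : 0 ≤ b) (h : a ^ 2 ≤ b ^ 2) : a ≤ b :=
  (le_abs_self a).trans (abs_le_of_sq_le_sq h hb)

lemma sqrt_trick {g p I : ℝ} (hg : 0 ≤ g) (hp : 0 ≤ p) (hI : 0 ≤ I) (h1 : g ≤ p)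
    (h2 : g ≤ I * p ^ 2) : g ≤ √I * (p * √p) := by
  refine le_of_sq_le_sq' (by positivity) ?_
  rw [mul_pow, mul_pow, Real.sq_sqrt hI, Real.sq_sqrt hp]
  calc g ^ 2 = g * g := by ring
    _ ≤ p * (I * p ^ 2) := mul_le_mul h1 h2 hg hp
    _ = _ := by ring

/-- Krylov estimate on smooth test functions. -/
def Kry {Ω : Type*} [MeasurableSpace Ω] (μ : Measure Ω) (K T : ℝ) (X : ℝ → Ω → ℝ) : Prop :=
  ∀ t, 0 < t → t ≤ T → ∀ ψ : ℝ → ℝ, ContDiff ℝ 1 ψ → HasCompactSupport ψ →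
    (∀ z, 0 ≤ ψ z) → (∀ z, ψ z ≤ 1) → ∀ η > 0,
    ∫ ω, ψ (X t ω) ∂μ ≤ K * (η * t ^ (-(1/2) : ℝ) + η⁻¹ * ∫ z, ψ z)

section
variable {Ω : Type*} {G0 : MeasurableSpace Ω} {G : ℝ → MeasurableSpace Ω} [mΩ : MeasurableSpace Ω]
  {μ : Measure Ω} {r : ℝ} {V W : ℝ → Ω → ℝ}

lemma kry_DP [IsProbabilityMeasure μ] (S : Setup G0 G μ r V W) {M T : ℝ} (hM : 0 ≤ M)
    (hT : 0 ≤ T) : ∃ K > 0, ∀ (x : ℝ) (Φ a : ℝ → Ω → ℝ), DP G x M Φ a →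
      Kry μ K T (st r V W Φ) := by
  set w := |r|⁻¹ with hw
  have hw0 : 0 < w := inv_pos.2 (abs_pos.2 S.hr)
  refine ⟨√w + 4 * M * (w * √w) * T ^ (1/2 : ℝ), by positivity, ?_⟩
  intro x Φ a D t ht htT ψ hψ hψc h0 h1 η hη
  have hψi : Integrable ψ := hψ.continuous.integrable_of_hasCompactSupport hψc
  set I := ∫ z, ψ z with hI
  have hI0 : 0 ≤ I := integral_nonneg h0
  have hd : ∀ z, HasDerivAt ψ (deriv ψ z) z := fun z =>
    (hψ.differentiable one_ne_zero z).hasDerivAt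
  have hdc : Continuous (deriv ψ) := hψ.continuous_deriv le_rfl
  obtain ⟨L, hL⟩ := hdc.bounded_above_of_compact_support hψc.deriv
  have hψ1 : ∀ z, |ψ z| ≤ 1 := fun z => by rw [abs_of_nonneg (h0 z)]; exact h1 z
  have hf : TF G0 (fun ω z => ψ (z + V t ω)) (fun ω z => deriv ψ (z + V t ω)) 1 L :=
    tf_shift hd hdc hψ1 hL (S.Vm t)
  obtain ⟨hIg, heq⟩ := duhamel S D hf ht.le
  have hshift : ∀ v : ℝ, (∫ z, ψ (z + v)) = I := fun v => integral_add_right_eq_self ψ v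
  -- first term
  have hfirst : ∫ ω, ψ (x + r * W t ω + V t ω) ∂μ ≤ √I * (√w * t ^ (-(1/4) : ℝ)) := by
    have hV : Measurable[G 0] (V t) := (S.Vm t).mono (S.G0_le 0) le_rfl
    have hWm : Measurable[G 0] (W 0) := S.Wm 0 le_rfl
    have hF : @Measurable _ _ ((G 0).prod inferInstance) _
        (fun p : Ω × ℝ => ψ ((x + r * W 0 p.1 + V t p.1) + r * p.2)) := by
      have h2 : @Measurable _ _ ((G 0).prod inferInstance) _
        (fun p : Ω × ℝ => (x + r * W 0 p.1 + V t p.1)) := by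
        have : Measurable[G 0] (fun ω => x + r * W 0 ω + V t ω) :=
          Measurable.add (m := G 0) ((hWm.const_mul r).const_add x) hV
        exact @Measurable.comp _ _ _ ((G 0).prod inferInstance) (G 0) _ _ _ this
          (@measurable_fst Ω ℝ (G 0) _)
      have h3 : @Measurable _ _ ((G 0).prod inferInstance) _ (fun p : Ω × ℝ => r * p.2) :=
        (@measurable_snd Ω ℝ (G 0) _).const_mul r
      exact hψ.continuous.measurable.comp (h2.add h3)
    have h := indep_integral (S.le 0) (ξ := fun ω => W t ω - W 0 ω) ((S.Wma t).sub (S.Wma 0))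
      (S.indep 0 t le_rfl ht) hF (K := 1) (fun p => hψ1 _)
    rw [S.law 0 t le_rfl ht, sub_zero] at h
    have e1 : ∫ ω, ψ (x + r * W t ω + V t ω) ∂μ =
        ∫ ω, ψ ((x + r * W 0 ω + V t ω) + r * (W t ω - W 0 ω)) ∂μ := by
      congr 1; ext ω; congr 1; ring
    rw [e1, h]
    have hb : ∀ z, Gs r t ψ z ≤ √I * (√w * t ^ (-(1/4) : ℝ)) := by
      intro z
      have b1 := (abs_le.1 (Gs_abs_le (r := r) (q := t) hψ1 z)).2
      have b2 := Gs_le_L1 S.hr ht h0 hψi z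
      have b0 : 0 ≤ Gs r t ψ z := integral_nonneg fun y => h0 _
      refine le_of_sq_le_sq' (by positivity) ?_
      rw [mul_pow, mul_pow, Real.sq_sqrt hI0, Real.sq_sqrt hw0.le, ← Real.rpow_natCast,
        ← Real.rpow_natCast (t ^ _), ← Real.rpow_mul ht.le]
      norm_num at b2 ⊢
      nlinarith
    have := norm_integral_le_of_norm_le_const (μ := μ)
      (f := fun ω => Gs r t ψ (x + r * W 0 ω + V t ω)) (C := √I * (√w * t ^ (-(1/4) : ℝ)))
      (Filter.Eventually.of_forall fun ω => by
        rw [Real.norm_eq_abs, abs_of_nonneg (show 0 ≤ Gs r t ψ _ from integral_nonneg fun y => h0 _)]; exact hb _)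
    simp only [probReal_univ, mul_one] at this
    exact (le_abs_self _).trans this
  -- second term
  have hsecond : (∫ s in (0:ℝ)..t, ∫ ω, a s ω * Gs r (t - s) (fun z => deriv ψ (z + V t ω))
      (Φ s ω + r * W s ω) ∂μ) ≤ M * (√I * (w * √w)) * (4 * t ^ (1/4 : ℝ)) := by
    rw [← sing_integral ht.le, ← intervalIntegral.integral_const_mul]
    have hii : IntervalIntegrable (fun s => M * (√I * (w * √w)) * (t - s) ^ (-(3/4) : ℝ))
      volume 0 t := (sing_integrable (by norm_num)).const_mul _
    apply intervalIntegral.integral_mono_on_of_le_Ioo ht.le hIg hii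
    intro s hs
    have hq : 0 < t - s := by linarith [hs.2]
    have hb : ∀ ω, ‖a s ω * Gs r (t - s) (fun z => deriv ψ (z + V t ω)) (Φ s ω + r * W s ω)‖ ≤
        M * (√I * (w * √w)) * (t - s) ^ (-(3/4) : ℝ) := by
      intro ω
      rw [norm_mul, mul_assoc M]
      apply mul_le_mul (D.ab _ _) _ (norm_nonneg _) hM
      rw [stein S.hr hq (hf.hd ω) (hf.hK ω) (hf.hL ω), Real.norm_eq_abs]
      have b1 := Gy_abs_le (r := r) hq (hf.hK ω) (Φ s ω + r * W s ω)
      have b2 := Gy_le_L1 S.hr hq (F := fun z => ψ (z + V t ω)) (fun z => h0 _)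
        (hψi.comp_add_right _) (Φ s ω + r * W s ω)
      rw [hshift] at b2
      rw [one_mul] at b1
      have hp : (|r|⁻¹ * (t - s) ^ (-(1/2) : ℝ)) ^ 2 = (|r| ^ 2)⁻¹ * (t - s)⁻¹ := by
        rw [mul_pow, ← Real.rpow_natCast ((t - s) ^ _), ← Real.rpow_mul hq.le, inv_pow]
        norm_num [Real.rpow_neg_one]
      have := sqrt_trick (abs_nonneg _) (by positivity) hI0 b1 (by rw [hp]; exact b2)
      refine this.trans (le_of_eq ?_)
      rw [← hw, Real.sqrt_mul hw0.le, Real.sqrt_eq_rpow ((t - s) ^ _), ← Real.rpow_mul hq.le]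
      have : (t - s) ^ (-(3/4) : ℝ) = (t - s) ^ (-(1/2) : ℝ) * (t - s) ^ (-(1/2) * (1/2) : ℝ) := by
        rw [← Real.rpow_add hq]; norm_num
      rw [this]; ring
    have := norm_integral_le_of_norm_le_const (μ := μ) (Filter.Eventually.of_forall hb)
    simp only [probReal_univ, mul_one] at this
    exact (le_abs_self _).trans this
  have e0 : ∫ ω, ψ (st r V W Φ t ω) ∂μ = ∫ ω, ψ (Φ t ω + r * W t ω + V t ω) ∂μ := rfl
  rw [e0, heq]
  have ht4 : t ^ (1/4 : ℝ) ≤ t ^ (-(1/4) : ℝ) * T ^ (1/2 : ℝ) := by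
    have : t ^ (1/4 : ℝ) = t ^ (-(1/4) : ℝ) * t ^ (1/2 : ℝ) := by
      rw [← Real.rpow_add ht]; norm_num
    rw [this]; gcongr
  have hq : √I * t ^ (-(1/4) : ℝ) ≤ η * t ^ (-(1/2) : ℝ) + η⁻¹ * I := by
    have e1 : t ^ (-(1/2) : ℝ) = (t ^ (-(1/4) : ℝ)) ^ 2 := by
      rw [← Real.rpow_natCast, ← Real.rpow_mul ht.le]; norm_num
    have e2 : I = (√I) ^ 2 := (Real.sq_sqrt hI0).symm
    rw [e1]
    nth_rw 2 [e2]
    set p := √I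
    set q := t ^ (-(1/4) : ℝ)
    have : η * q ^ 2 + η⁻¹ * p ^ 2 - p * q = η * (q - η⁻¹ * p / 2) ^ 2 + (3/4) * (η⁻¹ * p ^ 2) := by
      field_simp; ring
    have h' : 0 ≤ η * (q - η⁻¹ * p / 2) ^ 2 + (3/4) * (η⁻¹ * p ^ 2) := by positivity
    linarith
  calc _ ≤ √I * (√w * t ^ (-(1/4) : ℝ)) + M * (√I * (w * √w)) * (4 * t ^ (1/4 : ℝ)) :=
        add_le_add hfirst hsecond
    _ ≤ √I * (√w * t ^ (-(1/4) : ℝ)) +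
        M * (√I * (w * √w)) * (4 * (t ^ (-(1/4) : ℝ) * T ^ (1/2 : ℝ))) := by gcongr
    _ = (√w + 4 * M * (w * √w) * T ^ (1/2 : ℝ)) * (√I * t ^ (-(1/4) : ℝ)) := by ring
    _ ≤ _ := by gcongr
end

/-! ### Part 7: Krylov estimates for measurable functions -/

section
variable {Ω : Type*} [mΩ : MeasurableSpace Ω] {μ : Measure Ω}

lemma kry_limit [IsProbabilityMeasure μ] {K T : ℝ} {X : ℕ → ℝ → Ω → ℝ} {Y : ℝ → Ω → ℝ}
    (hX : ∀ n, Kry μ K T (X n)) (hm : ∀ n t, Measurable (X n t))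
    (hlim : ∀ t ∈ Icc 0 T, ∀ᵐ ω ∂μ, Filter.Tendsto (fun n => X n t ω) Filter.atTop (nhds (Y t ω))) :
    Kry μ K T Y := by
  intro t ht htT ψ hψ hψc h0 h1 η hη
  have hl : Filter.Tendsto (fun n => ∫ ω, ψ (X n t ω) ∂μ) Filter.atTop
      (nhds (∫ ω, ψ (Y t ω) ∂μ)) := by
    apply tendsto_integral_of_dominated_convergence (fun _ => 1)
    · intro n
      exact (hψ.continuous.measurable.comp (hm n t)).aestronglyMeasurable
    · exact integrable_const _
    · intro n
      exact Filter.Eventually.of_forall fun ω => by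
        rw [Real.norm_eq_abs, abs_of_nonneg (h0 _)]; exact h1 _
    · filter_upwards [hlim t ⟨ht.le, htT⟩] with ω hω
      exact (hψ.continuous.tendsto _).comp hω
  exact le_of_tendsto' hl (fun n => hX n t ht htT ψ hψ hψc h0 h1 η hη)

lemma sin_sq_sub (a b : ℝ) : |sin a ^ 2 - sin b ^ 2| ≤ |a - b| := by
  have : sin a ^ 2 - sin b ^ 2 = sin (a - b) * sin (a + b) := by
    rw [sin_sub, sin_add]
    have h1 := sin_sq_add_cos_sq a
    have h2 := sin_sq_add_cos_sq b
    have e1 : cos a ^ 2 = 1 - sin a ^ 2 := by linarith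
    have e2 : cos b ^ 2 = 1 - sin b ^ 2 := by linarith
    ring_nf
    rw [e1, e2]; ring
  rw [this, abs_mul]
  calc |sin (a - b)| * |sin (a + b)| ≤ |a - b| * 1 :=
        mul_le_mul (Real.abs_sin_le_abs) (Real.abs_sin_le_one _) (abs_nonneg _) (abs_nonneg _)
    _ = _ := mul_one _

lemma kry_meas [IsProbabilityMeasure μ] {K T : ℝ} (hK : 0 ≤ K) {X : ℝ → Ω → ℝ}
    (hX : Kry μ K T X) {t : ℝ} (hm : Measurable (X t)) (ht : 0 < t) (htT : t ≤ T) {h : ℝ → ℝ}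
    (hh : Measurable h) (h0 : ∀ z, 0 ≤ h z) (h1 : ∀ z, h z ≤ 1) (hi : Integrable h) {η : ℝ}
    (hη : 0 < η) :
    ∫ ω, h (X t ω) ∂μ ≤ K * (η * t ^ (-(1/2) : ℝ) + η⁻¹ * (5 * ∫ z, h z)) := by
  set ν : Measure ℝ := μ.map (X t) with hν
  have : IsProbabilityMeasure ν := Measure.isProbabilityMeasure_map hm.aemeasurable
  set A : ℝ → ℝ := fun z => arcsin (√(h z)) with hA
  have hAm : Measurable A := measurable_arcsin.comp (hh.sqrt)
  have hs1 : ∀ z, √(h z) ≤ 1 := fun z => Real.sqrt_le_one.2 (h1 z)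
  have hsin : ∀ z, sin (A z) ^ 2 = h z := fun z => by
    rw [hA, Real.sin_arcsin (by linarith [Real.sqrt_nonneg (h z)]) (hs1 z), Real.sq_sqrt (h0 z)]
  have hA0 : ∀ z, 0 ≤ A z := fun z => Real.arcsin_nonneg.2 (Real.sqrt_nonneg _)
  have hAle : ∀ z, A z ^ 2 ≤ (5/2) * h z := fun z => by
    have := Real.mul_le_sin (hA0 z) (Real.arcsin_le_pi_div_two _)
    have hA2 : A z ≤ π / 2 * sin (A z) := by
      have hp := Real.pi_pos
      calc A z = π / 2 * (2 / π * A z) := by field_simp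
        _ ≤ _ := by gcongr
    rw [← hsin z]
    have hpi : (π / 2) ^ 2 ≤ 5 / 2 := by nlinarith [Real.pi_lt_d2, Real.pi_pos]
    calc A z ^ 2 ≤ (π / 2 * sin (A z)) ^ 2 := by gcongr; exact hA0 z
      _ = (π / 2) ^ 2 * sin (A z) ^ 2 := by ring
      _ ≤ _ := by gcongr
  -- integrability w.r.t. the sum measure
  have hiν : Integrable h ν := Integrable.of_bound (C := 1) hh.aestronglyMeasurable
    (Filter.Eventually.of_forall fun z => by rw [Real.norm_eq_abs, abs_of_nonneg (h0 _)]; exact h1 z)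
  have his : Integrable h (volume + ν) := hi.add_measure hiν
  have hAL : MemLp A 2 (volume + ν) := by
    rw [memLp_two_iff_integrable_sq hAm.aestronglyMeasurable]
    apply (his.const_mul (5/2)).mono' (hAm.pow_const 2).aestronglyMeasurable
    exact Filter.Eventually.of_forall fun z => by
      rw [Real.norm_eq_abs, abs_of_nonneg (sq_nonneg _)]; exact hAle z
  have hfc : IsFiniteMeasureOnCompacts (volume + ν) := ⟨fun k hk => by
    rw [Measure.add_apply]
    exact ENNReal.add_lt_top.2 ⟨hk.measure_lt_top, hk.measure_lt_top⟩⟩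
  have key : ∀ ε > 0, ∫ ω, h (X t ω) ∂μ ≤
      K * (η * t ^ (-(1/2) : ℝ) + η⁻¹ * (5 * (∫ z, h z) + 2 * ε ^ 2)) + ε := by
    intro ε hε
    obtain ⟨g, hgc, hgs, hge⟩ := hAL.exist_eLpNorm_sub_le (by norm_num) (by norm_num) hε
    have hgm : Measurable g := hgs.continuous.measurable
    have hgL : MemLp (A - g) 2 (volume + ν) := by
      refine ⟨(hAm.sub hgm).aestronglyMeasurable, hge.trans_lt ENNReal.ofReal_lt_top⟩
    have hgL1 : MemLp (A - g) 2 volume := hgL.mono_measure (Measure.le_add_right le_rfl)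
    have hgL2 : MemLp (A - g) 2 ν := hgL.mono_measure (Measure.le_add_left le_rfl)
    have hsq : ∀ κ : Measure ℝ, κ ≤ volume + ν → ∫ z, (A z - g z) ^ 2 ∂κ ≤ ε ^ 2 := by
      intro κ hκ
      have hL := hgL.mono_measure hκ
      have h2 := hL.eLpNorm_eq_integral_rpow_norm (by norm_num) (by norm_num)
      have h3 : eLpNorm (A - g) 2 κ ≤ ENNReal.ofReal ε := (eLpNorm_mono_measure _ hκ).trans hge
      rw [h2, ENNReal.ofReal_le_ofReal_iff hε.le] at h3
      norm_num at h3
      rw [← Real.sqrt_eq_rpow, Real.sqrt_le_left hε.le] at h3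
      exact h3
    set ψ : ℝ → ℝ := fun z => sin (g z) ^ 2 with hψ
    have hψs : ContDiff ℝ 1 ψ := (Real.contDiff_sin.comp (hgs.of_le (by simp))).pow 2
    have hψc : HasCompactSupport ψ := hgc.comp_left (g := fun y => sin y ^ 2) (by simp)
    have hψ0 : ∀ z, 0 ≤ ψ z := fun z => sq_nonneg _
    have hψ1 : ∀ z, ψ z ≤ 1 := fun z => Real.sin_sq_le_one _
    have h1' := hX t ht htT ψ hψs hψc hψ0 hψ1 η hη
    have hψi : Integrable ψ := hψs.continuous.integrable_of_hasCompactSupport hψc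
    have hψν : Integrable ψ ν := Integrable.of_bound (C := 1) hψs.continuous.aestronglyMeasurable
      (Filter.Eventually.of_forall fun z => by
        rw [Real.norm_eq_abs, abs_of_nonneg (hψ0 _)]; exact hψ1 z)
    have hI : ∫ z, ψ z ≤ 5 * (∫ z, h z) + 2 * ε ^ 2 := by
      have hi2 : Integrable (fun z => (A z - g z) ^ 2) := hgL1.integrable_sq
      calc ∫ z, ψ z ≤ ∫ z, (5 * h z + 2 * (A z - g z) ^ 2) := by
            apply integral_mono hψi ((hi.const_mul 5).add (hi2.const_mul 2))
            intro z
            have e1 : ψ z ≤ g z ^ 2 := by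
              rw [← sq_abs (g z), hψ]
              simp only
              rw [← sq_abs (sin _)]
              exact pow_le_pow_left₀ (abs_nonneg _) Real.abs_sin_le_abs 2
            have := hAle z
            show ψ z ≤ 5 * h z + 2 * (A z - g z) ^ 2
            nlinarith [sq_nonneg (2 * A z - g z)]
        _ = 5 * (∫ z, h z) + 2 * ∫ z, (A z - g z) ^ 2 := by
            rw [integral_add (hi.const_mul 5) (hi2.const_mul 2), integral_const_mul,
              integral_const_mul]
        _ ≤ _ := by
            have := hsq volume (Measure.le_add_right le_rfl)
            linarith
    have hE : ∫ z, h z ∂ν ≤ ∫ z, ψ z ∂ν + ε := by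
      have hi1 : Integrable (fun z => |A z - g z|) ν :=
        (hgL2.integrable (by norm_num)).abs
      have hcs : ∫ z, |A z - g z| ∂ν ≤ ε := by
        have hh2 : eLpNorm (A - g) 1 ν ≤ ENNReal.ofReal ε :=
          (eLpNorm_le_eLpNorm_of_exponent_le (by norm_num)
            (hAm.sub hgm).aestronglyMeasurable).trans
            ((eLpNorm_mono_measure _ (Measure.le_add_left le_rfl)).trans hge)
        rw [eLpNorm_one_eq_lintegral_enorm, ← ofReal_integral_norm_eq_lintegral_enorm
          (hgL2.integrable (by norm_num)), ENNReal.ofReal_le_ofReal_iff hε.le] at hh2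
        exact hh2
      have : ∫ z, h z ∂ν ≤ ∫ z, (ψ z + |A z - g z|) ∂ν := by
        apply integral_mono hiν (hψν.add hi1)
        intro z
        have := (abs_le.1 (sin_sq_sub (A z) (g z))).2
        rw [hsin] at this
        show h z ≤ ψ z + |A z - g z|
        simp only [hψ]; linarith
      rw [integral_add hψν hi1] at this
      linarith
    rw [hν, integral_map hm.aemeasurable hh.aestronglyMeasurable,
      integral_map hm.aemeasurable hψs.continuous.aestronglyMeasurable] at hE
    refine hE.trans (add_le_add (h1'.trans ?_) le_rfl)
    gcongr
  have hlim : Filter.Tendsto (fun ε : ℝ => K * (η * t ^ (-(1/2) : ℝ) + η⁻¹ * (5 * (∫ z, h z)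
      + 2 * ε ^ 2)) + ε) (nhdsWithin 0 (Ioi 0)) (nhds (K * (η * t ^ (-(1/2) : ℝ) + η⁻¹ *
      (5 * (∫ z, h z) + 2 * 0 ^ 2)) + 0)) := by
    apply Filter.Tendsto.mono_left _ nhdsWithin_le_nhds
    apply Continuous.tendsto (f := fun ε : ℝ => K * (η * t ^ (-(1/2) : ℝ) + η⁻¹ * (5 * (∫ z, h z)
      + 2 * ε ^ 2)) + ε)
    fun_prop
  have := ge_of_tendsto hlim (eventually_nhdsWithin_of_forall fun ε hε => key ε hε)
  simpa using this

lemma kry_q [IsProbabilityMeasure μ] {K T Q : ℝ} (hK : 0 ≤ K) (hT : 0 < T) (hQ : 0 < Q) {ε : ℝ}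
    (hε : 0 < ε) : ∃ δ > 0, ∀ X : ℝ → Ω → ℝ, Kry μ K T X →
      Measurable (fun p : ℝ × Ω => X p.1 p.2) → ∀ q : ℝ × ℝ → ℝ, Measurable q →
      (∀ p, |q p| ≤ Q) → Integrable q → ∫ p, |q p| ≤ δ →
      (∫ s in (0:ℝ)..T, ∫ ω, |q (s, X s ω)| ∂μ) ≤ ε := by
  set P := Q * K * (2 * T ^ (1/2 : ℝ)) with hP
  have hP0 : 0 ≤ P := by positivity
  set η := ε / (2 * (P + 1)) with hη
  have hη0 : 0 < η := by positivity
  refine ⟨ε / (2 * (5 * K * η⁻¹ + 1)), by positivity, ?_⟩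
  intro X hX hXm q hq hqb hqi hqδ
  have hqi' : Integrable q ((volume : Measure ℝ).prod (volume : Measure ℝ)) := by
    rwa [← Measure.volume_eq_prod]
  have hqa := hqi'.abs
  set J : ℝ → ℝ := fun s => ∫ z, |q (s, z)| with hJ
  have hJi : Integrable J := hqa.integral_prod_left
  have hJ0 : ∀ s, 0 ≤ J s := fun s => integral_nonneg fun _ => abs_nonneg _
  have hJI : ∫ s, J s = ∫ p, |q p| := by
    rw [Measure.volume_eq_prod, integral_prod _ hqa]
  have hae : ∀ᵐ s : ℝ, Integrable fun z => |q (s, z)| := by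
    simpa using hqa.prod_right_ae
  have hbd : ∀ᵐ s : ℝ, s ∈ Ioc 0 T → ∫ ω, |q (s, X s ω)| ∂μ ≤
      Q * K * η * s ^ (-(1/2) : ℝ) + 5 * K * η⁻¹ * J s := by
    filter_upwards [hae] with s hs hs0
    have hqs : Measurable fun z => |q (s, z)| := (hq.comp (by fun_prop)).abs
    have h := kry_meas hK hX (hXm.comp (by fun_prop : Measurable fun ω : Ω => (s, ω))) hs0.1 hs0.2
      (h := fun z => |q (s, z)| / Q) (hqs.div_const Q) (fun z => by positivity)
      (fun z => by rw [div_le_one hQ]; exact hqb _) (hs.div_const Q) hη0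
    rw [integral_div, integral_div, div_le_iff₀ hQ] at h
    refine h.trans (le_of_eq ?_)
    simp only [hJ]; field_simp
  have hsi : IntervalIntegrable (fun s : ℝ => s ^ (-(1/2) : ℝ)) volume 0 T :=
    intervalIntegral.intervalIntegrable_rpow' (by norm_num)
  have hsI : ∫ s in (0:ℝ)..T, s ^ (-(1/2) : ℝ) = 2 * T ^ (1/2 : ℝ) := by
    rw [integral_rpow (Or.inl (by norm_num))]; norm_num; ring
  have hleft : IntervalIntegrable (fun s => ∫ ω, |q (s, X s ω)| ∂μ) volume 0 T :=
    avg_intervalIntegrable (g := fun s ω => |q (s, X s ω)|)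
      (hq.comp (measurable_fst.prodMk hXm)).abs (M := Q)
      (fun s ω => by rw [abs_abs]; exact hqb _) 0 T
  calc (∫ s in (0:ℝ)..T, ∫ ω, |q (s, X s ω)| ∂μ) ≤
        ∫ s in (0:ℝ)..T, (Q * K * η * s ^ (-(1/2) : ℝ) + 5 * K * η⁻¹ * J s) := by
        rw [intervalIntegral.integral_of_le hT.le, intervalIntegral.integral_of_le hT.le]
        apply integral_mono_ae
        · exact (intervalIntegrable_iff_integrableOn_Ioc_of_le hT.le).1 hleft
        · exact (intervalIntegrable_iff_integrableOn_Ioc_of_le hT.le).1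
            ((hsi.const_mul _).add (hJi.intervalIntegrable.const_mul _))
        · exact (ae_restrict_iff' measurableSet_Ioc).2 hbd
    _ = Q * K * η * (2 * T ^ (1/2 : ℝ)) + 5 * K * η⁻¹ * ∫ s in (0:ℝ)..T, J s := by
        rw [intervalIntegral.integral_add (hsi.const_mul _) (hJi.intervalIntegrable.const_mul _),
          intervalIntegral.integral_const_mul, intervalIntegral.integral_const_mul, hsI]
    _ ≤ P * η + 5 * K * η⁻¹ * (ε / (2 * (5 * K * η⁻¹ + 1))) := by
        apply add_le_add (le_of_eq (by rw [hP]; ring))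
        gcongr
        rw [intervalIntegral.integral_of_le hT.le]
        exact (setIntegral_le_integral hJi (Filter.Eventually.of_forall hJ0)).trans
          (hJI.le.trans hqδ)
    _ ≤ ε / 2 + ε / 2 := by
        apply add_le_add
        · rw [hη, mul_div_assoc', div_le_iff₀ (by positivity)]; nlinarith
        · have : 0 ≤ 5 * K * η⁻¹ := by positivity
          rw [mul_div_assoc', div_le_iff₀ (by positivity)]; nlinarith
    _ = ε := by ring
end

/-! ### Part 8: smooth approximation of the drift -/

lemma abs_arcsin_le {y : ℝ} (h : |y| ≤ 1) : |arcsin y| ≤ 2 * |y| := by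
  have key : ∀ y : ℝ, 0 ≤ y → y ≤ 1 → |arcsin y| ≤ 2 * |y| := by
    intro y h0 h1
    rw [abs_of_nonneg h0, abs_of_nonneg (Real.arcsin_nonneg.2 h0)]
    have := Real.mul_le_sin (Real.arcsin_nonneg.2 h0) (Real.arcsin_le_pi_div_two _)
    rw [Real.sin_arcsin (by linarith) h1] at this
    have hp := Real.pi_pos
    have hA : arcsin y ≤ π / 2 * y := by
      calc arcsin y = π / 2 * (2 / π * arcsin y) := by field_simp
        _ ≤ _ := by gcongr
    nlinarith [Real.pi_lt_d2]
  rcases le_total 0 y with h0 | h0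
  · exact key y h0 (le_of_abs_le h)
  · have := key (-y) (by linarith) (by linarith [neg_le_of_abs_le h])
    rwa [Real.arcsin_neg, abs_neg, abs_neg] at this

lemma abs_sin_sub_sin (a b : ℝ) : |sin a - sin b| ≤ |a - b| := by
  rw [Real.sin_sub_sin, abs_mul, abs_mul]
  have h1 : |sin ((a - b) / 2)| ≤ |(a - b) / 2| := Real.abs_sin_le_abs
  have h2 := Real.abs_cos_le_one ((a + b) / 2)
  rw [abs_div, abs_two] at h1
  rw [abs_two]
  calc 2 * |sin ((a - b) / 2)| * |cos ((a + b) / 2)| ≤ 2 * (|a - b| / 2) * 1 := by gcongr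
    _ = _ := by ring

lemma drift_approx {M : ℝ} (hM : 0 < M) {b : ℝ × ℝ → ℝ} (hb : Measurable b)
    (hbM : ∀ p, |b p| ≤ M) (hbi : Integrable b) {δ : ℝ} (hδ : 0 < δ) :
    ∃ (c c' : ℝ → ℝ → ℝ) (L : ℝ), RC c c' M L ∧ Integrable (fun p : ℝ × ℝ => c p.1 p.2) ∧
      ∫ p : ℝ × ℝ, |c p.1 p.2 - b p| ≤ δ := by
  set A : ℝ × ℝ → ℝ := fun p => arcsin (b p / M) with hA
  have hAm : Measurable A := measurable_arcsin.comp (hb.div_const M)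
  have hle1 : ∀ p, |b p / M| ≤ 1 := fun p => by
    rw [abs_div, abs_of_pos hM, div_le_one hM]; exact hbM p
  have hAi : Integrable A := by
    apply ((hbi.div_const M).abs.const_mul 2).mono' hAm.aestronglyMeasurable
    exact Filter.Eventually.of_forall fun p => abs_arcsin_le (hle1 p)
  obtain ⟨g, hgc, hgs, hge⟩ := (memLp_one_iff_integrable.2 hAi).exist_eLpNorm_sub_le
    (by norm_num) (by norm_num) (ε := δ / M) (by positivity)
  have hgi : Integrable g := hgs.continuous.integrable_of_hasCompactSupport hgc
  have hAg : ∫ p, |A p - g p| ≤ δ / M := by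
    rw [eLpNorm_one_eq_lintegral_enorm, ← ofReal_integral_norm_eq_lintegral_enorm
      (hAi.sub hgi), ENNReal.ofReal_le_ofReal_iff (by positivity)] at hge
    exact hge
  have hfc : Continuous (fderiv ℝ g) := hgs.continuous_fderiv (by simp)
  obtain ⟨C, hC⟩ := hfc.bounded_above_of_compact_support (hgc.fderiv (𝕜 := ℝ))
  have hcont : Continuous g := hgs.continuous
  refine ⟨fun s z => M * sin (g (s, z)), fun s z => M * (cos (g (s, z)) * fderiv ℝ g (s, z) (0, 1)),
    M * (1 * (C * ‖((0 : ℝ), (1 : ℝ))‖)), ⟨?_, ?_, ?_, ?_, ?_⟩, ?_, ?_⟩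
  · fun_prop
  · fun_prop
  · intro s z
    have h1 : HasFDerivAt g (fderiv ℝ g (s, z)) (s, z) :=
      (hgs.differentiable (by simp) (s, z)).hasFDerivAt
    have h2 : HasDerivAt (fun z : ℝ => (s, z)) ((0 : ℝ), (1 : ℝ)) z :=
      (hasDerivAt_const z s).prodMk (hasDerivAt_id z)
    exact ((h1.comp_hasDerivAt z h2).sin).const_mul M
  · intro s z
    rw [abs_mul, abs_of_pos hM]
    exact mul_le_of_le_one_right hM.le (Real.abs_sin_le_one _)
  · intro s z
    rw [abs_mul, abs_of_pos hM, abs_mul]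
    gcongr
    · exact Real.abs_cos_le_one _
    · exact ((fderiv ℝ g (s, z)).le_opNorm _).trans (by gcongr; exact hC _)
  · exact (hgi.const_mul M).mono (by fun_prop) (Filter.Eventually.of_forall fun p => by
      simp only [norm_mul]
      gcongr
      exact Real.abs_sin_le_abs)
  · have hpt : ∀ p : ℝ × ℝ, |M * sin (g (p.1, p.2)) - b p| ≤ M * |A p - g p| := by
      intro p
      have hb' : b p = M * sin (A p) := by
        have := abs_le.1 (hle1 p)
        simp only [hA]
        rw [Real.sin_arcsin this.1 this.2]; field_simp
      rw [hb', ← mul_sub, abs_mul, abs_of_pos hM, abs_sub_comm (A p)]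
      exact mul_le_mul_of_nonneg_left (abs_sin_sub_sin _ _) hM.le
    calc _ ≤ ∫ p, M * |A p - g p| := by
          apply integral_mono_of_nonneg (Filter.Eventually.of_forall fun p => abs_nonneg _)
            ((hAi.sub hgi).abs.const_mul M) (Filter.Eventually.of_forall hpt)
      _ = M * ∫ p, |A p - g p| := integral_const_mul _ _
      _ ≤ M * (δ / M) := by gcongr
      _ = δ := by field_simp

/-! ### Part 9: Picard iteration with adaptedness -/

/-- Continuous adapted process. -/
structure CA {Ω E : Type*} (𝓕 : ℝ → MeasurableSpace Ω) [mΩ : MeasurableSpace Ω]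
    [TopologicalSpace E] [MeasurableSpace E] (P : ℝ → Ω → E) : Prop where
  cont : ∀ ω, Continuous fun t => P t ω
  meas : ∀ t, Measurable (P t)
  adapted : ∀ t, 0 ≤ t → Measurable[𝓕 t] (P t)

lemma int_meas {Ω E : Type*} [MeasurableSpace Ω] [TopologicalSpace E] [TopologicalSpace.MetrizableSpace E]
    [MeasurableSpace E] [BorelSpace E] {P : ℝ → Ω → E} {t : ℝ} (ht : 0 ≤ t)
    (hc : ∀ ω, Continuous fun t => P t ω) (hm : ∀ s ∈ Icc 0 t, Measurable (P s))
    {F : ℝ → E → ℝ} (hF : Measurable fun p : ℝ × E => F p.1 p.2) :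
    Measurable fun ω => ∫ s in (0:ℝ)..t, F s (P s ω) := by
  set Q : ℝ → Ω → E := fun s ω => P (max 0 (min s t)) ω with hQ
  have hcl : ∀ s : ℝ, max 0 (min s t) ∈ Icc 0 t := fun s =>
    ⟨le_max_left _ _, max_le ht (min_le_right _ _)⟩
  have hQj : Measurable fun p : ℝ × Ω => Q p.1 p.2 :=
    measurable_uncurry_of_continuous_of_measurable (u := Q)
      (fun ω => (hc ω).comp (by fun_prop : Continuous fun s : ℝ => max 0 (min s t)))
      (fun s => hm _ (hcl s))
  have e : (fun ω => ∫ s in (0:ℝ)..t, F s (P s ω)) = fun ω => ∫ s in (0:ℝ)..t, F s (Q s ω) := by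
    ext ω
    apply intervalIntegral.integral_congr
    intro s hs
    rw [uIcc_of_le ht] at hs
    simp only [hQ]
    rw [min_eq_left hs.2, max_eq_right hs.1]
  rw [e]
  simp_rw [intervalIntegral.integral_of_le ht]
  have h1 : StronglyMeasurable (fun p : Ω × ℝ => F p.2 (Q p.2 p.1)) :=
    (hF.comp (measurable_snd.prodMk (hQj.comp measurable_swap))).stronglyMeasurable
  exact h1.integral_prod_right.measurable

section
variable {Ω : Type*} {𝓕 : ℝ → MeasurableSpace Ω} [mΩ : MeasurableSpace Ω]

lemma CA.j {E : Type*} [TopologicalSpace E] [TopologicalSpace.MetrizableSpace E]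
    [MeasurableSpace E] [BorelSpace E] {P : ℝ → Ω → E} (h : CA 𝓕 P) :
    Measurable fun p : ℝ × Ω => P p.1 p.2 :=
  measurable_uncurry_of_continuous_of_measurable (u := P) h.cont h.meas

lemma DP_of {E : Type*} [TopologicalSpace E] [TopologicalSpace.MetrizableSpace E]
    [MeasurableSpace E] [BorelSpace E] (hmono : Monotone 𝓕)
    {P : ℝ → Ω → E} (hP : CA 𝓕 P) {F : ℝ → E → ℝ} (hF : Measurable fun p : ℝ × E => F p.1 p.2)
    {M : ℝ} (hM : ∀ s p, |F s p| ≤ M) {x : ℝ} {Φ : ℝ → Ω → ℝ}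
    (hΦ : ∀ ω t, Φ t ω = x + ∫ s in (0:ℝ)..t, F s (P s ω)) :
    DP 𝓕 x M Φ (fun s ω => F s (P s ω)) where
  am := hF.comp (measurable_fst.prodMk hP.j)
  aG s hs := (hF.comp (by fun_prop : Measurable fun p : E => (s, p))).comp (hP.adapted s hs)
  ab s ω := hM _ _
  ΦG t ht := by
    have : Φ t = fun ω => x + ∫ s in (0:ℝ)..t, F s (P s ω) := funext fun ω => hΦ ω t
    rw [this]
    have := @int_meas Ω E (𝓕 t) _ _ _ _ P t ht hP.cont
      (fun s hs => (hP.adapted s hs.1).mono (hmono hs.2) le_rfl) F hF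
    exact this.const_add x
  eq := hΦ

lemma DP.ca {x M : ℝ} {Φ a : ℝ → Ω → ℝ} (D : DP 𝓕 x M Φ a) : CA 𝓕 Φ :=
  ⟨D.cont, D.meas, D.ΦG⟩

lemma CA.prodMk {E E' : Type*} [TopologicalSpace E] [MeasurableSpace E] [TopologicalSpace E']
    [MeasurableSpace E'] {P : ℝ → Ω → E} {P' : ℝ → Ω → E'} (h : CA 𝓕 P) (h' : CA 𝓕 P') :
    CA 𝓕 (fun t ω => (P t ω, P' t ω)) :=
  ⟨fun ω => (h.cont ω).prodMk (h'.cont ω), fun t => (h.meas t).prodMk (h'.meas t),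
    fun t ht => Measurable.prodMk (m := 𝓕 t) (h.adapted t ht) (h'.adapted t ht)⟩

/-- Picard iterates. -/
def pic {E : Type*} (F : ℝ → E → ℝ → ℝ) (P : ℝ → Ω → E) (x : ℝ) : ℕ → ℝ → Ω → ℝ
  | 0 => fun _ _ => x
  | n + 1 => fun t ω => x + ∫ s in (0:ℝ)..t, F s (P s ω) (pic F P x n s ω)

lemma picard {E : Type*} [TopologicalSpace E] [TopologicalSpace.MetrizableSpace E]
    [SecondCountableTopology E]
    [MeasurableSpace E] [BorelSpace E] (hmono : Monotone 𝓕)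
    {P : ℝ → Ω → E} (hP : CA 𝓕 P) {F : ℝ → E → ℝ → ℝ}
    (hF : Measurable fun p : ℝ × E × ℝ => F p.1 p.2.1 p.2.2)
    {M L T : ℝ} (hT : 0 ≤ T) (hL : 0 < L) (hM : ∀ s p y, |F s p y| ≤ M)
    (hlip : ∀ s p y y', |F s p y - F s p y'| ≤ L * |y - y'|)
    (hz : ∀ s p y, s ∉ Icc 0 T → F s p y = 0) (x : ℝ) :
    ∃ Φ : ℝ → Ω → ℝ, DP 𝓕 x M Φ (fun s ω => F s (P s ω) (Φ s ω)) := by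
  rcases isEmpty_or_nonempty Ω with hΩ | ⟨⟨ω₀⟩⟩
  · refine ⟨fun _ _ => x, ⟨?_, ?_, ?_, ?_, ?_⟩⟩
    · exact measurable_of_empty _
    · intro s _; exact @measurable_of_empty _ _ (𝓕 s) _ _ _
    · intro s ω; exact hM _ _ _
    · intro s _; exact measurable_const
    · intro ω; exact (hΩ.false ω).elim
  have hM0 : 0 ≤ M := (abs_nonneg _).trans (hM 0 (P 0 ω₀) 0)
  set Y := pic F P x with hY
  have hca : ∀ n, CA 𝓕 (Y n) := by
    intro n
    induction n with
    | zero => exact ⟨fun ω => continuous_const, fun t => measurable_const, fun t _ => measurable_const⟩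
    | succ n ih =>
      exact (DP_of hmono (hP.prodMk ih) (F := fun s p => F s p.1 p.2) hF
        (fun s p => hM s p.1 p.2) (x := x) (Φ := Y (n + 1)) (fun ω t => rfl)).ca
  have hsec : ∀ (ω : Ω) (y : ℝ → ℝ), Measurable y → Measurable fun s => F s (P s ω) (y s) :=
    fun ω y hy => hF.comp (measurable_id.prodMk ((hP.cont ω).measurable.prodMk hy))
  have hii : ∀ (ω : Ω) (y : ℝ → ℝ), Measurable y → ∀ u v,
      IntervalIntegrable (fun s => F s (P s ω) (y s)) volume u v := fun ω y hy u v =>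
    bd_intervalIntegrable (hsec ω y hy) (fun s => hM _ _ _) u v
  have hneg : ∀ n t ω, t ≤ 0 → Y n t ω = x := by
    intro n t ω ht
    cases n with
    | zero => rfl
    | succ n =>
      show x + ∫ s in (0:ℝ)..t, F s (P s ω) (Y n s ω) = x
      rw [intervalIntegral.integral_zero_ae]
      · simp
      · have : ∀ᵐ s : ℝ, s ≠ 0 := by simp [ae_iff]
        filter_upwards [this] with s hs0 hs
        rw [uIoc_of_ge ht] at hs
        apply hz
        intro h
        exact hs0 (le_antisymm hs.2 h.1)
  have hstep : ∀ n : ℕ, ∀ t ω, 0 ≤ t →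
      |Y (n + 1) t ω - Y n t ω| ≤ M * T * (1/2) ^ n * rexp (2 * L * t) := by
    intro n
    induction n with
    | zero =>
      intro t ω ht
      have e : Y (0 + 1) t ω - Y 0 t ω = ∫ s in (0:ℝ)..t, F s (P s ω) x := by
        show x + (∫ s in (0:ℝ)..t, F s (P s ω) x) - x = _
        ring
      have h1 : ‖∫ s in (0:ℝ)..t, F s (P s ω) x‖ ≤ M * T := by
        have hb : ‖∫ s in (0:ℝ)..t, F s (P s ω) x‖ ≤
            ∫ s in (0:ℝ)..t, (Icc 0 T).indicator (fun _ => M) s := by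
          apply intervalIntegral.norm_integral_le_of_norm_le ht
          · refine Filter.Eventually.of_forall fun s hs => ?_
            by_cases h : s ∈ Icc 0 T
            · rw [indicator_of_mem h]; exact hM _ _ _
            · rw [indicator_of_notMem h, hz _ _ _ h]; simp
          · exact bd_intervalIntegrable (M := M) (measurable_const.indicator measurableSet_Icc)
              (fun s => by
                by_cases h : s ∈ Icc 0 T
                · rw [indicator_of_mem h, abs_of_nonneg hM0]
                · rw [indicator_of_notMem h]; simpa using hM0) 0 t
        refine hb.trans ?_
        rw [intervalIntegral.integral_of_le ht]
        have hi : Integrable ((Icc 0 T).indicator (fun _ : ℝ => M)) :=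
          (integrable_indicator_iff measurableSet_Icc).2 (integrableOn_const (by simp))
        refine (setIntegral_le_integral hi (Filter.Eventually.of_forall fun s =>
          indicator_nonneg (fun _ _ => hM0) s)).trans (le_of_eq ?_)
        rw [integral_indicator measurableSet_Icc, setIntegral_const]
        simp [hT, mul_comm]
      rw [e, ← Real.norm_eq_abs]
      refine h1.trans ?_
      have : 1 ≤ rexp (2 * L * t) := Real.one_le_exp (by positivity)
      have h0 : 0 ≤ M * T := by positivity
      simp only [pow_zero, mul_one]
      nlinarith
    | succ n ih =>
      intro t ω ht
      have e : Y (n + 1 + 1) t ω - Y (n + 1) t ω =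
          ∫ s in (0:ℝ)..t, (F s (P s ω) (Y (n + 1) s ω) - F s (P s ω) (Y n s ω)) := by
        rw [intervalIntegral.integral_sub (hii ω _ ((hca (n+1)).cont ω).measurable 0 t)
          (hii ω _ ((hca n).cont ω).measurable 0 t)]
        show x + (∫ s in (0:ℝ)..t, F s (P s ω) (Y (n+1) s ω)) -
          (x + (∫ s in (0:ℝ)..t, F s (P s ω) (Y n s ω))) = _
        ring
      rw [e, ← Real.norm_eq_abs]
      have hbd : ‖∫ s in (0:ℝ)..t, (F s (P s ω) (Y (n + 1) s ω) - F s (P s ω) (Y n s ω))‖ ≤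
          ∫ s in (0:ℝ)..t, L * (M * T * (1/2) ^ n) * rexp (2 * L * s) := by
        apply intervalIntegral.norm_integral_le_of_norm_le ht
        · refine Filter.Eventually.of_forall fun s hs => ?_
          refine (hlip _ _ _ _).trans ?_
          rw [mul_assoc L]
          exact mul_le_mul_of_nonneg_left (ih s ω hs.1.le) hL.le
        · exact (by fun_prop : Continuous fun s : ℝ => L * (M * T * (1/2) ^ n) *
            rexp (2 * L * s)).intervalIntegrable _ _
      refine hbd.trans ?_
      rw [intervalIntegral.integral_const_mul]
      have h2 : ∫ s in (0:ℝ)..t, rexp (2 * L * s) = (2 * L)⁻¹ * (rexp (2 * L * t) - 1) := by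
        rw [intervalIntegral.integral_comp_mul_left (fun y => rexp y) (by positivity)]
        simp
      rw [h2]
      have h0 : 0 ≤ M * T * (1/2) ^ n := by positivity
      calc L * (M * T * (1/2) ^ n) * ((2 * L)⁻¹ * (rexp (2 * L * t) - 1)) =
          (M * T * (1/2) ^ n) / 2 * (rexp (2 * L * t) - 1) := by field_simp
        _ ≤ (M * T * (1/2) ^ n) / 2 * rexp (2 * L * t) := by gcongr; linarith
        _ = _ := by rw [pow_succ]; ring
  have hlim : ∀ t ω, ∃ y, Filter.Tendsto (fun n => Y n t ω) Filter.atTop (nhds y) := by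
    intro t ω
    rcases le_total t 0 with ht | ht
    · exact ⟨x, by simp_rw [hneg _ t ω ht]; exact tendsto_const_nhds⟩
    · apply cauchySeq_tendsto_of_complete
      apply cauchySeq_of_le_geometric (1/2) (M * T * rexp (2 * L * t)) (by norm_num)
      intro n
      rw [dist_comm, Real.dist_eq]
      refine (hstep n t ω ht).trans (le_of_eq ?_)
      ring
  choose Φ hΦ using hlim
  have hΦs : ∀ ω, Measurable fun s => Φ s ω := fun ω =>
    measurable_of_tendsto_metrizable (fun n => ((hca n).cont ω).measurable)
      (tendsto_pi_nhds.2 fun s => hΦ s ω)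
  have heq : ∀ ω t, Φ t ω = x + ∫ s in (0:ℝ)..t, F s (P s ω) (Φ s ω) := by
    intro ω t
    have h1 : Filter.Tendsto (fun n => Y (n + 1) t ω) Filter.atTop (nhds (Φ t ω)) :=
      (hΦ t ω).comp (Filter.tendsto_add_atTop_nat 1)
    refine tendsto_nhds_unique h1 ?_
    show Filter.Tendsto (fun n => x + ∫ s in (0:ℝ)..t, F s (P s ω) (Y n s ω)) _ _
    apply Filter.Tendsto.const_add
    apply intervalIntegral.tendsto_integral_filter_of_dominated_convergence (fun _ => M)
    · exact Filter.Eventually.of_forall fun n =>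
        (hsec ω _ ((hca n).cont ω).measurable).aestronglyMeasurable
    · exact Filter.Eventually.of_forall fun n => Filter.Eventually.of_forall fun s _ => hM _ _ _
    · exact intervalIntegrable_const
    · refine Filter.Eventually.of_forall fun s _ => ?_
      have hc : Continuous (F s (P s ω)) := by
        have : LipschitzWith L.toNNReal (F s (P s ω)) := LipschitzWith.of_dist_le_mul fun y y' => by
          rw [Real.dist_eq, Real.dist_eq, Real.coe_toNNReal _ hL.le]; exact hlip _ _ _ _
        exact this.continuous
      exact (hc.tendsto _).comp (hΦ s ω)
  have hΦca : CA 𝓕 Φ := by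
    refine ⟨fun ω => ?_, fun t => ?_, fun t ht => ?_⟩
    · exact (bd_integral_lipschitz (hsec ω _ (hΦs ω)) (fun s => hM _ _ _) x _ (heq ω)).continuous
    · exact measurable_of_tendsto_metrizable (fun n => (hca n).meas t)
        (tendsto_pi_nhds.2 fun ω => hΦ t ω)
    · exact @measurable_of_tendsto_metrizable Ω ℝ (𝓕 t) _ _ _ _ _ _
        (fun n => (hca n).adapted t ht) (tendsto_pi_nhds.2 fun ω => hΦ t ω)
  exact ⟨Φ, DP_of hmono (hP.prodMk hΦca) (F := fun s p => F s p.1 p.2) hF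
        (fun s p => hM s p.1 p.2) heq⟩
end

/-! ### Part 10: tools for the limit -/

section
variable {Ω : Type*} {G0 : MeasurableSpace Ω} {G : ℝ → MeasurableSpace Ω} [mΩ : MeasurableSpace Ω]
  {μ : Measure Ω} {r : ℝ} {V W : ℝ → Ω → ℝ}

lemma kq [IsProbabilityMeasure μ] (S : Setup G0 G μ r V W) {M T : ℝ} (hM : 0 < M)
    (hT : 0 < T) {ε : ℝ} (hε : 0 < ε) :
    ∃ δ > 0, ∀ (x : ℝ) (Φ₁ a₁ Φ₂ a₂ : ℝ → Ω → ℝ) (c c' : ℝ → ℝ → ℝ) (L₀ : ℝ) (q : ℝ × ℝ → ℝ),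
      DP G x M Φ₁ a₁ → DP G x M Φ₂ a₂ → RC c c' M L₀ →
      (∀ s ∈ Icc 0 T, ∀ ω, a₂ s ω = c s (st r V W Φ₂ s ω)) →
      Measurable q → (∀ p, |q p| ≤ 2 * M) → Integrable q → ∫ p, |q p| ≤ δ →
      (∀ s ∈ Icc 0 T, ∀ᵐ ω ∂μ, |a₁ s ω - c s (st r V W Φ₁ s ω)| ≤ |q (s, st r V W Φ₁ s ω)|) →
      ∀ t ∈ Icc 0 T, ∫ ω, |Φ₁ t ω - Φ₂ t ω| ∂μ ≤ ε := by
  obtain ⟨δ₁, hδ₁, h1⟩ := kl S hM.le hM.le hT.le hε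
  obtain ⟨K, hK, h2⟩ := kry_DP S hM.le hT.le
  obtain ⟨δ, hδ, h3⟩ := kry_q (μ := μ) hK.le hT (by positivity : 0 < 2 * M) hδ₁
  refine ⟨δ, hδ, ?_⟩
  intro x Φ₁ a₁ Φ₂ a₂ c c' L₀ q D₁ D₂ R ha₂ hq hqb hqi hqδ hle
  refine h1 x Φ₁ a₁ Φ₂ a₂ c c' L₀ D₁ D₂ R ha₂ ?_
  refine le_trans ?_ (h3 (st r V W Φ₁) (h2 x Φ₁ a₁ D₁) (st_jmeas S D₁) q hq hqb hqi hqδ)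
  have hej : Measurable (fun p : ℝ × Ω => a₁ p.1 p.2 - c p.1 (st r V W Φ₁ p.1 p.2)) :=
    D₁.am.sub (st_cj S D₁ R)
  have hqj : Measurable (fun p : ℝ × Ω => q (p.1, st r V W Φ₁ p.1 p.2)) :=
    hq.comp (measurable_fst.prodMk (st_jmeas S D₁))
  have heb : ∀ s ω, |(|a₁ s ω - c s (st r V W Φ₁ s ω)|)| ≤ M + M := fun s ω => by
    rw [abs_abs]; exact (abs_sub _ _).trans (add_le_add (D₁.ab _ _) (R.hM _ _))
  have hqb' : ∀ s ω, |(|q (s, st r V W Φ₁ s ω)|)| ≤ 2 * M := fun s ω => by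
    rw [abs_abs]; exact hqb _
  have hsec : ∀ s : ℝ, Measurable fun ω : Ω => (s, ω) := fun s => by fun_prop
  apply intervalIntegral.integral_mono_on hT.le
  · exact avg_intervalIntegrable hej.abs heb 0 T
  · exact avg_intervalIntegrable hqj.abs hqb' 0 T
  intro s hs
  apply integral_mono_ae
  · exact Integrable.of_bound (C := M + M) (hej.comp (hsec s)).abs.aestronglyMeasurable
      (Filter.Eventually.of_forall fun ω => heb s ω)
  · exact Integrable.of_bound (C := 2 * M) (hqj.comp (hsec s)).abs.aestronglyMeasurable
      (Filter.Eventually.of_forall fun ω => hqb' s ω)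
  · exact hle s hs

lemma DP.mono {𝓕 : ℝ → MeasurableSpace Ω} (hle : ∀ t, 𝓕 t ≤ G t) {x M : ℝ} {Φ a : ℝ → Ω → ℝ}
    (D : DP 𝓕 x M Φ a) : DP G x M Φ a :=
  ⟨D.am, fun s hs => (D.aG s hs).mono (hle s) le_rfl, D.ab,
    fun s hs => (D.ΦG s hs).mono (hle s) le_rfl, D.eq⟩

lemma CA.mono {E : Type*} [TopologicalSpace E] [MeasurableSpace E] {𝓕 : ℝ → MeasurableSpace Ω}
    (hle : ∀ t, 𝓕 t ≤ G t) {P : ℝ → Ω → E} (h : CA 𝓕 P) : CA G P :=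
  ⟨h.cont, h.meas, fun t ht => (h.adapted t ht).mono (hle t) le_rfl⟩

lemma ae_nonpos_of_le {f : Ω → ℝ} {g : ℕ → Ω → ℝ} {e : ℕ → ℝ} (hf : Measurable f)
    (hle : ∀ n, ∀ᵐ ω ∂μ, f ω ≤ g n ω) (hi : ∀ n, Integrable (g n) μ) (hg0 : ∀ n ω, 0 ≤ g n ω)
    (hg : ∀ n, ∫ ω, g n ω ∂μ ≤ e n) (he : Filter.Tendsto e Filter.atTop (nhds 0)) :
    ∀ᵐ ω ∂μ, f ω ≤ 0 := by
  have h0 : ∫⁻ ω, ENNReal.ofReal (f ω) ∂μ = 0 := by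
    have hlim : Filter.Tendsto (fun n => ENNReal.ofReal (e n)) Filter.atTop (nhds 0) := by
      simpa using ENNReal.tendsto_ofReal he
    refine le_antisymm (ge_of_tendsto' hlim fun n => ?_) zero_le
    calc ∫⁻ ω, ENNReal.ofReal (f ω) ∂μ ≤ ∫⁻ ω, ENNReal.ofReal (g n ω) ∂μ :=
          lintegral_mono_ae ((hle n).mono fun ω h => ENNReal.ofReal_le_ofReal h)
      _ = ENNReal.ofReal (∫ ω, g n ω ∂μ) :=
          (ofReal_integral_eq_lintegral_ofReal (hi n) (Filter.Eventually.of_forall (hg0 n))).symm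
      _ ≤ _ := ENNReal.ofReal_le_ofReal (hg n)
  rw [lintegral_eq_zero_iff hf.ennreal_ofReal] at h0
  filter_upwards [h0] with ω hω
  exact ENNReal.ofReal_eq_zero.1 hω

lemma ae_cauchy {f : ℕ → Ω → ℝ} (hf : ∀ n, Measurable (f n))
    (hi : ∀ n, Integrable (fun ω => |f n ω - f (n+1) ω|) μ)
    (hle : ∀ n, ∫ ω, |f n ω - f (n+1) ω| ∂μ ≤ (1/2)^n) :
    ∀ᵐ ω ∂μ, CauchySeq fun n => f n ω := by
  have hm : ∀ n, Measurable fun ω => ENNReal.ofReal |f n ω - f (n+1) ω| := fun n =>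
    ((hf n).sub (hf (n+1))).abs.ennreal_ofReal
  have h1 : ∫⁻ ω, ∑' n, ENNReal.ofReal |f n ω - f (n+1) ω| ∂μ ≠ ⊤ := by
    rw [lintegral_tsum fun n => (hm n).aemeasurable]
    have : ∀ n, ∫⁻ ω, ENNReal.ofReal |f n ω - f (n+1) ω| ∂μ ≤ ENNReal.ofReal ((1/2)^n) := fun n => by
      rw [← ofReal_integral_eq_lintegral_ofReal (hi n)
        (Filter.Eventually.of_forall fun ω => abs_nonneg _)]
      exact ENNReal.ofReal_le_ofReal (hle n)
    refine ne_top_of_le_ne_top ?_ (ENNReal.tsum_le_tsum this)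
    rw [← ENNReal.ofReal_tsum_of_nonneg (fun n => by positivity) summable_geometric_two]
    exact ENNReal.ofReal_ne_top
  have h2 := ae_lt_top' (AEMeasurable.tsum fun n => (hm n).aemeasurable) h1
  filter_upwards [h2] with ω hω
  apply cauchySeq_of_summable_dist
  have := ENNReal.summable_toReal hω.ne
  refine this.congr fun n => ?_
  rw [ENNReal.toReal_ofReal (abs_nonneg _), Real.dist_eq]

lemma eqlip {g : ℕ → ℝ → ℝ} {K : ℝ≥0} (hg : ∀ n, LipschitzWith K (g n))
    (hq : ∀ q : ℚ, CauchySeq fun n => g n q) (t : ℝ) : CauchySeq fun n => g n t := by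
  rw [Metric.cauchySeq_iff']
  intro ε hε
  set η := ε / (3 * (K + 1)) with hη
  have hη0 : 0 < η := by positivity
  obtain ⟨q, hq1, hq2⟩ := exists_rat_btwn (lt_add_of_pos_right t hη0)
  obtain ⟨N, hN⟩ := Metric.cauchySeq_iff'.1 (hq q) (ε / 3) (by positivity)
  refine ⟨N, fun n hn => ?_⟩
  have hd : dist t q ≤ η := by
    rw [dist_comm, Real.dist_eq, abs_of_pos (by linarith)]; linarith
  have hb : ∀ n, dist (g n t) (g n q) < ε / 3 := fun n => by
    refine ((hg n).dist_le_mul t q).trans_lt ?_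
    calc (K : ℝ) * dist t q ≤ K * η := by gcongr
      _ < (K + 1) * η := by nlinarith
      _ = ε / 3 := by rw [hη]; field_simp
  calc dist (g n t) (g N t) ≤ dist (g n t) (g n q) + dist (g n q) (g N q) + dist (g N q) (g N t) :=
        dist_triangle4 _ _ _ _
    _ < ε / 3 + ε / 3 + ε / 3 := by
        have h1 := hb n
        have h2 := hb N
        rw [dist_comm] at h2
        have h3 := hN n hn
        linarith
    _ = ε := by ring

/-- clamping to `[0,T]` -/
def cl (T t : ℝ) : ℝ := max 0 (min t T)

lemma cl_mem {T : ℝ} (hT : 0 ≤ T) (t : ℝ) : cl T t ∈ Icc 0 T :=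
  ⟨le_max_left _ _, max_le hT (min_le_right _ _)⟩

lemma cl_of_mem {T t : ℝ} (h : t ∈ Icc 0 T) : cl T t = t := by
  rw [cl, min_eq_left h.2, max_eq_right h.1]

lemma cl_le {T t : ℝ} (h : 0 ≤ t) : cl T t ≤ t := max_le h (min_le_left _ _)

lemma cl_lip (T : ℝ) : LipschitzWith 1 (cl T) :=
  (LipschitzWith.id.min_const T).const_max 0

lemma ca_clamp {𝓕 : ℝ → MeasurableSpace Ω} (hmono : Monotone 𝓕) (hle : ∀ t, 𝓕 t ≤ mΩ)
    {T : ℝ} (hT : 0 ≤ T) {P : ℝ → Ω → ℝ} (hc : ∀ ω, ContinuousOn (fun t => P t ω) (Icc 0 T))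
    (hm : ∀ t ∈ Icc 0 T, Measurable[𝓕 t] (P t)) : CA 𝓕 (fun t ω => P (cl T t) ω) := by
  refine ⟨fun ω => ?_, fun t => ?_, fun t ht => ?_⟩
  · exact (hc ω).comp_continuous (cl_lip T).continuous (fun t => cl_mem hT t)
  · exact (hm _ (cl_mem hT t)).mono (hle _) le_rfl
  · exact (hm _ (cl_mem hT t)).mono (hmono (cl_le ht)) le_rfl

lemma ca_limit {𝓕 : ℝ → MeasurableSpace Ω} (hle : ∀ t, 𝓕 t ≤ mΩ)
    (hnull : ∀ t A, μ A = 0 → MeasurableSet[𝓕 t] A) {Y : ℕ → ℝ → Ω → ℝ} (hY : ∀ n, CA 𝓕 (Y n))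
    {Gd : Set Ω} (hGd : μ Gdᶜ = 0) {Φ : ℝ → Ω → ℝ}
    (hlim : ∀ ω ∈ Gd, ∀ t, Filter.Tendsto (fun n => Y n t ω) Filter.atTop (nhds (Φ t ω)))
    (hc : ∀ ω ∈ Gd, Continuous fun t => Φ t ω) (h0 : ∀ ω ∉ Gd, ∀ t, Φ t ω = 0) : CA 𝓕 Φ := by
  have hgm : ∀ t, MeasurableSet[𝓕 t] Gd := fun t => by
    have := (hnull t _ hGd).compl
    rwa [compl_compl] at this
  have key : ∀ t (m : MeasurableSpace Ω), MeasurableSet[m] Gd → (∀ n, Measurable[m] (Y n t)) →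
      Measurable[m] (Φ t) := by
    intro t m hm hY'
    refine @measurable_of_tendsto_metrizable Ω ℝ m _ _ _ _ (fun n => Gd.indicator (Y n t)) _
      (fun n => (hY' n).indicator hm) (tendsto_pi_nhds.2 fun ω => ?_)
    by_cases h : ω ∈ Gd
    · simp only [indicator_of_mem h]; exact hlim ω h t
    · simp only [indicator_of_notMem h, h0 ω h]; exact tendsto_const_nhds
  refine ⟨fun ω => ?_, fun t => ?_, fun t ht => ?_⟩
  · by_cases h : ω ∈ Gd
    · exact hc ω h
    · simp only [h0 ω h]; exact continuous_const
  · exact key t mΩ (hle t _ (hgm t)) (fun n => (hY n).meas t)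
  · exact key t (𝓕 t) (hgm t) (fun n => (hY n).adapted t ht)

end

/-! ### Part 11: bounded drift -/

lemma RC.lip {c c' : ℝ → ℝ → ℝ} {M L : ℝ} (R : RC c c' M L) (s z z' : ℝ) :
    |c s z - c s z'| ≤ L * |z - z'| := by
  have := Convex.norm_image_sub_le_of_norm_hasDerivWithin_le (f := c s) (f' := c' s) (C := L)
    (s := univ) (x := z') (y := z) (fun y _ => (R.hd s y).hasDerivWithinAt) (fun y _ => R.hL s y)
    convex_univ (mem_univ _) (mem_univ _)
  simpa using this

lemma anti_seq {p : ℕ → ℝ → Prop} (h : ∀ n, ∃ δ > 0, p n δ) (hm : ∀ n δ δ', δ' ≤ δ → p n δ → p n δ') :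
    ∃ δ : ℕ → ℝ, (∀ n, 0 < δ n) ∧ Antitone δ ∧ Filter.Tendsto δ Filter.atTop (nhds 0) ∧
      ∀ n, p n (δ n) := by
  choose d hd hp using h
  have hpos : ∀ n, 0 < (Finset.range (n+1)).inf' (by simp) d := fun n => by
    rw [Finset.lt_inf'_iff]; exact fun i _ => hd i
  have hle : ∀ n, (Finset.range (n+1)).inf' (by simp) d ≤ d n := fun n =>
    Finset.inf'_le _ (by simp)
  have hinf : Antitone fun n => (Finset.range (n+1)).inf' (by simp) d := fun i j hij =>
    Finset.inf'_mono _ (by simpa using hij) _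
  refine ⟨fun n => (1/2)^n * (Finset.range (n+1)).inf' (by simp) d, fun n => ?_, ?_, ?_, fun n => ?_⟩
  · have := hpos n; positivity
  · intro i j hij
    have h1 : ((1:ℝ)/2)^j ≤ (1/2)^i := pow_le_pow_of_le_one (by norm_num) (by norm_num) hij
    exact mul_le_mul h1 (hinf hij) (hpos j).le (by positivity)
  · have h1 : Filter.Tendsto (fun n : ℕ => ((1:ℝ)/2)^n * d 0) Filter.atTop (nhds (0 * d 0)) :=
      (tendsto_pow_atTop_nhds_zero_of_lt_one (by norm_num) (by norm_num)).mul_const _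
    rw [zero_mul] at h1
    refine squeeze_zero (fun n => by have := hpos n; positivity) (fun n => ?_) h1
    have : (Finset.range (n+1)).inf' (by simp) d ≤ d 0 := Finset.inf'_le _ (by simp)
    gcongr
  · refine hm n _ _ ?_ (hp n)
    have h1 : ((1:ℝ)/2)^n ≤ 1 := pow_le_one₀ (by norm_num) (by norm_num)
    have := hpos n
    nlinarith [hle n]

section
variable {Ω : Type*} {G0 : MeasurableSpace Ω} {G 𝓕 : ℝ → MeasurableSpace Ω} [mΩ : MeasurableSpace Ω]
  {μ : Measure Ω} {r : ℝ} {V W : ℝ → Ω → ℝ}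

/-- the smaller filtration -/
structure SF (𝓕 G : ℝ → MeasurableSpace Ω) (μ : Measure Ω) (V W : ℝ → Ω → ℝ) : Prop where
  mono : Monotone 𝓕
  le : ∀ t, 𝓕 t ≤ G t
  Vm : ∀ t, 0 ≤ t → Measurable[𝓕 t] (V t)
  Wm : ∀ t, 0 ≤ t → Measurable[𝓕 t] (W t)
  null : ∀ t A, μ A = 0 → MeasurableSet[𝓕 t] A

/-- approximating sequence -/
structure AS (𝓕 G : ℝ → MeasurableSpace Ω) (μ : Measure Ω) (r : ℝ) (V W : ℝ → Ω → ℝ) (x M T : ℝ)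
    (b : ℝ × ℝ → ℝ)
    (c c' : ℕ → ℝ → ℝ → ℝ) (L : ℕ → ℝ) (δ : ℕ → ℝ) (R a : ℕ → ℝ → Ω → ℝ) : Prop where
  rc : ∀ n, RC (c n) (c' n) M (L n)
  ci : ∀ n, Integrable (fun p : ℝ × ℝ => c n p.1 p.2)
  dp : ∀ n, DP 𝓕 x M (R n) (a n)
  ha : ∀ n, ∀ s ∈ Icc 0 T, ∀ ω, a n s ω = c n s (st r V W (R n) s ω)
  δ0 : Filter.Tendsto δ Filter.atTop (nhds 0)
  δa : Antitone δ
  δp : ∀ n, 0 < δ n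
  cb : ∀ n, ∫ p : ℝ × ℝ, |c n p.1 p.2 - b p| ≤ δ n / 2
  k : ∀ n, ∀ (Φ₁ a₁ : ℝ → Ω → ℝ) (q : ℝ × ℝ → ℝ), DP G x M Φ₁ a₁ → 
      Measurable q → (∀ p, |q p| ≤ 2 * M) → Integrable q → ∫ p, |q p| ≤ δ n →
      (∀ s ∈ Icc 0 T, ∀ᵐ ω ∂μ, |a₁ s ω - c n s (st r V W Φ₁ s ω)| ≤ |q (s, st r V W Φ₁ s ω)|) →
      ∀ t ∈ Icc 0 T, ∫ ω, |Φ₁ t ω - R n t ω| ∂μ ≤ (1/2)^n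

lemma exists_AS [IsProbabilityMeasure μ] (S : Setup G0 G μ r V W) (F : SF 𝓕 G μ V W) {M T : ℝ}
    (hM : 0 < M) (hT : 0 < T) {b : ℝ × ℝ → ℝ} (hb : Measurable b)
    (hbM : ∀ p, |b p| ≤ M) (hbi : Integrable b) (x : ℝ) :
    ∃ c c' L δ R a, AS 𝓕 G μ r V W x M T b c c' L δ R a := by
  obtain ⟨δ, hδp, hδa, hδ0, hk⟩ := anti_seq
    (fun n : ℕ => kq S hM hT (by positivity : (0:ℝ) < (1/2)^n))
    (fun n δ δ' hle h x Φ₁ a₁ Φ₂ a₂ c c' L₀ q h1 h2 h3 h4 h5 h6 h7 h8 =>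
      h x Φ₁ a₁ Φ₂ a₂ c c' L₀ q h1 h2 h3 h4 h5 h6 h7 (h8.trans hle))
  choose c c' L hrc hci hcb using fun n => drift_approx hM hb hbM hbi (half_pos (hδp n))
  have hP : CA 𝓕 (fun t ω => (V t ω, W t ω)) :=
    CA.prodMk ⟨S.Vc, fun t => (S.Vm t).mono ((S.G0_le 0).trans (S.le 0)) le_rfl, F.Vm⟩ ⟨S.Wc, S.Wma, F.Wm⟩
  have hR : ∀ n, ∃ Φ : ℝ → Ω → ℝ, DP 𝓕 x M Φ
      (fun s ω => if s ∈ Icc 0 T then c n s (Φ s ω + r * W s ω + V s ω) else 0) := by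
    intro n
    have hcm : Measurable fun p : ℝ × ℝ => c n p.1 p.2 := (hrc n).cc.measurable
    refine picard F.mono hP (F := fun s p y => if s ∈ Icc 0 T then c n s (y + r * p.2 + p.1) else 0)
      ?_ hT.le (lt_max_of_lt_right zero_lt_one : 0 < max (L n) 1) ?_ ?_ ?_ x
    · refine Measurable.ite (measurable_fst measurableSet_Icc) ?_ measurable_const
      exact hcm.comp (by fun_prop : Measurable fun p : ℝ × (ℝ × ℝ) × ℝ => (p.1, p.2.2 + r * p.2.1.2 + p.2.1.1))
    · intro s p y
      split_ifs
      · exact (hrc n).hM _ _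
      · simpa using hM.le
    · intro s p y y'
      split_ifs
      · refine ((hrc n).lip _ _ _).trans ?_
        have : y + r * p.2 + p.1 - (y' + r * p.2 + p.1) = y - y' := by ring
        rw [this]
        gcongr
        exact le_max_left _ _
      · simp only [sub_self, abs_zero]; positivity
    · intro s p y hs
      simp [hs]
  choose R hR using hR
  refine ⟨c, c', L, δ, R, _, ⟨hrc, hci, hR, ?_, hδ0, hδa, hδp, hcb, ?_⟩⟩
  · intro n s hs ω
    simp only [hs, if_true, st]
  · intro n Φ₁ a₁ q hD hq hqM hqi hqδ hle
    refine hk n x Φ₁ a₁ (R n) _ (c n) (c' n) (L n) q hD ((hR n).mono F.le) (hrc n) ?_ hq hqM hqi hqδ hle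
    intro s hs ω
    simp only [hs, if_true, st]

variable {x M T : ℝ} {b : ℝ × ℝ → ℝ} {c c' : ℕ → ℝ → ℝ → ℝ} {L : ℕ → ℝ} {δ : ℕ → ℝ}
  {R a : ℕ → ℝ → Ω → ℝ}

lemma AS.cm (A : AS 𝓕 G μ r V W x M T b c c' L δ R a) (n : ℕ) :
    Measurable fun p : ℝ × ℝ => c n p.1 p.2 := (A.rc n).cc.measurable

lemma AS.cc (A : AS 𝓕 G μ r V W x M T b c c' L δ R a) (hbi : Integrable b) {n m : ℕ} (h : n ≤ m) :
    ∫ p : ℝ × ℝ, |c m p.1 p.2 - c n p.1 p.2| ≤ δ n := by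
  have h1 : ∫ p : ℝ × ℝ, |c m p.1 p.2 - c n p.1 p.2| ≤
      ∫ p : ℝ × ℝ, (|c m p.1 p.2 - b p| + |c n p.1 p.2 - b p|) := by
    apply integral_mono ((A.ci m).sub (A.ci n)).abs
      (((A.ci m).sub hbi).abs.add ((A.ci n).sub hbi).abs)
    intro p
    beta_reduce
    have : c m p.1 p.2 - c n p.1 p.2 = (c m p.1 p.2 - b p) - (c n p.1 p.2 - b p) := by ring
    simp only [Pi.sub_apply, Pi.add_apply]
    rw [this]
    exact abs_sub _ _
  have e : ∫ p : ℝ × ℝ, (|c m p.1 p.2 - b p| + |c n p.1 p.2 - b p|) =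
      (∫ p : ℝ × ℝ, |c m p.1 p.2 - b p|) + ∫ p : ℝ × ℝ, |c n p.1 p.2 - b p| :=
    integral_add ((A.ci m).sub hbi).abs ((A.ci n).sub hbi).abs
  rw [e] at h1
  have := A.cb m
  have := A.cb n
  have := A.δa h
  linarith

lemma AS.RR (A : AS 𝓕 G μ r V W x M T b c c' L δ R a) (F : SF 𝓕 G μ V W) (hbi : Integrable b)
    {n m : ℕ} (h : n ≤ m) (t : ℝ) (ht : t ∈ Icc 0 T) :
    ∫ ω, |R m t ω - R n t ω| ∂μ ≤ (1/2)^n := by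
  refine A.k n (R m) (a m) (fun p => c m p.1 p.2 - c n p.1 p.2) ((A.dp m).mono F.le)
    ((A.cm m).sub (A.cm n)) (fun p => ?_) ((A.ci m).sub (A.ci n)) (A.cc hbi h) ?_ t ht
  · have h1 := (A.rc m).hM p.1 p.2
    have h2 := (A.rc n).hM p.1 p.2
    have h3 := abs_sub (c m p.1 p.2) (c n p.1 p.2)
    linarith
  · intro s hs
    refine Filter.Eventually.of_forall fun ω => ?_
    rw [A.ha m s hs]

lemma DP.lip {Φ a : ℝ → Ω → ℝ} (D : DP G x M Φ a) (ω : Ω) :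
    LipschitzWith M.toNNReal (fun t => Φ t ω) :=
  bd_integral_lipschitz (D.meas_section ω) (D.ab · ω) x _ (D.eq ω)

/-- existence of the limit -/
lemma AS.limit [IsProbabilityMeasure μ] (A : AS 𝓕 G μ r V W x M T b c c' L δ R a)
    (S : Setup G0 G μ r V W) (F : SF 𝓕 G μ V W)
    (hbi : Integrable b) (hT : 0 < T) :
    ∃ Φ, CA 𝓕 Φ ∧ ∀ᵐ ω ∂μ, ∀ t ∈ Icc 0 T,
      Filter.Tendsto (fun n => R n t ω) Filter.atTop (nhds (Φ t ω)) := by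
  have h1 : ∀ᵐ ω ∂μ, ∀ q : ℚ, CauchySeq fun n => R n (cl T q) ω := by
    rw [ae_all_iff]
    intro q
    have hq := cl_mem hT.le (q : ℝ)
    apply ae_cauchy (fun n => (A.dp n).meas _)
    · intro n
      exact ((A.dp n).diff_integrable (A.dp (n+1)) _).abs
    · intro n
      have := A.RR F hbi (Nat.le_succ n) _ hq
      simp_rw [abs_sub_comm (R n _ _)]
      exact this
  set Gd : Set Ω := {ω | ∀ q : ℚ, CauchySeq fun n => R n (cl T q) ω} with hGd
  have hlip : ∀ n ω, LipschitzWith M.toNNReal (fun t => R n (cl T t) ω) := fun n ω => by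
    have := ((A.dp n).lip ω).comp (cl_lip T)
    rwa [mul_one] at this
  have h2 : ∀ ω ∈ Gd, ∀ t, CauchySeq fun n => R n (cl T t) ω := fun ω hω t =>
    eqlip (g := fun n t => R n (cl T t) ω) (fun n => hlip n ω) hω t
  have h3 : ∀ ω, ∃ φ : ℝ → ℝ, (ω ∈ Gd → ∀ t, Filter.Tendsto (fun n => R n (cl T t) ω) Filter.atTop (nhds (φ t)))
      ∧ (ω ∉ Gd → ∀ t, φ t = 0) := by
    intro ω
    by_cases h : ω ∈ Gd
    · choose φ hφ using fun t => cauchySeq_tendsto_of_complete (h2 ω h t)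
      exact ⟨φ, fun _ => hφ, fun h' => absurd h h'⟩
    · exact ⟨fun _ => 0, fun h' => absurd h' h, fun _ _ => rfl⟩
  choose φ hφ hφ0 using h3
  refine ⟨fun t ω => φ ω t, ?_, ?_⟩
  · refine ca_limit (μ := μ) (fun t => (F.le t).trans (S.le t)) F.null
      (Y := fun n t ω => R n (cl T t) ω) (Gd := Gd) ?_ ?_ hφ ?_ hφ0
    · intro n
      exact ca_clamp F.mono (fun t => (F.le t).trans (S.le t)) hT.le
        (fun ω => ((A.dp n).lip ω).continuous.continuousOn) (fun t ht => (A.dp n).ΦG t ht.1)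
    · exact h1
    · intro ω hω
      have : LipschitzWith M.toNNReal (φ ω) := by
        apply LipschitzWith.of_dist_le_mul
        intro s t
        refine le_of_tendsto ((hφ ω hω s).dist (hφ ω hω t)) (Filter.Eventually.of_forall fun n => ?_)
        exact (hlip n ω).dist_le_mul s t
      exact this.continuous
  · filter_upwards [h1] with ω hω t ht
    have := hφ ω hω t
    rwa [cl_of_mem ht] at this

end

/-! ### Part 12: the limit solves the equation -/

lemma eq_of_rat {f g : ℝ → ℝ} {T : ℝ} (hf : Continuous f) (hg : Continuous g)
    (h : ∀ q : ℚ, f (cl T q) = g (cl T q)) : ∀ t ∈ Icc 0 T, f t = g t := by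
  have hc := (cl_lip T).continuous
  have h1 : (fun t => f (cl T t)) = fun t => g (cl T t) := by
    refine Continuous.ext_on Rat.denseRange_cast (hf.comp hc) (hg.comp hc) ?_
    rintro _ ⟨q, rfl⟩
    exact h q
  intro t ht
  have := congrFun h1 t
  simpa only [cl_of_mem ht] using this

section
variable {Ω : Type*} {G0 : MeasurableSpace Ω} {G 𝓕 : ℝ → MeasurableSpace Ω} [mΩ : MeasurableSpace Ω]
  {μ : Measure Ω} {r : ℝ} {V W : ℝ → Ω → ℝ}
  {x M T : ℝ} {b : ℝ × ℝ → ℝ} {c c' : ℕ → ℝ → ℝ → ℝ} {L : ℕ → ℝ} {δ : ℕ → ℝ}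
  {R a : ℕ → ℝ → Ω → ℝ}

lemma DP.diff_le [IsProbabilityMeasure μ] {Φ₁ a₁ Φ₂ a₂ : ℝ → Ω → ℝ} (D₁ : DP G x M Φ₁ a₁)
    (D₂ : DP G x M Φ₂ a₂) {t : ℝ} (ht : t ∈ Icc 0 T) :
    ∫ ω, |Φ₁ t ω - Φ₂ t ω| ∂μ ≤ ∫ s in (0:ℝ)..T, ∫ ω, |a₁ s ω - a₂ s ω| ∂μ := by
  have hdj : Measurable (fun p : ℝ × Ω => |a₁ p.1 p.2 - a₂ p.1 p.2|) := (D₁.am.sub D₂.am).abs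
  have hdb : ∀ s ω, |(|a₁ s ω - a₂ s ω|)| ≤ M + M := fun s ω => by
    rw [abs_abs]
    exact (abs_sub _ _).trans (add_le_add (D₁.ab _ _) (D₂.ab _ _))
  have hT : 0 ≤ T := ht.1.trans ht.2
  have hpath : ∀ ω, |Φ₁ t ω - Φ₂ t ω| ≤ ∫ s in (0:ℝ)..T, |a₁ s ω - a₂ s ω| := fun ω => by
    have e : Φ₁ t ω - Φ₂ t ω = ∫ s in (0:ℝ)..t, (a₁ s ω - a₂ s ω) := by
      rw [intervalIntegral.integral_sub (bd_intervalIntegrable (D₁.meas_section ω) (D₁.ab · ω) 0 t)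
        (bd_intervalIntegrable (D₂.meas_section ω) (D₂.ab · ω) 0 t), D₁.eq, D₂.eq]; ring
    rw [e]
    have hi : ∀ u v, IntervalIntegrable (fun s => |a₁ s ω - a₂ s ω|) volume u v := fun u v =>
      bd_intervalIntegrable (((D₁.meas_section ω).sub (D₂.meas_section ω)).abs) (fun s => hdb s ω) u v
    refine (intervalIntegral.abs_integral_le_integral_abs ht.1).trans ?_
    exact intervalIntegral.integral_mono_interval le_rfl ht.1 ht.2
      (Filter.Eventually.of_forall fun s => abs_nonneg _) (hi _ _)
  have hIg : Integrable (Function.uncurry fun (ω : Ω) (s : ℝ) => |a₁ s ω - a₂ s ω|)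
      (μ.prod (volume.restrict (Ioc 0 T))) :=
    Integrable.of_bound (hdj.comp measurable_swap).aestronglyMeasurable (M + M)
      (Filter.Eventually.of_forall fun p => hdb _ _)
  have hswap : ∫ ω, (∫ s in (0:ℝ)..T, |a₁ s ω - a₂ s ω|) ∂μ =
      ∫ s in (0:ℝ)..T, ∫ ω, |a₁ s ω - a₂ s ω| ∂μ := by
    simp_rw [intervalIntegral.integral_of_le hT]
    rw [integral_integral_swap hIg]
  rw [← hswap]
  refine integral_mono (D₁.diff_integrable D₂ t).abs ?_ hpath
  simp_rw [intervalIntegral.integral_of_le hT]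
  exact hIg.integral_prod_left

lemma AS.RΦ [IsProbabilityMeasure μ] (A : AS 𝓕 G μ r V W x M T b c c' L δ R a)
    (F : SF 𝓕 G μ V W) (hbi : Integrable b) {Φ : ℝ → Ω → ℝ} (hΦ : CA 𝓕 Φ)
    (hl : ∀ᵐ ω ∂μ, ∀ t ∈ Icc 0 T,
      Filter.Tendsto (fun n => R n t ω) Filter.atTop (nhds (Φ t ω))) (n : ℕ) {t : ℝ}
    (ht : t ∈ Icc 0 T) :
    Integrable (fun ω => |R n t ω - Φ t ω|) μ ∧ ∫ ω, |R n t ω - Φ t ω| ∂μ ≤ (1/2)^n := by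
  have hb : ∀ m ω, |R n t ω - R m t ω| ≤ 2 * M * |t| := fun m ω => (A.dp n).bdd_diff (A.dp m) t ω
  have hpt : ∀ᵐ ω ∂μ, Filter.Tendsto (fun m => |R n t ω - R m t ω|) Filter.atTop
      (nhds (|R n t ω - Φ t ω|)) := by
    filter_upwards [hl] with ω hω
    exact (tendsto_const_nhds.sub (hω t ht)).abs
  constructor
  · refine Integrable.of_bound (C := 2 * M * |t|)
      (((A.dp n).meas t).sub (hΦ.meas t)).abs.aestronglyMeasurable ?_
    filter_upwards [hpt] with ω hω
    rw [Real.norm_eq_abs, abs_abs]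
    exact le_of_tendsto hω (Filter.Eventually.of_forall fun m => hb m ω)
  · have h1 : Filter.Tendsto (fun m => ∫ ω, |R n t ω - R m t ω| ∂μ) Filter.atTop
        (nhds (∫ ω, |R n t ω - Φ t ω| ∂μ)) := by
      apply tendsto_integral_of_dominated_convergence (fun _ => 2 * M * |t|)
      · exact fun m => (((A.dp n).meas t).sub ((A.dp m).meas t)).abs.aestronglyMeasurable
      · exact integrable_const _
      · intro m
        refine Filter.Eventually.of_forall fun ω => ?_
        rw [Real.norm_eq_abs, abs_abs]
        exact hb m ω
      · exact hpt
    refine le_of_tendsto h1 (Filter.eventually_atTop.2 ⟨n, fun m hm => ?_⟩)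
    have := A.RR F hbi hm t ht
    simp_rw [abs_sub_comm (R n _ _)]
    exact this

/-- The limit solves the equation. -/
lemma AS.solves [IsProbabilityMeasure μ] (A : AS 𝓕 G μ r V W x M T b c c' L δ R a)
    (S : Setup G0 G μ r V W) (F : SF 𝓕 G μ V W) (hM : 0 < M) (hb : Measurable b)
    (hbM : ∀ p, |b p| ≤ M) (hbi : Integrable b) (hT : 0 < T)
    {Φ : ℝ → Ω → ℝ} (hΦ : CA 𝓕 Φ)
    (hl : ∀ᵐ ω ∂μ, ∀ t ∈ Icc 0 T,
      Filter.Tendsto (fun n => R n t ω) Filter.atTop (nhds (Φ t ω))) :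
    ∀ᵐ ω ∂μ, ∀ t ∈ Icc 0 T, Φ t ω = x + ∫ s in (0:ℝ)..t, b (s, st r V W Φ s ω) := by
  have hstj : Measurable (fun p : ℝ × Ω => st r V W Φ p.1 p.2) :=
    (hΦ.j.add (S.Wj.const_mul r)).add S.Vj
  set Ψ : ℝ → Ω → ℝ := fun t ω => x + ∫ s in (0:ℝ)..t, b (s, st r V W Φ s ω) with hΨ
  have hDΨ : DP G x M Ψ (fun s ω => b (s, st r V W Φ s ω)) := by
    have hP : CA G (fun t ω => ((V t ω, W t ω), Φ t ω)) :=
      CA.prodMk (CA.prodMk ⟨S.Vc, S.Vma, fun t ht => (S.Vm t).mono (S.G0_le t) le_rfl⟩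
        ⟨S.Wc, S.Wma, S.Wm⟩) (hΦ.mono F.le)
    exact DP_of S.mono hP (F := fun s p => b (s, p.2 + r * p.1.2 + p.1.1))
      (hb.comp (by fun_prop : Measurable fun p : ℝ × (ℝ × ℝ) × ℝ =>
        (p.1, p.2.2 + r * p.2.1.2 + p.2.1.1))) (fun s p => hbM _) (fun ω t => rfl)
  obtain ⟨K, hK, hkry⟩ := kry_DP S hM.le hT.le
  have hKR : ∀ n, Kry μ K T (st r V W (R n)) := fun n => hkry x (R n) (a n) ((A.dp n).mono F.le)
  have hKΦ : Kry μ K T (st r V W Φ) := by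
    refine kry_limit hKR (fun n t => st_meas S ((A.dp n).mono F.le) t) ?_
    intro t ht
    filter_upwards [hl] with ω hω
    exact ((hω t ht).add tendsto_const_nhds).add tendsto_const_nhds
  have hLn : ∀ n, 0 ≤ L n := fun n => (abs_nonneg _).trans ((A.rc n).hL 0 0)
  have hsec : ∀ s : ℝ, Measurable fun ω : Ω => (s, ω) := fun s => by fun_prop
  have key : ∀ t ∈ Icc 0 T, Filter.Tendsto (fun n => ∫ ω, |R n t ω - Ψ t ω| ∂μ) Filter.atTop
      (nhds 0) := by
    intro t ht
    rw [Metric.tendsto_atTop]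
    intro ε hε
    obtain ⟨d, hd, hkq⟩ := kry_q (μ := μ) hK.le hT (by positivity : 0 < 2 * M)
      (by positivity : 0 < ε / 4)
    obtain ⟨m, hm⟩ := (A.δ0.eventually (gt_mem_nhds hd)).exists
    have hlim : Filter.Tendsto (fun n : ℕ => T * (L m * (1/2)^n)) Filter.atTop (nhds 0) := by
      have : Filter.Tendsto (fun n : ℕ => T * (L m * (1/2:ℝ)^n)) Filter.atTop
          (nhds (T * (L m * 0))) :=
        ((tendsto_pow_atTop_nhds_zero_of_lt_one (by norm_num) (by norm_num)).const_mul _).const_mul _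
      simpa using this
    obtain ⟨N, hN⟩ := Filter.eventually_atTop.1 (hlim.eventually (gt_mem_nhds (by positivity : 0 < ε/4)))
    refine ⟨max N m, fun n hn => ?_⟩
    have hnm : m ≤ n := (le_max_right _ _).trans hn
    rw [Real.dist_eq, sub_zero, abs_of_nonneg (integral_nonneg fun ω => abs_nonneg _)]
    have h0 := ((A.dp n).mono F.le).diff_le hDΨ (μ := μ) ht
    have hq1 : ∀ n', ∀ p : ℝ × ℝ, |c n' p.1 p.2 - c m p.1 p.2| ≤ 2 * M := fun n' p => by
      have h1 := (A.rc n').hM p.1 p.2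
      have h2 := (A.rc m).hM p.1 p.2
      have h3 := abs_sub (c n' p.1 p.2) (c m p.1 p.2)
      linarith
    have hq2 : ∀ p : ℝ × ℝ, |c m p.1 p.2 - b p| ≤ 2 * M := fun p => by
      have h1 := hbM p
      have h2 := (A.rc m).hM p.1 p.2
      have h3 := abs_sub (c m p.1 p.2) (b p)
      linarith
    have hq1m : Measurable fun p : ℝ × ℝ => c n p.1 p.2 - c m p.1 p.2 := (A.cm n).sub (A.cm m)
    have hq2m : Measurable fun p : ℝ × ℝ => c m p.1 p.2 - b p := (A.cm m).sub hb
    have hRj := st_jmeas S ((A.dp n).mono F.le)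
    have h1 := hkq (st r V W (R n)) (hKR n) hRj
      (fun p => c n p.1 p.2 - c m p.1 p.2) hq1m (hq1 n) ((A.ci n).sub (A.ci m))
      ((A.cc hbi hnm).trans hm.le)
    have h2 := hkq (st r V W Φ) hKΦ hstj (fun p => c m p.1 p.2 - b p) hq2m hq2 ((A.ci m).sub hbi)
      ((A.cb m).trans (by have := A.δp m; linarith))
    have j1 : Measurable fun p : ℝ × Ω => |c n p.1 (st r V W (R n) p.1 p.2) -
        c m p.1 (st r V W (R n) p.1 p.2)| := (hq1m.comp (measurable_fst.prodMk hRj)).abs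
    have j2 : Measurable fun p : ℝ × Ω => |c m p.1 (st r V W Φ p.1 p.2) -
        b (p.1, st r V W Φ p.1 p.2)| := (hq2m.comp (measurable_fst.prodMk hstj)).abs
    have b1 : ∀ s ω, |(|c n s (st r V W (R n) s ω) - c m s (st r V W (R n) s ω)|)| ≤ 2 * M :=
      fun s ω => by rw [abs_abs]; exact hq1 n (s, st r V W (R n) s ω)
    have b2 : ∀ s ω, |(|c m s (st r V W Φ s ω) - b (s, st r V W Φ s ω)|)| ≤ 2 * M :=
      fun s ω => by rw [abs_abs]; exact hq2 (s, st r V W Φ s ω)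
    have i1 := avg_intervalIntegrable (μ := μ)
      (g := fun s ω => |c n s (st r V W (R n) s ω) - c m s (st r V W (R n) s ω)|) j1 b1 0 T
    have i2 := avg_intervalIntegrable (μ := μ)
      (g := fun s ω => |c m s (st r V W Φ s ω) - b (s, st r V W Φ s ω)|) j2 b2 0 T
    have h3 : (∫ s in (0:ℝ)..T, ∫ ω, |a n s ω - b (s, st r V W Φ s ω)| ∂μ) ≤
        ∫ s in (0:ℝ)..T, ((∫ ω, |c n s (st r V W (R n) s ω) - c m s (st r V W (R n) s ω)| ∂μ) +
          (∫ ω, |c m s (st r V W Φ s ω) - b (s, st r V W Φ s ω)| ∂μ) + L m * (1/2)^n) := by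
      apply intervalIntegral.integral_mono_on hT.le
      · refine avg_intervalIntegrable (g := fun s ω => |a n s ω - b (s, st r V W Φ s ω)|)
          (((A.dp n).am.sub hDΨ.am).abs) (M := M + M) (fun s ω => ?_) 0 T
        rw [abs_abs]
        exact (abs_sub _ _).trans (add_le_add ((A.dp n).ab _ _) (hbM _))
      · exact (i1.add i2).add (by simp)
      · intro s hs
        obtain ⟨hRi, hRle⟩ := A.RΦ F hbi hΦ hl n hs
        have k1 : Integrable (fun ω => |c n s (st r V W (R n) s ω) - c m s (st r V W (R n) s ω)|) μ :=
          Integrable.of_bound (C := 2 * M) (j1.comp (hsec s)).aestronglyMeasurable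
            (Filter.Eventually.of_forall fun ω => b1 s ω)
        have k2 : Integrable (fun ω => |c m s (st r V W Φ s ω) - b (s, st r V W Φ s ω)|) μ :=
          Integrable.of_bound (C := 2 * M) (j2.comp (hsec s)).aestronglyMeasurable
            (Filter.Eventually.of_forall fun ω => b2 s ω)
        have k12 : Integrable (fun ω => |c n s (st r V W (R n) s ω) - c m s (st r V W (R n) s ω)| +
            |c m s (st r V W Φ s ω) - b (s, st r V W Φ s ω)|) μ := k1.add k2
        have k123 : Integrable (fun ω => |c n s (st r V W (R n) s ω) - c m s (st r V W (R n) s ω)| +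
            |c m s (st r V W Φ s ω) - b (s, st r V W Φ s ω)| + L m * |R n s ω - Φ s ω|) μ :=
          k12.add (hRi.const_mul _)
        have e : (∫ ω, |c n s (st r V W (R n) s ω) - c m s (st r V W (R n) s ω)| ∂μ) +
          (∫ ω, |c m s (st r V W Φ s ω) - b (s, st r V W Φ s ω)| ∂μ) +
          L m * (∫ ω, |R n s ω - Φ s ω| ∂μ) =
          ∫ ω, (|c n s (st r V W (R n) s ω) - c m s (st r V W (R n) s ω)| +
            |c m s (st r V W Φ s ω) - b (s, st r V W Φ s ω)| + L m * |R n s ω - Φ s ω|) ∂μ := by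
          rw [integral_add k12 (hRi.const_mul _), integral_add k1 k2, integral_const_mul]
        have h4 : (∫ ω, |a n s ω - b (s, st r V W Φ s ω)| ∂μ) ≤
            ∫ ω, (|c n s (st r V W (R n) s ω) - c m s (st r V W (R n) s ω)| +
            |c m s (st r V W Φ s ω) - b (s, st r V W Φ s ω)| + L m * |R n s ω - Φ s ω|) ∂μ := by
          apply integral_mono_of_nonneg (Filter.Eventually.of_forall fun ω => abs_nonneg _)
            k123
          refine Filter.Eventually.of_forall fun ω => ?_
          beta_reduce
          rw [A.ha n s hs]
          have l := (A.rc m).lip s (st r V W (R n) s ω) (st r V W Φ s ω)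
          have e1 : st r V W (R n) s ω - st r V W Φ s ω = R n s ω - Φ s ω := by
            simp only [st]; ring
          rw [e1] at l
          have e2 : c n s (st r V W (R n) s ω) - b (s, st r V W Φ s ω) =
            (c n s (st r V W (R n) s ω) - c m s (st r V W (R n) s ω)) +
            (c m s (st r V W Φ s ω) - b (s, st r V W Φ s ω)) +
            (c m s (st r V W (R n) s ω) - c m s (st r V W Φ s ω)) := by ring
          rw [e2]
          exact (abs_add_three _ _ _).trans (by linarith)
        have h5 := mul_le_mul_of_nonneg_left hRle (hLn m)
        linarith
    rw [intervalIntegral.integral_add (i1.add i2) (by simp), intervalIntegral.integral_add i1 i2,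
      intervalIntegral.integral_const] at h3
    simp only [sub_zero, smul_eq_mul] at h3
    have h4 := hN n ((le_max_left _ _).trans hn)
    linarith
  have hfin : ∀ t ∈ Icc 0 T, ∀ᵐ ω ∂μ, Φ t ω = Ψ t ω := by
    intro t ht
    have := ae_nonpos_of_le (μ := μ) (f := fun ω => |Φ t ω - Ψ t ω|)
      (g := fun n ω => |R n t ω - Φ t ω| + |R n t ω - Ψ t ω|)
      (e := fun n => (1/2)^n + ∫ ω, |R n t ω - Ψ t ω| ∂μ)
      ((hΦ.meas t).sub (hDΨ.meas t)).abs
      (fun n => Filter.Eventually.of_forall fun ω => ?_) (fun n => ?_) (fun n ω => by positivity)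
      (fun n => ?_) ?_
    · filter_upwards [this] with ω hω
      exact sub_eq_zero.1 (abs_nonpos_iff.1 hω)
    · have : Φ t ω - Ψ t ω = (R n t ω - Ψ t ω) - (R n t ω - Φ t ω) := by ring
      rw [this]
      exact (abs_sub _ _).trans (by linarith)
    · exact (A.RΦ F hbi hΦ hl n ht).1.add (((A.dp n).mono F.le).diff_integrable hDΨ t).abs
    · rw [integral_add (A.RΦ F hbi hΦ hl n ht).1 (((A.dp n).mono F.le).diff_integrable hDΨ t).abs]
      have := (A.RΦ F hbi hΦ hl n ht).2
      linarith
    · have : Filter.Tendsto (fun n : ℕ => ((1:ℝ)/2)^n) Filter.atTop (nhds 0) :=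
        tendsto_pow_atTop_nhds_zero_of_lt_one (by norm_num) (by norm_num)
      simpa using this.add (key t ht)
  have hall : ∀ᵐ ω ∂μ, ∀ q : ℚ, Φ (cl T q) ω = Ψ (cl T q) ω :=
    ae_all_iff.2 fun q => hfin _ (cl_mem hT.le _)
  filter_upwards [hall] with ω hω
  exact eq_of_rat (hΦ.cont ω) (hDΨ.cont ω) hω

end

/-! ### Part 13: local uniqueness -/

section
variable {Ω : Type*} {G0 : MeasurableSpace Ω} {G 𝓕 : ℝ → MeasurableSpace Ω} [mΩ : MeasurableSpace Ω]
  {μ : Measure Ω} {r : ℝ} {V W : ℝ → Ω → ℝ}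
  {x M T : ℝ} {b : ℝ × ℝ → ℝ} {c c' : ℕ → ℝ → ℝ → ℝ} {L : ℕ → ℝ} {δ : ℕ → ℝ}
  {R a : ℕ → ℝ → Ω → ℝ}

lemma AS.unique [IsProbabilityMeasure μ] (A : AS 𝓕 G μ r V W x M T b c c' L δ R a)
    (S : Setup G0 G μ r V W) (F : SF 𝓕 G μ V W) (hM : 0 < M) (hb : Measurable b)
    (hbM : ∀ p, |b p| ≤ M) (hbi : Integrable b) (hT : 0 < T)
    {Φ : ℝ → Ω → ℝ} (hΦ : CA 𝓕 Φ)
    (hl : ∀ᵐ ω ∂μ, ∀ t ∈ Icc 0 T,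
      Filter.Tendsto (fun n => R n t ω) Filter.atTop (nhds (Φ t ω)))
    {X J : ℝ → Ω → ℝ} (hX : CA G X) (hJ : CA G J)
    (hJm : ∀ ω s t, 0 ≤ s → s ≤ t → J t ω = 0 → J s ω = 0)
    (hXeq : ∀ᵐ ω ∂μ, ∀ t ∈ Icc 0 T, J t ω = 0 →
      X t ω = x + (∫ s in (0:ℝ)..t, b (s, X s ω)) + r * W t ω + V t ω) :
    ∀ᵐ ω ∂μ, J T ω = 0 → ∀ t ∈ Icc 0 T, X t ω = st r V W Φ t ω := by
  have hP : CA G (fun t ω => ((X t ω, J t ω), (V t ω, W t ω))) :=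
    CA.prodMk (CA.prodMk hX hJ) (CA.prodMk
      ⟨S.Vc, S.Vma, fun t ht => (S.Vm t).mono (S.G0_le t) le_rfl⟩ ⟨S.Wc, S.Wma, S.Wm⟩)
  have hY : ∀ n, ∃ Y : ℝ → Ω → ℝ, DP G x M Y (fun s ω => if s ∈ Icc 0 T then
      (if J s ω = 0 then b (s, X s ω) else c n s (Y s ω + r * W s ω + V s ω)) else 0) := by
    intro n
    have hLn : 0 ≤ L n := (abs_nonneg _).trans ((A.rc n).hL 0 0)
    refine picard S.mono hP (F := fun s p y => if s ∈ Icc 0 T then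
      (if p.1.2 = 0 then b (s, p.1.1) else c n s (y + r * p.2.2 + p.2.1)) else 0)
      ?_ hT.le (lt_max_of_lt_right zero_lt_one : 0 < max (L n) 1) ?_ ?_ ?_ x
    · refine Measurable.ite (measurable_fst measurableSet_Icc) ?_ measurable_const
      refine Measurable.ite ?_ ?_ ?_
      · exact (by fun_prop : Measurable fun p : ℝ × ((ℝ × ℝ) × (ℝ × ℝ)) × ℝ => p.2.1.1.2)
          (measurableSet_singleton 0)
      · exact hb.comp (by fun_prop : Measurable fun p : ℝ × ((ℝ × ℝ) × (ℝ × ℝ)) × ℝ =>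
          (p.1, p.2.1.1.1))
      · exact (A.cm n).comp (by fun_prop : Measurable fun p : ℝ × ((ℝ × ℝ) × (ℝ × ℝ)) × ℝ =>
          (p.1, p.2.2 + r * p.2.1.2.2 + p.2.1.2.1))
    · intro s p y
      split_ifs
      · exact hbM _
      · exact (A.rc n).hM _ _
      · simpa using hM.le
    · intro s p y y'
      split_ifs
      · simp only [sub_self, abs_zero]; positivity
      · refine ((A.rc n).lip _ _ _).trans ?_
        have : y + r * p.2.2 + p.2.1 - (y' + r * p.2.2 + p.2.1) = y - y' := by ring
        rw [this]
        gcongr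
        exact le_max_left _ _
      · simp only [sub_self, abs_zero]; positivity
    · intro s p y hs
      simp [hs]
  choose Y hY using hY
  have hst : ∀ n, ∀ᵐ ω ∂μ, ∀ t ∈ Icc 0 T, J t ω = 0 → st r V W (Y n) t ω = X t ω := by
    intro n
    filter_upwards [hXeq] with ω hω t ht hJt
    rw [hω t ht hJt]
    simp only [st]
    rw [(hY n).eq ω t]
    congr 3
    apply intervalIntegral.integral_congr
    intro s hs
    rw [uIcc_of_le ht.1] at hs
    have hsT : s ∈ Icc 0 T := ⟨hs.1, hs.2.trans ht.2⟩
    have hJs : J s ω = 0 := hJm ω s t hs.1 hs.2 hJt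
    simp only [hsT, if_true, hJs]
  have hYR : ∀ n, ∀ t ∈ Icc 0 T, ∫ ω, |Y n t ω - R n t ω| ∂μ ≤ (1/2)^n := by
    intro n
    refine A.k n (Y n) _ (fun p => c n p.1 p.2 - b p) (hY n)
      ((A.cm n).sub hb) (fun p => ?_) ((A.ci n).sub hbi)
      ((A.cb n).trans (by have := A.δp n; linarith)) ?_
    · have h1 := hbM p
      have h2 := (A.rc n).hM p.1 p.2
      have h3 := abs_sub (c n p.1 p.2) (b p)
      linarith
    · intro s hs
      filter_upwards [hst n] with ω hω
      simp only [hs, if_true]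
      split_ifs with hJs
      · rw [← hω s hs hJs, abs_sub_comm]
      · have : Y n s ω + r * W s ω + V s ω = st r V W (Y n) s ω := rfl
        rw [this, sub_self, abs_zero]
        exact abs_nonneg _
  have hfin : ∀ t ∈ Icc 0 T, ∀ᵐ ω ∂μ, J t ω = 0 → X t ω = st r V W Φ t ω := by
    intro t ht
    have hΦm : Measurable (st r V W Φ t) :=
      ((hΦ.meas t).add ((S.Wma t).const_mul r)).add (S.Vma t)
    have := ae_nonpos_of_le (μ := μ) (f := fun ω => if J t ω = 0 then |X t ω - st r V W Φ t ω| else 0)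
      (g := fun n ω => |Y n t ω - R n t ω| + |R n t ω - Φ t ω|)
      (e := fun n => (1/2)^n + (1/2)^n)
      (Measurable.ite (hJ.meas t (measurableSet_singleton 0)) ((hX.meas t).sub hΦm).abs
        measurable_const)
      (fun n => ?_) (fun n => ?_) (fun n ω => by positivity)
      (fun n => ?_) ?_
    · filter_upwards [this] with ω hω h0
      rw [if_pos h0] at hω
      exact sub_eq_zero.1 (abs_nonpos_iff.1 hω)
    · filter_upwards [hst n] with ω hω
      split_ifs with h0
      · rw [← hω t ht h0]
        have : st r V W (Y n) t ω - st r V W Φ t ω = (Y n t ω - R n t ω) + (R n t ω - Φ t ω) := by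
          simp only [st]; ring
        rw [this]
        exact abs_add_le _ _
      · positivity
    · exact ((hY n).diff_integrable ((A.dp n).mono F.le) t).abs.add (A.RΦ F hbi hΦ hl n ht).1
    · rw [integral_add ((hY n).diff_integrable ((A.dp n).mono F.le) t).abs
        (A.RΦ F hbi hΦ hl n ht).1]
      have := (A.RΦ F hbi hΦ hl n ht).2
      have := hYR n t ht
      linarith
    · have : Filter.Tendsto (fun n : ℕ => ((1:ℝ)/2)^n) Filter.atTop (nhds 0) :=
        tendsto_pow_atTop_nhds_zero_of_lt_one (by norm_num) (by norm_num)
      simpa using this.add this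
  have hall : ∀ᵐ ω ∂μ, ∀ q : ℚ, J (cl T q) ω = 0 → X (cl T q) ω = st r V W Φ (cl T q) ω :=
    ae_all_iff.2 fun q => hfin _ (cl_mem hT.le _)
  filter_upwards [hall] with ω hω hJT
  refine eq_of_rat (hX.cont ω) (((hΦ.cont ω).add ((S.Wc ω).const_mul r)).add (S.Vc ω)) fun q => ?_
  exact hω q (hJm ω _ _ (cl_mem hT.le _).1 (cl_mem hT.le _).2 hJT)

lemma bounded_main [IsProbabilityMeasure μ]
    (S : Setup G0 G μ r V W) (F : SF 𝓕 G μ V W) (hM : 0 < M) (hb : Measurable b)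
    (hbM : ∀ p, |b p| ≤ M) (hbi : Integrable b) (hT : 0 < T) (x : ℝ) :
    ∃ Φ : ℝ → Ω → ℝ, CA 𝓕 Φ ∧
      (∀ᵐ ω ∂μ, ∀ t ∈ Icc 0 T, Φ t ω = x + ∫ s in (0:ℝ)..t, b (s, st r V W Φ s ω)) ∧
      ∀ X J : ℝ → Ω → ℝ, CA G X → CA G J → (∀ ω s t, 0 ≤ s → s ≤ t → J t ω = 0 → J s ω = 0) →
        (∀ᵐ ω ∂μ, ∀ t ∈ Icc 0 T, J t ω = 0 →
          X t ω = x + (∫ s in (0:ℝ)..t, b (s, X s ω)) + r * W t ω + V t ω) →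
        ∀ᵐ ω ∂μ, J T ω = 0 → ∀ t ∈ Icc 0 T, X t ω = st r V W Φ t ω := by
  obtain ⟨c, c', L, δ, R, a, A⟩ := exists_AS S F hM hT hb hbM hbi x
  obtain ⟨Φ, hΦ, hl⟩ := A.limit S F hbi hT
  exact ⟨Φ, hΦ, A.solves S F hM hb hbM hbi hT hΦ hl,
    fun X J hX hJ hJm hXe => A.unique S F hM hb hbM hbi hT hΦ hl hX hJ hJm hXe⟩

end

/-! ### Part 14: gluing -/

lemma gron {y : ℝ → ℝ} {A C T : ℝ} (hy : Continuous y) (hA : 0 ≤ A) (hC : 0 ≤ C)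
    (h : ∀ t ∈ Icc 0 T, |y t| ≤ A + ∫ s in (0:ℝ)..t, C * (1 + |y s|)) :
    ∀ t ∈ Icc 0 T, |y t| ≤ gronwallBound A C C T := by
  have hg : Continuous fun s => C * (1 + |y s|) := by fun_prop
  have hd : ∀ t, HasDerivAt (fun t => A + ∫ s in (0:ℝ)..t, C * (1 + |y s|)) (C * (1 + |y t|)) t :=
    fun t => (hg.integral_hasStrictDerivAt 0 t).hasDerivAt.const_add A
  have h1 := norm_le_gronwallBound_of_norm_deriv_right_le (a := 0) (b := T) (δ := A) (K := C) (ε := C)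
    (f := fun t => A + ∫ s in (0:ℝ)..t, C * (1 + |y s|)) (f' := fun t => C * (1 + |y t|))
    (fun t _ => (hd t).continuousAt.continuousWithinAt) (fun t _ => (hd t).hasDerivWithinAt)
    (by simp [abs_of_nonneg hA]) (fun t ht => by
      have h2 := h t ⟨ht.1, ht.2.le⟩
      have h3 := le_abs_self (A + ∫ s in (0:ℝ)..t, C * (1 + |y s|))
      rw [Real.norm_eq_abs, Real.norm_eq_abs, abs_of_nonneg (by positivity)]
      nlinarith)
  intro t ht
  refine (h t ht).trans ((le_abs_self _).trans ((h1 t ht).trans ?_))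
  exact gronwallBound_mono hA hC hC (by linarith [ht.2])

/-- truncated drift -/
def trc (T : ℝ) (b : ℝ → ℝ → ℝ) (N : ℕ) (p : ℝ × ℝ) : ℝ :=
  (Icc 0 T ×ˢ Icc (-(N:ℝ)) N).indicator (fun p => b p.1 p.2) p

lemma trc_eq {T : ℝ} {b : ℝ → ℝ → ℝ} {N : ℕ} {s z : ℝ} (hs : s ∈ Icc 0 T) (hz : |z| ≤ N) :
    trc T b N (s, z) = b s z :=
  indicator_of_mem (show (s, z) ∈ Icc 0 T ×ˢ Icc (-(N:ℝ)) N from ⟨hs, abs_le.1 hz⟩) _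

lemma trc_meas {T : ℝ} {b : ℝ → ℝ → ℝ} (hb : Measurable fun p : ℝ × ℝ => b p.1 p.2) (N : ℕ) :
    Measurable (trc T b N) :=
  hb.indicator (measurableSet_Icc.prod measurableSet_Icc)

lemma trc_le {T C : ℝ} {b : ℝ → ℝ → ℝ} (hC : 0 < C)
    (hbC : ∀ t ∈ Icc 0 T, ∀ z, |b t z| ≤ C * (1 + |z|)) (N : ℕ) (p : ℝ × ℝ) :
    |trc T b N p| ≤ C * (1 + |p.2|) := by
  unfold trc
  by_cases h : p ∈ Icc 0 T ×ˢ Icc (-(N:ℝ)) N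
  · rw [indicator_of_mem h]; exact hbC _ h.1 _
  · rw [indicator_of_notMem h]; simp only [abs_zero]; positivity

lemma trc_bd {T C : ℝ} {b : ℝ → ℝ → ℝ} (hC : 0 < C)
    (hbC : ∀ t ∈ Icc 0 T, ∀ z, |b t z| ≤ C * (1 + |z|)) (N : ℕ) (p : ℝ × ℝ) :
    |trc T b N p| ≤ C * (1 + N) := by
  unfold trc
  by_cases h : p ∈ Icc 0 T ×ˢ Icc (-(N:ℝ)) N
  · rw [indicator_of_mem h]
    refine (hbC _ h.1 _).trans ?_
    have : |p.2| ≤ N := abs_le.2 h.2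
    gcongr
  · rw [indicator_of_notMem h]; simp only [abs_zero]; positivity

lemma trc_int {T C : ℝ} {b : ℝ → ℝ → ℝ} (hC : 0 < C) (hb : Measurable fun p : ℝ × ℝ => b p.1 p.2)
    (hbC : ∀ t ∈ Icc 0 T, ∀ z, |b t z| ≤ C * (1 + |z|)) (N : ℕ) :
    Integrable (trc T b N) := by
  have hms : MeasurableSet (Icc 0 T ×ˢ Icc (-(N:ℝ)) N) := measurableSet_Icc.prod measurableSet_Icc
  have : IntegrableOn (trc T b N) (Icc 0 T ×ˢ Icc (-(N:ℝ)) N) := by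
    refine Measure.integrableOn_of_bounded (M := C * (1 + N)) ?_ (trc_meas hb N).aestronglyMeasurable
      (Filter.Eventually.of_forall fun p => trc_bd hC hbC N p)
    exact ((isCompact_Icc.prod isCompact_Icc).measure_lt_top).ne
  have h2 := this.integrable_indicator hms
  have e : trc T b N = (Icc 0 T ×ˢ Icc (-(N:ℝ)) N).indicator (trc T b N) := by
    ext p
    by_cases h : p ∈ Icc 0 T ×ˢ Icc (-(N:ℝ)) N
    · rw [indicator_of_mem h]
    · rw [indicator_of_notMem h, trc, indicator_of_notMem h]
  rw [e]
  exact h2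

section
variable {Ω : Type*} {G0 : MeasurableSpace Ω} {G 𝓕 : ℝ → MeasurableSpace Ω} [mΩ : MeasurableSpace Ω]
  {μ : Measure Ω} {r : ℝ} {V W : ℝ → Ω → ℝ} {x T : ℝ} 

/-- localisation functional -/
def JJ (X : ℝ → Ω → ℝ) (N : ℕ) (t : ℝ) (ω : Ω) : ℝ :=
  ∫ s in (0:ℝ)..|t|, max (|X s ω| - N) 0

lemma JJ_ca (hmono : Monotone G) {X : ℝ → Ω → ℝ} (hX : CA G X) (N : ℕ) : CA G (JJ X N) := by
  have hF : Measurable fun p : ℝ × ℝ => max (|p.2| - (N:ℝ)) 0 := by fun_prop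
  refine ⟨fun ω => ?_, fun t => ?_, fun t ht => ?_⟩
  · have hc : Continuous fun s => max (|X s ω| - (N:ℝ)) 0 := by
      have := hX.cont ω
      fun_prop
    exact (intervalIntegral.continuous_primitive (fun u v => hc.intervalIntegrable u v) 0).comp
      continuous_abs
  · exact int_meas (F := fun _ z => max (|z| - (N:ℝ)) 0) (abs_nonneg t) hX.cont
      (fun s _ => hX.meas s) hF
  · have := @int_meas Ω ℝ (G t) _ _ _ _ X |t| (abs_nonneg t) hX.cont
      (fun s hs => (hX.adapted s hs.1).mono (hmono (by rw [abs_of_nonneg ht] at hs; exact hs.2)) le_rfl)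
      (fun _ z => max (|z| - (N:ℝ)) 0) hF
    exact this

lemma JJ_mono {Ω : Type*} {X : ℝ → Ω → ℝ} (hX : ∀ ω, Continuous fun t => X t ω) (N : ℕ) (ω : Ω) (s t : ℝ)
    (hs : 0 ≤ s) (hst : s ≤ t) (h : JJ X N t ω = 0) : JJ X N s ω = 0 := by
  have hc : Continuous fun s => max (|X s ω| - (N:ℝ)) 0 := by
    have := hX ω
    fun_prop
  refine le_antisymm ?_ (intervalIntegral.integral_nonneg (abs_nonneg _) fun u _ => le_max_right _ _)
  rw [← h]
  refine intervalIntegral.integral_mono_interval le_rfl (abs_nonneg _) ?_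
    (Filter.Eventually.of_forall fun u => le_max_right _ _) (hc.intervalIntegrable _ _)
  rwa [abs_of_nonneg hs, abs_of_nonneg (hs.trans hst)]

lemma JJ_zero {Ω : Type*} {X : ℝ → Ω → ℝ} {N : ℕ} {ω : Ω} {t : ℝ} (ht : 0 ≤ t)
    (h : ∀ s ∈ Icc 0 t, |X s ω| ≤ N) : JJ X N t ω = 0 := by
  unfold JJ
  rw [abs_of_nonneg ht]
  rw [intervalIntegral.integral_congr (g := fun _ => 0), intervalIntegral.integral_zero]
  intro s hs
  rw [uIcc_of_le ht] at hs
  exact max_eq_right (by linarith [h s hs])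

lemma JJ_ae {Ω : Type*} {X : ℝ → Ω → ℝ} (hX : ∀ ω, Continuous fun t => X t ω) {N : ℕ} {ω : Ω} {t : ℝ}
    (ht : 0 ≤ t) (h : JJ X N t ω = 0) : ∀ᵐ s ∂(volume.restrict (Ioc 0 t)), |X s ω| ≤ N := by
  have hc : Continuous fun s => max (|X s ω| - (N:ℝ)) 0 := by
    have := hX ω
    fun_prop
  unfold JJ at h
  rw [abs_of_nonneg ht] at h
  have h' := (intervalIntegral.integral_eq_zero_iff_of_le_of_nonneg_ae ht
    (Filter.Eventually.of_forall fun u => le_max_right _ _) (hc.intervalIntegrable _ _)).1 h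
  filter_upwards [h'] with s hs
  have := le_max_left (|X s ω| - (N:ℝ)) 0
  have hs' : max (|X s ω| - (N:ℝ)) 0 = 0 := hs
  rw [hs'] at this
  simpa using this

/-- the glued result -/
lemma glue [IsProbabilityMeasure μ] {C : ℝ} {b : ℝ → ℝ → ℝ}
    (S : Setup G0 G μ r V W) (F : SF 𝓕 G μ V W) (hb : Measurable fun p : ℝ × ℝ => b p.1 p.2)
    (hC : 0 < C) (hbC : ∀ t ∈ Icc 0 T, ∀ z, |b t z| ≤ C * (1 + |z|)) (hT : 0 < T) (x : ℝ) :
    ∃ X : ℝ → Ω → ℝ, CA 𝓕 X ∧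
      (∀ᵐ ω ∂μ, ∀ t ∈ Icc 0 T, X t ω = x + (∫ s in (0:ℝ)..t, b s (X s ω)) + r * W t ω + V t ω) ∧
      ∀ Y : ℝ → Ω → ℝ, CA G Y →
        (∀ᵐ ω ∂μ, ∀ t ∈ Icc 0 T, Y t ω = x + (∫ s in (0:ℝ)..t, b s (Y s ω)) + r * W t ω + V t ω) →
        ∀ᵐ ω ∂μ, ∀ t ∈ Icc 0 T, X t ω = Y t ω := by
  choose Φ hΦ hΦe hΦu using fun N : ℕ => bounded_main S F (by positivity : 0 < C * (1 + N))
    (trc_meas hb N) (trc_bd hC hbC N) (trc_int hC hb hbC N) hT x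
  set Z : ℕ → ℝ → Ω → ℝ := fun N => st r V W (Φ N) with hZ
  have hVca : CA 𝓕 V := ⟨S.Vc, S.Vma, F.Vm⟩
  have hWca : CA 𝓕 W := ⟨S.Wc, S.Wma, F.Wm⟩
  have hZca : ∀ N, CA 𝓕 (Z N) := fun N => by
    refine ⟨fun ω => ?_, fun t => ?_, fun t ht => ?_⟩
    · exact (((hΦ N).cont ω).add ((S.Wc ω).const_mul r)).add (S.Vc ω)
    · exact (((hΦ N).meas t).add ((S.Wma t).const_mul r)).add (S.Vma t)
    · exact Measurable.add (m := 𝓕 t) (Measurable.add (m := 𝓕 t) ((hΦ N).adapted t ht)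
        (Measurable.const_mul (m := 𝓕 t) (F.Wm t ht) r)) (F.Vm t ht)
  have hZe : ∀ N, ∀ᵐ ω ∂μ, ∀ t ∈ Icc 0 T,
      Z N t ω = x + (∫ s in (0:ℝ)..t, trc T b N (s, Z N s ω)) + r * W t ω + V t ω := fun N => by
    filter_upwards [hΦe N] with ω hω t ht
    rw [← hω t ht]
    rfl
  -- localisation
  have loc : ∀ (b' : ℝ → ℝ → ℝ) (N : ℕ), (∀ s ∈ Icc 0 T, ∀ z : ℝ, |z| ≤ N → b' s z = b s z) →
      ∀ Y : ℝ → Ω → ℝ, CA G Y →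
      (∀ᵐ ω ∂μ, ∀ t ∈ Icc 0 T, Y t ω = x + (∫ s in (0:ℝ)..t, b' s (Y s ω)) + r * W t ω + V t ω) →
      ∀ᵐ ω ∂μ, (∀ t ∈ Icc 0 T, |Y t ω| ≤ N) → ∀ t ∈ Icc 0 T, Y t ω = Z N t ω := by
    intro b' N hbb Y hY hYe
    have := hΦu N Y (JJ Y N) hY (JJ_ca S.mono hY N) (JJ_mono hY.cont N) ?_
    · filter_upwards [this] with ω hω hle
      exact hω (JJ_zero hT.le hle)
    · filter_upwards [hYe] with ω hω t ht hJ
      rw [hω t ht]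
      congr 3
      rw [intervalIntegral.integral_of_le ht.1, intervalIntegral.integral_of_le ht.1]
      apply integral_congr_ae
      filter_upwards [JJ_ae hY.cont ht.1 hJ, ae_restrict_mem measurableSet_Ioc] with s hs hs'
      have hsT : s ∈ Icc 0 T := ⟨hs'.1.le, hs'.2.trans ht.2⟩
      rw [trc_eq hsT hs, hbb s hsT _ hs]
  have hbdd : ∀ Y : ℝ → Ω → ℝ, CA G Y → ∀ ω, ∃ N : ℕ, ∀ t ∈ Icc 0 T, |Y t ω| ≤ N := by
    intro Y hY ω
    obtain ⟨B, hB⟩ := isCompact_Icc.exists_bound_of_continuousOn (s := Icc 0 T)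
      (hY.cont ω).continuousOn
    obtain ⟨N, hN⟩ := exists_nat_ge B
    exact ⟨N, fun t ht => (hB t ht).trans hN⟩
  -- consistency
  have cons : ∀ᵐ ω ∂μ, ∀ N N' : ℕ, N ≤ N' → (∀ t ∈ Icc 0 T, |Z N' t ω| ≤ N) →
      ∀ t ∈ Icc 0 T, Z N' t ω = Z N t ω := by
    rw [ae_all_iff]; intro N
    rw [ae_all_iff]; intro N'
    by_cases h : N ≤ N'
    · filter_upwards [loc (fun s z => trc T b N' (s, z)) N (fun s hs z hz =>
        trc_eq hs (hz.trans (by exact_mod_cast h))) (Z N') ((hZca N').mono F.le) (hZe N')] with ω hω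
      exact fun _ => hω
    · exact Filter.Eventually.of_forall fun ω h' => absurd h' h
  have hZe' : ∀ᵐ ω ∂μ, ∀ N, ∀ t ∈ Icc 0 T,
      Z N t ω = x + (∫ s in (0:ℝ)..t, trc T b N (s, Z N s ω)) + r * W t ω + V t ω :=
    ae_all_iff.2 hZe
  have hgood : ∀ᵐ ω ∂μ, ∃ N0 : ℕ, (∀ N ≥ N0, ∀ t ∈ Icc 0 T, Z N t ω = Z N0 t ω) ∧
      ∀ t ∈ Icc 0 T, Z N0 t ω = x + (∫ s in (0:ℝ)..t, b s (Z N0 s ω)) + r * W t ω + V t ω := by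
    filter_upwards [cons, hZe'] with ω h1 h2
    obtain ⟨n, hn⟩ := hbdd W (hWca.mono F.le) ω
    obtain ⟨v, hv⟩ := hbdd V (hVca.mono F.le) ω
    obtain ⟨N0, hN0⟩ := exists_nat_ge (gronwallBound (|x| + |r| * n + v) C C T)
    have hle : ∀ N, ∀ t ∈ Icc 0 T, |Z N t ω| ≤ N0 := by
      intro N t ht
      refine (gron ((hZca N).cont ω) (by positivity) hC.le ?_ t ht).trans hN0
      intro t ht
      have hcZ : Continuous fun s => C * (1 + |Z N s ω|) := by
        have := (hZca N).cont ω
        fun_prop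
      have hI : |∫ s in (0:ℝ)..t, trc T b N (s, Z N s ω)| ≤ ∫ s in (0:ℝ)..t, C * (1 + |Z N s ω|) := by
        rw [← Real.norm_eq_abs]
        exact intervalIntegral.norm_integral_le_of_norm_le ht.1
          (Filter.Eventually.of_forall fun s _ => trc_le hC hbC N (s, Z N s ω))
          (hcZ.intervalIntegrable _ _)
      rw [h2 N t ht]
      have a1 := abs_add_le (x + (∫ s in (0:ℝ)..t, trc T b N (s, Z N s ω)) + r * W t ω) (V t ω)
      have a2 := abs_add_le (x + (∫ s in (0:ℝ)..t, trc T b N (s, Z N s ω))) (r * W t ω)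
      have a3 := abs_add_le x (∫ s in (0:ℝ)..t, trc T b N (s, Z N s ω))
      have a4 : |r * W t ω| ≤ |r| * n := by rw [abs_mul]; gcongr; exact hn t ht
      have a5 := hv t ht
      linarith
    refine ⟨N0, fun N hN => h1 N0 N hN (hle N), fun t ht => ?_⟩
    rw [h2 N0 t ht]
    congr 3
    apply intervalIntegral.integral_congr
    intro s hs
    rw [uIcc_of_le ht.1] at hs
    have hsT : s ∈ Icc 0 T := ⟨hs.1, hs.2.trans ht.2⟩
    beta_reduce
    rw [trc_eq hsT (hle N0 s hsT)]
  set Gd : Set Ω := {ω | ∃ N0 : ℕ, (∀ N ≥ N0, ∀ t ∈ Icc 0 T, Z N t ω = Z N0 t ω) ∧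
      ∀ t ∈ Icc 0 T, Z N0 t ω = x + (∫ s in (0:ℝ)..t, b s (Z N0 s ω)) + r * W t ω + V t ω} with hGd
  have hex : ∀ ω, ∃ φ : ℝ → ℝ, (ω ∈ Gd → Continuous φ ∧
      (∀ t, Filter.Tendsto (fun N => Z N (cl T t) ω) Filter.atTop (nhds (φ t))) ∧
      ∀ t ∈ Icc 0 T, φ t = x + (∫ s in (0:ℝ)..t, b s (φ s)) + r * W t ω + V t ω)
      ∧ (ω ∉ Gd → ∀ t, φ t = 0) := by
    intro ω
    by_cases h : ω ∈ Gd
    · obtain ⟨N0, hN, hE⟩ := h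
      refine ⟨fun t => Z N0 (cl T t) ω, fun _ => ⟨?_, ?_, ?_⟩, fun h' => absurd ⟨N0, hN, hE⟩ h'⟩
      · exact ((hZca N0).cont ω).comp (cl_lip T).continuous
      · intro t
        refine tendsto_const_nhds.congr' (Filter.eventually_atTop.2 ⟨N0, fun N hNN => ?_⟩)
        exact (hN N hNN _ (cl_mem hT.le t)).symm
      · intro t ht
        beta_reduce
        rw [cl_of_mem ht, hE t ht]
        congr 3
        apply intervalIntegral.integral_congr
        intro s hs
        rw [uIcc_of_le ht.1] at hs
        have hsT : s ∈ Icc 0 T := ⟨hs.1, hs.2.trans ht.2⟩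
        beta_reduce
        rw [cl_of_mem hsT]
    · exact ⟨fun _ => 0, fun h' => absurd h' h, fun _ _ => rfl⟩
  choose φ hφ hφ0 using hex
  have hXe : ∀ᵐ ω ∂μ, ∀ t ∈ Icc 0 T,
      φ ω t = x + (∫ s in (0:ℝ)..t, b s (φ ω s)) + r * W t ω + V t ω := by
    filter_upwards [hgood] with ω hω
    exact (hφ ω hω).2.2
  have hXca : CA 𝓕 (fun t ω => φ ω t) := by
    refine ca_limit (μ := μ) (fun t => (F.le t).trans (S.le t)) F.null
      (Y := fun n t ω => Z n (cl T t) ω) (Gd := Gd) ?_ hgood (fun ω hω => (hφ ω hω).2.1)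
      (fun ω hω => (hφ ω hω).1) hφ0
    intro n
    exact ca_clamp F.mono (fun t => (F.le t).trans (S.le t)) hT.le
      (fun ω => ((hZca n).cont ω).continuousOn) (fun t ht => (hZca n).adapted t ht.1)
  refine ⟨fun t ω => φ ω t, hXca, hXe, ?_⟩
  intro Y hY hYe
  have u1 : ∀ᵐ ω ∂μ, ∀ N : ℕ, (∀ t ∈ Icc 0 T, |φ ω t| ≤ N) → ∀ t ∈ Icc 0 T, φ ω t = Z N t ω :=
    ae_all_iff.2 fun N => loc b N (fun _ _ _ _ => rfl) _ (hXca.mono F.le) hXe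
  have u2 : ∀ᵐ ω ∂μ, ∀ N : ℕ, (∀ t ∈ Icc 0 T, |Y t ω| ≤ N) → ∀ t ∈ Icc 0 T, Y t ω = Z N t ω :=
    ae_all_iff.2 fun N => loc b N (fun _ _ _ _ => rfl) _ hY hYe
  filter_upwards [u1, u2] with ω h1 h2 t ht
  obtain ⟨n1, hn1⟩ := hbdd _ (hXca.mono F.le) ω
  obtain ⟨n2, hn2⟩ := hbdd _ hY ω
  rw [h1 (max n1 n2) (fun t ht => (hn1 t ht).trans (by exact_mod_cast le_max_left _ _)) t ht,
    h2 (max n1 n2) (fun t ht => (hn2 t ht).trans (by exact_mod_cast le_max_right _ _)) t ht]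

end

/-! ### Part 15: Brownian facts -/

lemma indep_sup_aux {Ω : Type*} {m0 m1 m2 m3 : MeasurableSpace Ω} [mΩ : MeasurableSpace Ω]
    {μ : Measure Ω} [IsProbabilityMeasure μ] (h0 : m0 ≤ mΩ) (h3 : m3 ≤ mΩ) (h13 : m1 ≤ m3)
    (h23 : m2 ≤ m3) (h03 : Indep m0 m3 μ) (h12 : Indep m1 m2 μ) : Indep (m0 ⊔ m1) m2 μ := by
  have e1 : m0 ⊔ m1 = MeasurableSpace.generateFrom
      (image2 (· ∩ ·) {s | MeasurableSet[m0] s} {s | MeasurableSet[m1] s}) := by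
    apply le_antisymm
    · refine sup_le (fun s hs => ?_) (fun s hs => ?_)
      · exact MeasurableSpace.measurableSet_generateFrom
          ⟨s, hs, univ, @MeasurableSet.univ Ω m1, inter_univ s⟩
      · exact MeasurableSpace.measurableSet_generateFrom
          ⟨univ, @MeasurableSet.univ Ω m0, s, hs, univ_inter s⟩
    · refine MeasurableSpace.generateFrom_le ?_
      rintro s ⟨a, ha, b, hb, rfl⟩
      exact @MeasurableSet.inter Ω (m0 ⊔ m1) _ _ ((le_sup_left : m0 ≤ m0 ⊔ m1) a ha)
        ((le_sup_right : m1 ≤ m0 ⊔ m1) b hb)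
  refine IndepSets.indep (sup_le h0 (h13.trans h3)) (h23.trans h3) ?_
    (@MeasurableSpace.isPiSystem_measurableSet Ω m2) e1
    (@MeasurableSpace.generateFrom_measurableSet Ω m2).symm ?_
  · rintro s ⟨a, ha, b, hb, rfl⟩ s' ⟨a', ha', b', hb', rfl⟩ -
    refine ⟨a ∩ a', ?_, b ∩ b', ?_, ?_⟩
    · exact @MeasurableSet.inter Ω m0 _ _ ha ha'
    · exact @MeasurableSet.inter Ω m1 _ _ hb hb'
    · simp only; exact inter_inter_inter_comm _ _ _ _
  · rw [IndepSets_iff]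
    rintro s e ⟨a, ha, b, hb, rfl⟩ he
    rw [Indep_iff] at h03 h12
    simp only
    rw [inter_assoc, h03 a (b ∩ e) ha (@MeasurableSet.inter Ω m3 _ _ (h13 _ hb) (h23 _ he)),
      h12 b e hb he, h03 a b ha (h13 _ hb), mul_assoc]

lemma indep_null {Ω : Type*} {m1 m2 : MeasurableSpace Ω} [mΩ : MeasurableSpace Ω]
    {μ : Measure Ω} (h12 : Indep m1 m2 μ) :
    Indep (m1 ⊔ MeasurableSpace.generateFrom {A : Set Ω | μ A = 0}) m2 μ := by
  have hle : m1 ⊔ MeasurableSpace.generateFrom {A : Set Ω | μ A = 0} ≤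
      eventuallyMeasurableSpace m1 (ae μ) := by
    refine sup_le (fun _ h => le_eventuallyMeasurableSpace _ h) (MeasurableSpace.generateFrom_le ?_)
    intro A hA
    exact ⟨∅, @MeasurableSet.empty Ω m1, ae_eq_empty.2 hA⟩
  rw [Indep_iff] at h12 ⊢
  intro s e hs he
  obtain ⟨s', hs', hss⟩ := hle s hs
  rw [measure_congr (hss.inter (ae_eq_refl e)), measure_congr hss, h12 s' e hs' he]

lemma IsFBM.preBM {Ω : Type*} [mΩ : MeasurableSpace Ω] {μ : Measure Ω} [IsProbabilityMeasure μ]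
    {W : ℝ → Ω → ℝ} (hW : IsFBM μ (1 / 2) W) :
    IsPreBrownianReal (fun t : ℝ≥0 => W t) μ := by
  have hlaw : ∀ t, ∃ v : ℝ≥0, μ.map (W t) = gaussianReal 0 v := by
    intro t
    obtain ⟨v, hv⟩ := hW.gaussian 1 (fun _ => t) (fun _ => 1)
    exact ⟨v, by simpa using hv⟩
  have hmean : ∀ t, ∫ ω, W t ω ∂μ = 0 := by
    intro t
    obtain ⟨v, hv⟩ := hlaw t
    have h1 : ∫ x, x ∂(μ.map (W t)) = ∫ ω, W t ω ∂μ :=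
      integral_map (hW.meas t).aemeasurable aestronglyMeasurable_id
    rw [← h1, hv, integral_id_gaussianReal]
  have hL2 : ∀ t, MemLp (W t) 2 μ := by
    intro t
    obtain ⟨v, hv⟩ := hlaw t
    have h1 : MemLp id 2 (μ.map (W t)) := by rw [hv]; exact memLp_id_gaussianReal 2
    exact (memLp_map_measure_iff aestronglyMeasurable_id (hW.meas t).aemeasurable).1 h1
  refine IsGaussianProcess.isPreBrownianReal_of_covariance ⟨fun I => ⟨?_⟩⟩ (fun t => hmean t) ?_
  · refine isGaussian_of_map_eq_gaussianReal fun L => ?_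
    let e := I.equivFin
    obtain ⟨v, hv⟩ := hW.gaussian I.card (fun i => ((e.symm i : ℝ≥0) : ℝ))
      (fun i => L (Pi.single (e.symm i) 1))
    refine ⟨0, v, ?_⟩
    have hm : Measurable fun ω => I.restrict fun t : ℝ≥0 => W t ω :=
      measurable_pi_lambda _ fun i => hW.meas _
    rw [← hv, Measure.map_map L.continuous.measurable hm]
    congr 1
    ext ω
    simp only [Function.comp_apply]
    rw [e.symm.sum_comp (fun i : I => L (Pi.single i 1) * W ((i : ℝ≥0) : ℝ) ω)]
    have h2 := LinearMap.pi_apply_eq_sum_univ (L : (I → ℝ) →ₗ[ℝ] ℝ)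
      (I.restrict fun t : ℝ≥0 => W t ω)
    simp only [ContinuousLinearMap.coe_coe] at h2
    rw [h2]
    refine Finset.sum_congr rfl fun i _ => ?_
    rw [smul_eq_mul, mul_comm]
    congr 2
    ext j
    simp [Pi.single_apply, eq_comm]
  · intro s t hst
    rw [covariance_eq_sub (hL2 s) (hL2 t), hmean, hmean]
    have h1 := hW.cov t s t.2 s.2
    simp only [Pi.mul_apply]
    rw [h1]
    have h2 : (s : ℝ) ≤ t := hst
    rw [abs_of_nonpos (by linarith)]
    norm_num
    ring

/-- the big filtration -/
def bigG {Ω : Type*} [MeasurableSpace Ω] (μ : Measure Ω) (B W : ℝ → Ω → ℝ) (t : ℝ) :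
    MeasurableSpace Ω :=
  (MeasurableSpace.comap (fun ω => fun t : ℝ => B t ω) MeasurableSpace.pi ⊔
    ⨆ s ∈ Icc (0:ℝ) t, MeasurableSpace.comap (W s) inferInstance) ⊔
    MeasurableSpace.generateFrom {A : Set Ω | μ A = 0}

section
variable {Ω : Type*} [mΩ : MeasurableSpace Ω] {μ : Measure Ω} {B W : ℝ → Ω → ℝ}

lemma bigG_le (hμc : μ.IsComplete) (hB : ∀ t, Measurable (B t)) (hW : ∀ t, Measurable (W t))
    (t : ℝ) : bigG μ B W t ≤ mΩ := by
  refine sup_le (sup_le ?_ (iSup₂_le fun s _ => (hW s).comap_le))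
    (MeasurableSpace.generateFrom_le fun A hA => hμc.out' A hA)
  exact (measurable_pi_lambda _ fun t => hB t).comap_le

lemma comap_le_path (t : ℝ) : MeasurableSpace.comap (B t) inferInstance ≤
    MeasurableSpace.comap (fun ω => fun t : ℝ => B t ω) MeasurableSpace.pi := by
  rw [← measurable_iff_comap_le]
  exact (measurable_pi_apply (X := fun _ : ℝ => ℝ) t).comp
    (comap_measurable (fun ω => fun t : ℝ => B t ω))

lemma aug_le_bigG (t : ℝ) : augPairFiltration μ B W t ≤ bigG μ B W t := by
  refine sup_le_sup_right (iSup₂_le fun s hs => sup_le ?_ ?_) _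
  · exact (comap_le_path s).trans le_sup_left
  · exact (le_iSup₂ (f := fun s (_ : s ∈ Icc (0:ℝ) t) =>
      MeasurableSpace.comap (W s) inferInstance) s hs).trans le_sup_right

lemma mkSF {ρ : ℝ} : SF (augPairFiltration μ B W) (bigG μ B W) μ (fun t ω => ρ * B t ω) W := by
  have h1 : ∀ t, 0 ≤ t → MeasurableSpace.comap (B t) inferInstance ⊔
      MeasurableSpace.comap (W t) inferInstance ≤ augPairFiltration μ B W t := fun t ht =>
    (le_iSup₂ (f := fun s (_ : s ∈ Icc (0:ℝ) t) =>
      MeasurableSpace.comap (B s) inferInstance ⊔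
      MeasurableSpace.comap (W s) inferInstance) t ⟨ht, le_rfl⟩).trans le_sup_left
  refine ⟨fun s t hst => ?_, aug_le_bigG, fun t ht => ?_, fun t ht => ?_, fun t A hA => ?_⟩
  · refine sup_le_sup_right (iSup₂_le fun u hu => ?_) _
    exact le_iSup₂ (f := fun s (_ : s ∈ Icc (0:ℝ) t) =>
      MeasurableSpace.comap (B s) inferInstance ⊔
      MeasurableSpace.comap (W s) inferInstance) u ⟨hu.1, hu.2.trans hst⟩
  · have : Measurable[augPairFiltration μ B W t] (B t) :=
      measurable_iff_comap_le.2 (le_sup_left.trans (h1 t ht))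
    exact (measurable_const_mul ρ).comp this
  · exact measurable_iff_comap_le.2 (le_sup_right.trans (h1 t ht))
  · exact (le_sup_right : _ ≤ augPairFiltration μ B W t) A
      (MeasurableSpace.measurableSet_generateFrom hA)

lemma mkSetup [IsProbabilityMeasure μ] (hμc : μ.IsComplete) {H ρ₁ ρ₂ : ℝ} (hρ₂ : ρ₂ ≠ 0)
    (hB : IsFBM μ H B) (hBcont : ∀ ω, Continuous fun t => B t ω)
    (hW : IsFBM μ (1 / 2) W) (hWcont : ∀ ω, Continuous fun t => W t ω)
    (hindep : IndepFun (fun ω => fun t : ℝ => B t ω) (fun ω => fun t : ℝ => W t ω) μ) :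
    Setup (MeasurableSpace.comap (fun ω => fun t : ℝ => B t ω) MeasurableSpace.pi)
      (bigG μ B W) μ ρ₂ (fun t ω => ρ₁ * B t ω) W where
  hr := hρ₂
  G0_le t := le_sup_left.trans le_sup_left
  mono s t hst := by
    refine sup_le_sup_right (sup_le_sup_left (iSup₂_le fun u hu => ?_) _) _
    exact le_iSup₂ (f := fun s (_ : s ∈ Icc (0:ℝ) t) =>
      MeasurableSpace.comap (W s) inferInstance) u ⟨hu.1, hu.2.trans hst⟩
  le := bigG_le hμc hB.meas hW.meas
  Vm t := by
    have h := measurable_iff_comap_le.2 (comap_le_path (B := B) t)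
    exact (measurable_const_mul ρ₁).comp h
  Vc ω := (hBcont ω).const_mul ρ₁
  Wm t ht := by
    refine measurable_iff_comap_le.2 (le_trans ?_ le_sup_left)
    exact (le_iSup₂ (f := fun s (_ : s ∈ Icc (0:ℝ) t) =>
      MeasurableSpace.comap (W s) inferInstance) t ⟨ht, le_rfl⟩).trans le_sup_right
  Wma := hW.meas
  Wc := hWcont
  indep s t hs hst := by
    refine indep_null (indep_sup_aux (m3 := MeasurableSpace.comap
      (fun ω => fun t : ℝ => W t ω) MeasurableSpace.pi) ?_ ?_ ?_ ?_ hindep ?_)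
    · exact (measurable_pi_lambda _ fun t => hB.meas t).comap_le
    · exact (measurable_pi_lambda _ fun t => hW.meas t).comap_le
    · exact iSup₂_le fun u _ => comap_le_path u
    · rw [← measurable_iff_comap_le]
      have h : ∀ u, Measurable[MeasurableSpace.comap
          (fun ω => fun t : ℝ => W t ω) MeasurableSpace.pi] (W u) := fun u =>
        measurable_iff_comap_le.2 (comap_le_path u)
      exact (h t).sub (h s)
    · obtain ⟨s', rfl⟩ : ∃ s' : ℝ≥0, (s' : ℝ) = s := ⟨⟨s, hs⟩, rfl⟩
      have h := hW.preBM.indepFun_shift s'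
      have h' := (IndepFun_iff_Indep _ _ _).1 h.symm
      refine indep_of_indep_of_le_left (indep_of_indep_of_le_right h' ?_) ?_
      · rw [← measurable_iff_comap_le]
        obtain ⟨d, hd⟩ : ∃ d : ℝ≥0, (d : ℝ) = t - s' := ⟨⟨t - s', by linarith⟩, rfl⟩
        have h2 := (measurable_pi_apply d).comp (comap_measurable
          (fun ω (u : ℝ≥0) => W ((s' + u : ℝ≥0) : ℝ) ω - W (s' : ℝ) ω))
        have e : ((s' + d : ℝ≥0) : ℝ) = t := by
          rw [NNReal.coe_add, hd]
          ring
        rw [← e]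
        exact h2
      · refine iSup₂_le fun u hu => ?_
        rw [← measurable_iff_comap_le]
        exact (measurable_pi_apply (⟨⟨u, hu.1⟩, hu.2⟩ : Iic s')).comp
          (comap_measurable (fun ω (u : Iic s') => W ((u : ℝ≥0) : ℝ) ω))
  law s t hs hst := by
    have h := (hW.preBM.hasLaw_sub ⟨t, hs.trans hst.le⟩ ⟨s, hs⟩).map_eq
    have e : nndist t s = (t - s).toNNReal := by
      rw [← NNReal.coe_inj, coe_nndist, Real.dist_eq, Real.coe_toNNReal _ (by linarith),
        abs_of_pos (by linarith)]
    rw [← e]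
    exact h

end

/-- Theorem `Ouknine`: existence and uniqueness of a strong solution to
`X_t = x + ∫_0^t b(u,X_u)du + ρ₁B^H_t + ρ₂W_t` for `H < 1/2`, where `b` is the sum of a
bounded measurable function and a Lipschitz function of linear growth. -/
theorem stmt7 {Ω : Type*} [MeasurableSpace Ω] (μ : Measure Ω) [IsProbabilityMeasure μ]
    (hμc : μ.IsComplete) (H T : ℝ) (hH0 : 0 < H) (hH : H < 1 / 2) (hT : 0 < T)
    (ρ₁ ρ₂ : ℝ) (hρ₁ : ρ₁ ≠ 0) (hρ₂ : ρ₂ ≠ 0)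
    (B W : ℝ → Ω → ℝ) (hB : IsFBM μ H B) (hBcont : ∀ ω, Continuous fun t => B t ω)
    (hW : IsFBM μ (1 / 2) W) (hWcont : ∀ ω, Continuous fun t => W t ω)
    (hindep : IndepFun (fun ω => fun t : ℝ => B t ω) (fun ω => fun t : ℝ => W t ω) μ)
    (b btilde bhat : ℝ → ℝ → ℝ)
    (hdecomp : ∀ t x, b t x = btilde t x + bhat t x)
    (htmeas : Measurable fun p : ℝ × ℝ => btilde p.1 p.2)
    (htbdd : ∃ M : ℝ, ∀ t x, |btilde t x| ≤ M)
    (hhmeas : Measurable fun p : ℝ × ℝ => bhat p.1 p.2)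
    (K C : ℝ)
    (hhlip : ∀ t ∈ Set.Icc (0 : ℝ) T, ∀ x y : ℝ, |bhat t x - bhat t y| ≤ K * |x - y|)
    (hhgrowth : ∀ t ∈ Set.Icc (0 : ℝ) T, ∀ x : ℝ, |bhat t x| ≤ C * (1 + |x|)) :
    ∀ x : ℝ, ∃ X : ℝ → Ω → ℝ,
      ((∀ ω, ContinuousOn (fun t => X t ω) (Set.Icc 0 T)) ∧
        (∀ t ∈ Set.Icc (0 : ℝ) T, Measurable[augPairFiltration μ B W t] (X t)) ∧
        (∀ᵐ ω ∂μ, ∀ t ∈ Set.Icc (0 : ℝ) T,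
            X t ω = x + (∫ u in Set.Ioc (0 : ℝ) t, b u (X u ω)) +
              ρ₁ * B t ω + ρ₂ * W t ω)) ∧
      ∀ Y : ℝ → Ω → ℝ,
        ((∀ ω, ContinuousOn (fun t => Y t ω) (Set.Icc 0 T)) ∧
          (∀ t ∈ Set.Icc (0 : ℝ) T, Measurable[augPairFiltration μ B W t] (Y t)) ∧
          (∀ᵐ ω ∂μ, ∀ t ∈ Set.Icc (0 : ℝ) T,
              Y t ω = x + (∫ u in Set.Ioc (0 : ℝ) t, b u (Y u ω)) +
                ρ₁ * B t ω + ρ₂ * W t ω)) →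
        ∀ᵐ ω ∂μ, ∀ t ∈ Set.Icc (0 : ℝ) T, X t ω = Y t ω := by
  intro x
  obtain ⟨M, hM⟩ := htbdd
  have hb : Measurable fun p : ℝ × ℝ => b p.1 p.2 := by
    have : (fun p : ℝ × ℝ => b p.1 p.2) = fun p => btilde p.1 p.2 + bhat p.1 p.2 := by
      ext p; exact hdecomp _ _
    rw [this]
    exact htmeas.add hhmeas
  have hbC : ∀ t ∈ Set.Icc (0:ℝ) T, ∀ z, |b t z| ≤ (|M| + |C| + 1) * (1 + |z|) := by
    intro t ht z
    rw [hdecomp]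
    have h1 := abs_add_le (btilde t z) (bhat t z)
    have h2 := (hM t z).trans (le_abs_self M)
    have h3 := hhgrowth t ht z
    have h4 : C * (1 + |z|) ≤ |C| * (1 + |z|) :=
      mul_le_mul_of_nonneg_right (le_abs_self C) (by positivity)
    nlinarith [mul_nonneg (abs_nonneg M) (abs_nonneg z), abs_nonneg z]
  have S := mkSetup hμc (ρ₁ := ρ₁) hρ₂ hB hBcont hW hWcont hindep
  have F : SF (augPairFiltration μ B W) (bigG μ B W) μ (fun t ω => ρ₁ * B t ω) W := mkSF
  obtain ⟨X, hX, hXe, hXu⟩ := glue S F hb (by positivity) hbC hT x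
  refine ⟨X, ⟨fun ω => (hX.cont ω).continuousOn, fun t ht => hX.adapted t ht.1, ?_⟩, ?_⟩
  · filter_upwards [hXe] with ω hω t ht
    rw [hω t ht, intervalIntegral.integral_of_le ht.1]
    ring
  · rintro Y ⟨hYc, hYm, hYe⟩
    have hca := CA.mono (G := bigG μ B W) F.le
      (ca_clamp F.mono (fun t => (F.le t).trans (S.le t)) hT.le hYc hYm)
    have h := hXu _ hca ?_
    · filter_upwards [h] with ω hω t ht
      have := hω t ht
      rwa [cl_of_mem ht] at this
    · filter_upwards [hYe] with ω hω t ht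
      rw [cl_of_mem ht, hω t ht, intervalIntegral.integral_of_le ht.1]
      have e : ∫ u in Set.Ioc (0 : ℝ) t, b u (Y u ω) =
          ∫ u in Set.Ioc (0 : ℝ) t, b u (Y (cl T u) ω) := by
        refine setIntegral_congr_fun measurableSet_Ioc fun u hu => ?_
        rw [cl_of_mem ⟨hu.1.le, hu.2.trans ht.2⟩]
      rw [e]
      ring
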